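/- There is a positive absolute constant C such that the following holds. For every ψ ∈ Ψ₁ (modulo p), if 1/2 + iγ and 1/2 + iγ' are zeros of s ↦ L(s,ψ)L(s,χψ) lying in Ω with γ < γ', and no zero of L(s,ψ)L(s,χψ) has imaginary part strictly between γ and γ', then |γ' − γ − α| ≤ C·α²·𝓛, where α = π/log P. -/

import Mathlib

open scoped Classical

noncomputable section

/-- The Dirichlet L-function of `χ` (extended to modulus `0` by `0`, a case never used below). -/
def Lfun {N : ℕ} (χ : DirichletCharacter ℂ N) (s : ℂ) : ℂ :=
  if h : N = 0 then 0
  else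
    haveI : NeZero N := ⟨h⟩
    DirichletCharacter.LFunction χ s

/-- A Dirichlet character is *real* if all of its values are real numbers. -/
def IsRealChar {N : ℕ} (χ : DirichletCharacter ℂ N) : Prop :=
  ∀ a : ZMod N, (χ a).im = 0

/-- `𝓛 = log D`. -/
def bigL (D : ℕ) : ℝ := Real.log D

/-- `P = exp (𝓛 ^ 9)`. -/
def bigP (D : ℕ) : ℝ := Real.exp (bigL D ^ 9)

/-- Assumption (A): `L(1, χ) < 𝓛 ^ (-2022)`. -/
def AssumptionA (D : ℕ) (χ : DirichletCharacter ℂ D) : Prop :=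
  (Lfun χ 1).re < bigL D ^ (-2022 : ℤ)

/-- `p ~ P`, i.e. `p` is a prime with `P < p < P * (1 + 𝓛 ^ (-68))`. -/
def SimP (D p : ℕ) : Prop :=
  p.Prime ∧ bigP D < (p : ℝ) ∧ (p : ℝ) < bigP D * (1 + bigL D ^ (-68 : ℤ))

/-- The finite set of primes `p ~ P`. -/
def primesP (D : ℕ) : Finset ℕ :=
  (Finset.range ⌈2 * bigP D⌉₊).filter (SimP D)

/-- `𝒫 = ∑_{p ~ P} p`. -/
def calP (D : ℕ) : ℝ := ∑ p ∈ primesP D, (p : ℝ)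

/-- `ν(n) = ∑_{d ∣ n} χ(d)`. -/
def nuF (D : ℕ) (χ : DirichletCharacter ℂ D) (n : ℕ) : ℂ :=
  ∑ d ∈ n.divisors, χ (d : ZMod D)

/-- `υ(n) = ∑_{ab = n} μ(a) μ(b) χ(b)`. -/
def upsF (D : ℕ) (χ : DirichletCharacter ℂ D) (n : ℕ) : ℂ :=
  ∑ d ∈ n.divisors,
    ((ArithmeticFunction.moebius (n / d) : ℤ) : ℂ) * ((ArithmeticFunction.moebius d : ℤ) : ℂ) *
      χ (d : ZMod D)

/-- `t₀ = 𝓛 ^ 519`. -/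
def t0 (D : ℕ) : ℝ := bigL D ^ 519

/-- `s₀ = 1/2 + 2 π i t₀`. -/
def s0 (D : ℕ) : ℂ := 1 / 2 + 2 * (Real.pi : ℂ) * Complex.I * (t0 D : ℂ)

/-- `𝓛₁ = 𝓛 ^ 405`. -/
def bigL1 (D : ℕ) : ℝ := bigL D ^ 405

/-- `ν` truncated to `n ≤ D ^ 4`, as an arithmetic function. -/
def nuT (D : ℕ) (χ : DirichletCharacter ℂ D) : ArithmeticFunction ℂ :=
  ⟨fun n => if n = 0 then 0 else if n ≤ D ^ 4 then nuF D χ n else 0, by simp⟩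

/-- `υ` truncated to `n ≤ D ^ 4`, as an arithmetic function. -/
def upsT (D : ℕ) (χ : DirichletCharacter ℂ D) : ArithmeticFunction ℂ :=
  ⟨fun n => if n = 0 then 0 else if n ≤ D ^ 4 then upsF D χ n else 0, by simp⟩

/-- `ν₂₀`, the 20-fold Dirichlet convolution of the truncation of `ν`. -/
def nu20 (D : ℕ) (χ : DirichletCharacter ℂ D) (n : ℕ) : ℂ := (nuT D χ ^ 20) n

/-- `υ₂₀`, the 20-fold Dirichlet convolution of the truncation of `υ`. -/
def ups20 (D : ℕ) (χ : DirichletCharacter ℂ D) (n : ℕ) : ℂ := (upsT D χ ^ 20) n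

/-- `ς(n) = ∑_{lm = n, l ≤ D⁴, m ≤ D⁴} ν(l) υ(m)`. -/
def sigF (D : ℕ) (χ : DirichletCharacter ℂ D) (n : ℕ) : ℂ :=
  ∑ d ∈ n.divisors,
    if d ≤ D ^ 4 ∧ n / d ≤ D ^ 4 then nuF D χ d * upsF D χ (n / d) else 0

/-- `X₁(x, ψ) = ∑_{n ≤ x} ν₂₀(n) ψ(n) n^{-s₀}`. -/
def X1 (D : ℕ) (χ : DirichletCharacter ℂ D) {p : ℕ} (ψ : DirichletCharacter ℂ p) (x : ℝ) : ℂ :=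
  ∑ n ∈ Finset.Icc 1 ⌊x⌋₊, nu20 D χ n * ψ (n : ZMod p) * (n : ℂ) ^ (-s0 D)

/-- `X₂(x, ψ) = ∑_{n ≤ x} υ₂₀(n) ψ(n) n^{-s₀}`. -/
def X2 (D : ℕ) (χ : DirichletCharacter ℂ D) {p : ℕ} (ψ : DirichletCharacter ℂ p) (x : ℝ) : ℂ :=
  ∑ n ∈ Finset.Icc 1 ⌊x⌋₊, ups20 D χ n * ψ (n : ZMod p) * (n : ℂ) ^ (-s0 D)

/-- `X₃(x, ψ) = ∑_{D⁴ < n ≤ x} ν(n) ψ(n) n^{-s₀}`. -/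
def X3 (D : ℕ) (χ : DirichletCharacter ℂ D) {p : ℕ} (ψ : DirichletCharacter ℂ p) (x : ℝ) : ℂ :=
  ∑ n ∈ Finset.Ioc (D ^ 4) ⌊x⌋₊, nuF D χ n * ψ (n : ZMod p) * (n : ℂ) ^ (-s0 D)

/-- `X₄(x, ψ) = ∑_{D⁴ < n ≤ x} ς(n) ψ(n) n^{-s₀}`. -/
def X4 (D : ℕ) (χ : DirichletCharacter ℂ D) {p : ℕ} (ψ : DirichletCharacter ℂ p) (x : ℝ) : ℂ :=
  ∑ n ∈ Finset.Ioc (D ^ 4) ⌊x⌋₊, sigF D χ n * ψ (n : ZMod p) * (n : ℂ) ^ (-s0 D)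

/-- Inequality (3.4). -/
def Ineq1 (D : ℕ) (χ : DirichletCharacter ℂ D) {p : ℕ} (ψ : DirichletCharacter ℂ p) : Prop :=
  ‖X1 D χ ψ ((D : ℝ) ^ 80)‖ + ‖X2 D χ ψ ((D : ℝ) ^ 80)‖ +
      (∫ x in (1 : ℝ)..((D : ℝ) ^ 80), (‖X1 D χ ψ x‖ + ‖X2 D χ ψ x‖) / x) <
    bigL D ^ 1171

/-- Inequality (3.5). -/
def Ineq2 (D : ℕ) (χ : DirichletCharacter ℂ D) {p : ℕ} (ψ : DirichletCharacter ℂ p) : Prop :=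
  ‖X3 D χ ψ (bigP D ^ 2)‖ + (∫ x in ((D : ℝ) ^ 4)..(bigP D ^ 2), ‖X3 D χ ψ x‖ / x) <
    bigL D ^ (-585 : ℤ)

/-- Inequality (3.6). -/
def Ineq3 (D : ℕ) (χ : DirichletCharacter ℂ D) {p : ℕ} (ψ : DirichletCharacter ℂ p) : Prop :=
  ‖X4 D χ ψ ((D : ℝ) ^ 8)‖ + (∫ x in ((D : ℝ) ^ 4)..((D : ℝ) ^ 8), ‖X4 D χ ψ x‖ / x) <
    bigL D ^ (-633 : ℤ)

/-- Membership in `Ψ₁`: `ψ` is a primitive character mod `p` with `p ~ P` satisfying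
(3.4), (3.5) and (3.6). -/
def MemPsi1 (D : ℕ) (χ : DirichletCharacter ℂ D) {p : ℕ} (ψ : DirichletCharacter ℂ p) : Prop :=
  SimP D p ∧ ψ.IsPrimitive ∧ Ineq1 D χ ψ ∧ Ineq2 D χ ψ ∧ Ineq3 D χ ψ

/-- `F(s, ψ) = ∑_{n ≤ D⁴} ν(n) ψ(n) n^{-s}`. -/
def Ffun (D : ℕ) (χ : DirichletCharacter ℂ D) {p : ℕ} (ψ : DirichletCharacter ℂ p) (s : ℂ) : ℂ :=
  ∑ n ∈ Finset.Icc 1 (D ^ 4), nuF D χ n * ψ (n : ZMod p) * (n : ℂ) ^ (-s)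

/-- `G(s, ψ) = ∑_{n ≤ D⁴} υ(n) ψ(n) n^{-s}`. -/
def Gfun (D : ℕ) (χ : DirichletCharacter ℂ D) {p : ℕ} (ψ : DirichletCharacter ℂ p) (s : ℂ) : ℂ :=
  ∑ n ∈ Finset.Icc 1 (D ^ 4), upsF D χ n * ψ (n : ZMod p) * (n : ℂ) ^ (-s)

/-- `F'(s, ψ) = -∑_{n ≤ D⁴} ν(n) ψ(n) (log n) n^{-s}`, the derivative of `F` in `s`. -/
def Ffun' (D : ℕ) (χ : DirichletCharacter ℂ D) {p : ℕ} (ψ : DirichletCharacter ℂ p) (s : ℂ) : ℂ :=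
  -∑ n ∈ Finset.Icc 1 (D ^ 4),
    nuF D χ n * ψ (n : ZMod p) * ((Real.log n : ℝ) : ℂ) * (n : ℂ) ^ (-s)

/-- `F(1 - s, ψ̄) = ∑_{n ≤ D⁴} ν(n) conj(ψ(n)) n^{s - 1}`, as a function of `s`. -/
def FfunBar (D : ℕ) (χ : DirichletCharacter ℂ D) {p : ℕ} (ψ : DirichletCharacter ℂ p)
    (s : ℂ) : ℂ :=
  ∑ n ∈ Finset.Icc 1 (D ^ 4),
    nuF D χ n * (starRingEnd ℂ) (ψ (n : ZMod p)) * (n : ℂ) ^ (s - 1)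

/-- The region `Ω`. -/
def InOmega (D : ℕ) (s : ℂ) : Prop :=
  |(s - s0 D).re| < 1 / 2 ∧ |(s - s0 D).im| < bigL1 D + 2

/-- The region `Ω₁`. -/
def InOmega1 (D : ℕ) (s : ℂ) : Prop :=
  1 / 2 - Real.log (bigL D) / (100 * bigL D) < s.re ∧
    s.re < 1 + Real.log (bigL D) / (100 * bigL D) ∧
    |s.im - 2 * Real.pi * t0 D| < bigL1 D + 5

/-- The region `Ω₂`. -/
def InOmega2 (D : ℕ) (s : ℂ) : Prop :=
  1 / 2 - (bigL D)⁻¹ < s.re ∧ s.re < 1 + (bigL D)⁻¹ ∧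
    |s.im - 2 * Real.pi * t0 D| < bigL1 D + 4

/-- `α = π / log P`. -/
def alphaD (D : ℕ) : ℝ := Real.pi / Real.log (bigP D)

/-- The region `Ω₃`. -/
def InOmega3 (D : ℕ) (s : ℂ) : Prop :=
  1 / 2 - alphaD D < s.re ∧ s.re < 1 + alphaD D ∧
    |s.im - 2 * Real.pi * t0 D| < bigL1 D + 3

/-- The Gauss sum `τ(θ) = ∑_{a mod k} θ(a) e(a/k)`. -/
def tauSum {k : ℕ} (θ : DirichletCharacter ℂ k) : ℂ :=
  ∑ a ∈ Finset.range k,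
    θ (a : ZMod k) * Complex.exp (2 * (Real.pi : ℂ) * Complex.I * (a : ℂ) / (k : ℂ))

/-- The factor `Z(s, θ)` from the functional equation. -/
def Zfun {k : ℕ} (θ : DirichletCharacter ℂ k) (s : ℂ) : ℂ :=
  if θ (-1) = 1 then
    tauSum θ * (Real.pi : ℂ) ^ (s - 1 / 2) * (k : ℂ) ^ (-s) *
      Complex.Gamma ((1 - s) / 2) / Complex.Gamma (s / 2)
  else
    -Complex.I * tauSum θ * (Real.pi : ℂ) ^ (s - 1 / 2) * (k : ℂ) ^ (-s) *
      Complex.Gamma ((2 - s) / 2) / Complex.Gamma ((1 + s) / 2)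

/-- The product character `χψ` modulo `D * p`, i.e. `n ↦ χ(n) ψ(n)`. -/
def chiPsi (D : ℕ) (χ : DirichletCharacter ℂ D) {p : ℕ} (ψ : DirichletCharacter ℂ p) :
    DirichletCharacter ℂ (D * p) :=
  DirichletCharacter.changeLevel (dvd_mul_right D p) χ *
    DirichletCharacter.changeLevel (dvd_mul_left p D) ψ

/-- `Z̃(s, ψ) = Z(s, ψ) Z(s, χψ)`. -/
def Ztilde (D : ℕ) (χ : DirichletCharacter ℂ D) {p : ℕ} (ψ : DirichletCharacter ℂ p)
    (s : ℂ) : ℂ :=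
  Zfun ψ s * Zfun (chiPsi D χ ψ) s

/-- `T = exp (𝓛 ^ 1.1)`. -/
def bigT (D : ℕ) : ℝ := Real.exp (bigL D ^ (1.1 : ℝ))

/-- `P₄ = P T⁻² t₀`. -/
def P4 (D : ℕ) : ℝ := bigP D * bigT D ^ (-2 : ℤ) * t0 D

/-- The smooth weight `g(x) = π^{-1/2} ∫_{-∞}^{𝓛^{15} log x} e^{-u²} du`. -/
def gfun (D : ℕ) (x : ℝ) : ℝ :=
  Real.pi ^ (-(1 : ℝ) / 2) * ∫ u in Set.Iio (bigL D ^ 15 * Real.log x), Real.exp (-u ^ 2)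

/-- `g*(y) = g(y)` for `y > 1/2`, and `0` otherwise. -/
def gstar (D : ℕ) (y : ℝ) : ℝ := if 1 / 2 < y then gfun D y else 0

/-- `K(s, ψ) = ∑_n ψ(n) n^{-s} g*(P₄ / n)`. -/
def Kfun (D : ℕ) {p : ℕ} (ψ : DirichletCharacter ℂ p) (s : ℂ) : ℂ :=
  ∑' n : ℕ, ψ (n : ZMod p) * (n : ℂ) ^ (-s) * ((gstar D (P4 D / n) : ℝ) : ℂ)

/-- `N(1 - s, ψ̄) = ∑_n conj(ψ(n)) n^{s-1} g*(T² / n)`, as a function of `s`. -/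
def Nfun (D : ℕ) {p : ℕ} (ψ : DirichletCharacter ℂ p) (s : ℂ) : ℂ :=
  ∑' n : ℕ,
    (starRingEnd ℂ) (ψ (n : ZMod p)) * (n : ℂ) ^ (s - 1) * ((gstar D (bigT D ^ 2 / n) : ℝ) : ℂ)

/-- `𝔞 = (6/π²) L'(1,χ)² ∏_{q ∣ D} q/(q+1)`. -/
def fraka (D : ℕ) (χ : DirichletCharacter ℂ D) : ℂ :=
  6 / (Real.pi : ℂ) ^ 2 * deriv (Lfun χ) 1 ^ 2 * ∏ q ∈ D.primeFactors, (q : ℂ) / ((q : ℂ) + 1)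

section
namespace ZS
open Complex Set

/-- Dichotomy: an angle in `[0, 2π)` with small chord is near `0` or near `2π`. -/
lemma angle_dichotomy {x ε : ℝ} (hx0 : 0 ≤ x) (h : ‖Complex.exp (-(I * x)) - 1‖ ≤ 2 * ε) :
    x ≤ 4 * ε ∨ 2 * Real.pi - 4 * ε ≤ x := by
  have hε : 0 ≤ ε := by have := norm_nonneg (Complex.exp (-(I * x)) - 1); linarith
  have h1 : ‖Complex.exp (-(I * x)) - 1‖ = ‖2 * Real.sin ((-x) / 2)‖ := by
    have := Complex.norm_exp_I_mul_ofReal_sub_one (-x)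
    rw [← this]; push_cast; ring_nf
  have h2 : |Real.sin (x / 2)| ≤ ε := by
    rw [h1] at h
    rw [Real.norm_eq_abs, neg_div, Real.sin_neg, abs_mul, abs_neg, abs_two] at h
    linarith
  by_cases hx : 2 * Real.pi ≤ x
  · right; linarith
  push Not at hx
  have hpi := Real.pi_pos
  have hpi4 := Real.pi_lt_four
  have h3 := (abs_le.mp h2).2
  rcases le_total (x / 2) (Real.pi / 2) with hh | hh
  · left
    have := Real.mul_le_sin (x := x / 2) (by linarith) hh
    have h5 : 2 / Real.pi * (x / 2) = x / Real.pi := by field_simp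
    rw [h5] at this
    have h6 : x / Real.pi ≤ ε := this.trans h3
    rw [div_le_iff₀ hpi] at h6
    nlinarith
  · right
    have := Real.mul_le_sin (x := Real.pi - x / 2) (by linarith) (by linarith)
    rw [Real.sin_pi_sub] at this
    have h5 : 2 / Real.pi * (Real.pi - x / 2) = (2 * Real.pi - x) / Real.pi := by field_simp
    rw [h5] at this
    have h6 := this.trans h3
    rw [div_le_iff₀ hpi] at h6
    nlinarith

/-- The abstract spacing lemma. -/
theorem spacing (lam K ε : ℝ) (a b : ℝ) (hab : a < b) (hlam : 0 < lam) (hK0 : 0 ≤ K)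
    (hK : K ≤ lam / 10) (hε0 : 0 < ε) (hε : ε ≤ 1 / 100)
    (h W e e' : ℝ → ℂ) (κ : ℝ → ℝ)
    (hh : ∀ t ∈ Icc a b, h t = 1 + W t + e t)
    (hW1 : ∀ t ∈ Icc a b, ‖W t‖ = 1)
    (hsym : ∀ t ∈ Icc a b, (starRingEnd ℂ) (h t) * W t = h t)
    (hWd : ∀ t ∈ Icc a b, HasDerivAt W (-(I * κ t) * W t) t)
    (hκc : ContinuousOn κ (Icc a b))
    (hκ : ∀ t ∈ Icc a b, |κ t - 2 * lam| ≤ K)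
    (he : ∀ t ∈ Icc a b, ‖e t‖ ≤ ε)
    (hed : ∀ t ∈ Icc a b, HasDerivAt e (e' t) t)
    (he' : ∀ t ∈ Icc a b, ‖e' t‖ ≤ lam / 2)
    (ha : h a = 0) (hb : h b = 0) (hne : ∀ t ∈ Ioo a b, h t ≠ 0) :
    |b - a - Real.pi / lam| ≤ 5 * (K + ε * lam) / lam ^ 2 := by
  have haI : a ∈ Icc a b := ⟨le_rfl, hab.le⟩
  have hbI : b ∈ Icc a b := ⟨hab.le, le_rfl⟩
  -- the phase
  set κ' : ℝ → ℝ := fun t => κ (projIcc a b hab.le t) with hκ'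
  have hκ'c : Continuous κ' := hκc.restrict.comp continuous_projIcc
  have hκ'e : ∀ t ∈ Icc a b, κ' t = κ t := by
    intro t ht; simp only [hκ']; rw [projIcc_of_mem hab.le ht]
  have hκ'b : ∀ t, |κ' t - 2 * lam| ≤ K := fun t => hκ _ (projIcc a b hab.le t).2
  set θ : ℝ → ℝ := fun t => ∫ x in a..t, κ' x with hθ
  have hθd : ∀ t, HasDerivAt θ (κ' t) t := fun t =>
    intervalIntegral.integral_hasDerivAt_right (hκ'c.intervalIntegrable _ _)
      hκ'c.stronglyMeasurable.stronglyMeasurableAtFilter hκ'c.continuousAt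
  have hθdiff : Differentiable ℝ θ := fun t => (hθd t).differentiableAt
  have hθc : Continuous θ := hθdiff.continuous
  have hθa : θ a = 0 := by simp [hθ]
  have hθlow : ∀ s t, s ≤ t → (2 * lam - K) * (t - s) ≤ θ t - θ s := by
    intro s t hst
    refine mul_sub_le_image_sub_of_le_deriv hθdiff (fun x => ?_) hst
    rw [(hθd x).deriv]; have := abs_le.mp (hκ'b x); linarith [this.1]
  have hθup : ∀ s t, s ≤ t → θ t - θ s ≤ (2 * lam + K) * (t - s) := by
    intro s t hst
    refine image_sub_le_mul_sub_of_deriv_le hθdiff (fun x => ?_) hst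
    rw [(hθd x).deriv]; have := abs_le.mp (hκ'b x); linarith [this.2]
  have hWθ : ∀ t ∈ Icc a b, W t = W a * Complex.exp (-(I * θ t)) := by
    have hg : ∀ t ∈ Icc a b, HasDerivAt (fun t => W t * Complex.exp (I * θ t)) 0 t := by
      intro t ht
      have h1 : HasDerivAt (fun t : ℝ => Complex.exp (I * (θ t : ℂ)))
          (Complex.exp (I * θ t) * (I * (κ' t : ℂ))) t :=
        ((hθd t).ofReal_comp.const_mul I).cexp
      have := (hWd t ht).mul h1
      refine this.congr_deriv ?_
      rw [hκ'e t ht]; ring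
    have := constant_of_has_deriv_right_zero (a := a) (b := b)
      (f := fun t => W t * Complex.exp (I * θ t))
      (fun t ht => (hg t ht).continuousAt.continuousWithinAt)
      (fun t ht => (hg t ⟨ht.1, ht.2.le⟩).hasDerivWithinAt)
    intro t ht
    have h2 := this t ht
    simp only [hθa] at h2
    simp only [ofReal_zero, mul_zero, Complex.exp_zero, mul_one] at h2
    rw [← h2, mul_assoc, ← Complex.exp_add]; simp
  have hWa : W a = -1 - e a := by
    have := hh a haI; rw [ha] at this; linear_combination -this
  have hWb : W b = -1 - e b := by
    have := hh b hbI; rw [hb] at this; linear_combination -this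
  have hea := he a haI
  have heb := he b hbI
  have hθb0 : 0 ≤ θ b := by
    have := hθlow a b hab.le; rw [hθa] at this
    have : 0 ≤ (2 * lam - K) * (b - a) := mul_nonneg (by linarith) (by linarith)
    linarith
  -- lower bound for θ b
  have hlow : 2 * Real.pi - 4 * ε ≤ θ b := by
    have hch : ‖Complex.exp (-(I * θ b)) - 1‖ ≤ 2 * ε := by
      have h1 : ‖W a * (Complex.exp (-(I * θ b)) - 1)‖ = ‖Complex.exp (-(I * θ b)) - 1‖ := by
        rw [norm_mul, hW1 a haI, one_mul]
      rw [← h1, mul_sub, ← hWθ b hbI, hWa, hWb]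
      have : (-1 - e b - (-1 - e a) * 1) = e a - e b := by ring
      rw [this]
      exact (norm_sub_le _ _).trans (by linarith)
    rcases angle_dichotomy hθb0 hch with h1 | h1
    swap
    · exact h1
    exfalso
    have hmono : ∀ t ∈ Icc a b, 0 ≤ θ t ∧ θ t ≤ 4 * ε := by
      intro t ht
      have h2 := hθlow a t ht.1
      have h3 := hθlow t b ht.2
      have h4 : 0 ≤ (2 * lam - K) * (t - a) := mul_nonneg (by linarith) (by linarith [ht.1])
      have h5 : 0 ≤ (2 * lam - K) * (b - t) := mul_nonneg (by linarith) (by linarith [ht.2])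
      rw [hθa] at h2
      constructor <;> linarith
    have hre : ∀ t ∈ Icc a b, (W t).re ≤ -1 + 5 * ε := by
      intro t ht
      have h2 : ‖W t + 1‖ ≤ 5 * ε := by
        have : W t + 1 = W a * (Complex.exp (-(I * θ t)) - 1) + (W a + 1) := by
          rw [hWθ t ht]; ring
        rw [this]
        refine (norm_add_le _ _).trans ?_
        rw [norm_mul, hW1 a haI, one_mul]
        have h6 : ‖Complex.exp (-(I * θ t)) - 1‖ ≤ 4 * ε := by
          have := Complex.norm_exp_I_mul_ofReal_sub_one (-(θ t))
          have h7 : -(I * (θ t : ℂ)) = I * ((-(θ t) : ℝ) : ℂ) := by push_cast; ring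
          rw [h7, this, Real.norm_eq_abs, abs_mul, abs_two]
          have := Real.abs_sin_le_abs (x := -(θ t) / 2)
          have h8 : |-(θ t) / 2| = θ t / 2 := by
            rw [neg_div, abs_neg, abs_of_nonneg]; linarith [(hmono t ht).1]
          rw [h8] at this
          linarith [(hmono t ht).2]
        have h7 : ‖W a + 1‖ ≤ ε := by
          have : W a + 1 = -(e a) := by rw [hWa]; ring
          rw [this, norm_neg]; exact hea
        linarith
      have h3 := (Complex.abs_re_le_norm (W t + 1)).trans h2
      have h4 := (abs_le.mp h3).2
      simp at h4
      linarith
    -- Rolle for Im h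
    have hhd : ∀ t ∈ Ioo a b, HasDerivAt (fun t => (1 + W t + e t).im)
        ((-(I * κ t) * W t + e' t).im) t := by
      intro t ht
      have ht' : t ∈ Icc a b := ⟨ht.1.le, ht.2.le⟩
      have h1 : HasDerivAt (fun t => 1 + W t + e t) (-(I * κ t) * W t + e' t) t :=
        ((hWd t ht').const_add 1).add (hed t ht')
      exact Complex.imCLM.hasFDerivAt.comp_hasDerivAt t h1
    have hcont : ContinuousOn (fun t => (1 + W t + e t).im) (Icc a b) := by
      intro t ht
      have h1 : ContinuousAt (fun t => 1 + W t + e t) t :=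
        (((hWd t ht).const_add 1).add (hed t ht)).continuousAt
      exact (Complex.continuous_im.continuousAt.comp h1).continuousWithinAt
    obtain ⟨c, hc, hc0⟩ := exists_hasDerivAt_eq_zero hab hcont
      (by show (1 + W a + e a).im = (1 + W b + e b).im; rw [← hh a haI, ← hh b hbI, ha, hb]) hhd
    have hcI : c ∈ Icc a b := ⟨hc.1.le, hc.2.le⟩
    have h9 : (-(I * κ c) * W c + e' c).im = -κ c * (W c).re + (e' c).im := by
      simp
    rw [h9] at hc0
    have h10 := hre c hcI
    have h11 := (abs_le.mp ((Complex.abs_im_le_norm (e' c)).trans (he' c hcI))).1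
    have h12 := (abs_le.mp (hκ c hcI)).1
    have h13 : 0 ≤ κ c := by linarith
    nlinarith
  -- upper bound for θ b
  have hup : θ b ≤ 2 * Real.pi + 5 * ε := by
    by_contra hcon
    push Not at hcon
    have hpi := Real.pi_pos
    obtain ⟨tb, htb, htb'⟩ : ∃ t ∈ Ioo a b, θ t = 2 * Real.pi + 5 * ε := by
      have := intermediate_value_Ioo hab.le hθc.continuousOn
      exact this ⟨by rw [hθa]; linarith, hcon⟩
    obtain ⟨ta, hta, hta'⟩ : ∃ t ∈ Ioo a tb, θ t = Real.pi := by
      have := intermediate_value_Ioo htb.1.le hθc.continuousOn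
      exact this ⟨by rw [hθa]; linarith, by rw [htb']; linarith⟩
    -- square root
    obtain ⟨c, hc2, hcI⟩ : ∃ c : ℂ, c ^ 2 * W a = 1 ∧ ‖c - I‖ ≤ ε := by
      have hWa0 : W a ≠ 0 := by
        intro h0; have := hW1 a haI; rw [h0] at this; simp at this
      obtain ⟨c, hc⟩ := IsAlgClosed.exists_pow_nat_eq ((W a)⁻¹) (n := 2) (by norm_num)
      have hprod : ‖c - I‖ * ‖c + I‖ ≤ ε := by
        rw [← norm_mul]
        have h1 : (c - I) * (c + I) = (W a)⁻¹ + 1 := by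
          rw [← hc]; linear_combination -Complex.I_sq
        have h2 : (W a)⁻¹ + 1 = (W a)⁻¹ * (-(e a)) := by
          have : -(e a) = 1 + W a := by rw [hWa]; ring
          rw [this]; field_simp
        rw [h1, h2, norm_mul, norm_inv, hW1 a haI, norm_neg]; simpa using hea
      have hsum : 2 ≤ ‖c - I‖ + ‖c + I‖ := by
        have : ‖(c + I) - (c - I)‖ ≤ ‖c + I‖ + ‖c - I‖ := norm_sub_le _ _
        have h2 : (c + I) - (c - I) = 2 * I := by ring
        rw [h2] at this; simp at this; linarith
      rcases le_total 1 ‖c + I‖ with h1 | h1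
      · refine ⟨c, by rw [hc]; field_simp, ?_⟩
        nlinarith [norm_nonneg (c - I)]
      · refine ⟨-c, by rw [neg_sq, hc]; field_simp, ?_⟩
        have h3 : ‖-c - I‖ = ‖c + I‖ := by rw [← norm_neg]; congr 1; ring
        rw [h3]; nlinarith [norm_nonneg (c + I)]
    set u : ℝ → ℂ := fun t => c * Complex.exp (I * (θ t / 2 : ℝ)) with hu
    have hcn : ‖c‖ = 1 := by
      have h1 : ‖c ^ 2 * W a‖ = 1 := by rw [hc2]; simp
      rw [norm_mul, hW1 a haI, mul_one, norm_pow] at h1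
      exact (pow_eq_one_iff_of_nonneg (norm_nonneg _) (by norm_num)).mp h1
    have hun : ∀ t, ‖u t‖ = 1 := by
      intro t; simp only [hu]; rw [norm_mul, hcn, mul_comm I, Complex.norm_exp_ofReal_mul_I, one_mul]
    have huu : ∀ t, u t * (starRingEnd ℂ) (u t) = 1 := by
      intro t; rw [Complex.mul_conj, Complex.normSq_eq_norm_sq, hun t]; simp
    have huW : ∀ t ∈ Icc a b, u t ^ 2 * W t = 1 := by
      intro t ht
      rw [hWθ t ht]; simp only [hu]
      rw [mul_pow, ← Complex.exp_nat_mul]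
      calc _ = (c ^ 2 * W a) * (Complex.exp (((2 : ℕ) : ℂ) * (I * ((θ t / 2 : ℝ) : ℂ)))
              * Complex.exp (-(I * θ t))) := by ring
        _ = 1 := by
          rw [hc2, ← Complex.exp_add]; push_cast
          rw [one_mul, ← Complex.exp_zero]; congr 1; ring
    have hconjW : ∀ t ∈ Icc a b, W t * u t = (starRingEnd ℂ) (u t) := by
      intro t ht
      have h1 := huW t ht
      have h2 := huu t
      have h0 : u t ≠ 0 := by intro h0; rw [h0] at h2; simp at h2
      apply mul_left_cancel₀ h0
      rw [h2]; linear_combination h1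
    have hreal : ∀ t ∈ Icc a b, (starRingEnd ℂ) (h t * u t) = h t * u t := by
      intro t ht
      rw [map_mul, ← hconjW t ht]
      calc _ = ((starRingEnd ℂ) (h t) * W t) * u t := by ring
        _ = _ := by rw [hsym t ht]
    have hhu : ∀ t ∈ Icc a b, (h t * u t).re = 2 * (u t).re + (e t * u t).re := by
      intro t ht
      rw [hh t ht, add_mul, add_mul, one_mul, hconjW t ht]
      simp; ring
    have heu : ∀ t ∈ Icc a b, |(e t * u t).re| ≤ ε := by
      intro t ht
      refine (Complex.abs_re_le_norm _).trans ?_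
      rw [norm_mul, hun, mul_one]; exact he t ht
    have hcr : |c.re| ≤ ε := by
      have := (Complex.abs_re_le_norm (c - I)).trans hcI
      simpa using this
    have hci : 1 - ε ≤ c.im := by
      have := (abs_le.mp ((Complex.abs_im_le_norm (c - I)).trans hcI)).1
      simp at this; linarith
    have hci1 : c.im ≤ 1 := by
      have := (abs_le.mp (Complex.abs_im_le_norm c)).2; rw [hcn] at this; exact this
    have hure : ∀ t, (u t).re = c.re * Real.cos (θ t / 2) - c.im * Real.sin (θ t / 2) := by
      intro t
      simp only [hu]
      rw [mul_comm I, Complex.exp_ofReal_mul_I]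
      simp only [mul_re, add_re, add_im, mul_im, I_re, I_im, ofReal_re, ofReal_im]
      simp
    have htaI : ta ∈ Icc a b := ⟨hta.1.le, (hta.2.trans htb.2).le⟩
    have htbI : tb ∈ Icc a b := ⟨htb.1.le, htb.2.le⟩
    have hra : (h ta * u ta).re < 0 := by
      rw [hhu ta htaI, hure, hta', Real.cos_pi_div_two, Real.sin_pi_div_two]
      have := (abs_le.mp (heu ta htaI)).2
      linarith
    have hrb : 0 < (h tb * u tb).re := by
      rw [hhu tb htbI, hure, htb']
      have e1 : (2 * Real.pi + 5 * ε) / 2 = 5 * ε / 2 + Real.pi := by ring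
      rw [e1, Real.cos_add_pi, Real.sin_add_pi]
      have h1 := (abs_le.mp (heu tb htbI)).1
      have h2 : 5 * ε / Real.pi ≤ Real.sin (5 * ε / 2) := by
        have := Real.mul_le_sin (x := 5 * ε / 2) (by linarith) (by linarith [Real.pi_gt_three])
        have h5 : 2 / Real.pi * (5 * ε / 2) = 5 * ε / Real.pi := by field_simp
        rwa [h5] at this
      have h3 : ε * (1.58 : ℝ) ≤ 5 * ε / Real.pi := by
        rw [le_div_iff₀ hpi]
        have := Real.pi_lt_d2
        nlinarith
      have h4 : c.re * Real.cos (5 * ε / 2) ≤ ε := by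
        have := Real.abs_cos_le_one (5 * ε / 2)
        calc _ ≤ |c.re * Real.cos (5 * ε / 2)| := le_abs_self _
          _ = |c.re| * |Real.cos (5 * ε / 2)| := abs_mul _ _
          _ ≤ ε * 1 := by gcongr
          _ = ε := mul_one _
      have h5 : (1 - ε) * (1.58 * ε) ≤ c.im * Real.sin (5 * ε / 2) := by
        apply mul_le_mul hci (by linarith) (by positivity) (by linarith)
      nlinarith
    have hcontu : ContinuousOn (fun t => (h t * u t).re) (Icc ta tb) := by
      have huc : Continuous u := by fun_prop
      have hsub : Icc ta tb ⊆ Icc a b := Icc_subset_Icc hta.1.le htb.2.le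
      have hhc : ContinuousOn h (Icc ta tb) := by
        have : ContinuousOn (fun t => 1 + W t + e t) (Icc ta tb) := fun t ht =>
          (((hWd t (hsub ht)).const_add 1).add (hed t (hsub ht))).continuousAt.continuousWithinAt
        exact this.congr (fun t ht => hh t (hsub ht))
      exact Complex.continuous_re.comp_continuousOn (hhc.mul huc.continuousOn)
    obtain ⟨z, hz, hz0⟩ := intermediate_value_Ioo hta.2.le hcontu ⟨hra, hrb⟩
    have hzI : z ∈ Ioo a b := ⟨hta.1.trans hz.1, hz.2.trans htb.2⟩
    have hz0' : h z * u z = 0 := by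
      have h1 := hreal z ⟨hzI.1.le, hzI.2.le⟩
      have h2 := Complex.conj_eq_iff_re.mp h1
      have hz0' : (h z * u z).re = 0 := hz0
      rw [← h2, hz0']; simp
    have : u z ≠ 0 := by intro h0; have := hun z; rw [h0] at this; simp at this
    exact hne z hzI ((mul_eq_zero.mp hz0').resolve_right this)
  have hpi4 := Real.pi_lt_four
  have hpi := Real.pi_pos
  have h1 := hθlow a b hab.le
  have h2 := hθup a b hab.le
  rw [hθa, sub_zero] at h1 h2
  set x := b - a with hx
  have hx0 : 0 < x := by rw [hx]; linarith
  have e1 : x - Real.pi / lam = (x * lam - Real.pi) / lam := by field_simp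
  rw [e1, abs_div, abs_of_pos hlam, div_le_div_iff₀ hlam (by positivity)]
  have h3 : |x * lam - Real.pi| ≤ 5 * (K + ε * lam) / lam := by
    have hxl : x * lam ≤ 5 := by nlinarith
    have hxK : x * K ≤ 5 * K / lam := by
      rw [le_div_iff₀ hlam]; nlinarith
    have : 5 * (K + ε * lam) / lam = 5 * K / lam + 5 * ε := by field_simp
    rw [this, abs_le]
    constructor <;> nlinarith
  calc |x * lam - Real.pi| * lam ^ 2 ≤ 5 * (K + ε * lam) / lam * lam ^ 2 := by gcongr
    _ = 5 * (K + ε * lam) * lam := by field_simp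

end ZS
end

section
namespace ZS
open Complex Set

/-- Logarithmic derivative bound via a primitive of `f'/f` and Borel-Caratheodory. -/
lemma logDeriv_bound {f : ℂ → ℂ} {c : ℂ} {r B : ℝ} (hr : 0 < r) (hB : 0 < B)
    (hf : DifferentiableOn ℂ f (Metric.ball c r)) (hne : ∀ z ∈ Metric.ball c r, f z ≠ 0)
    (hM : ∀ z ∈ Metric.ball c r, ‖f z‖ ≤ ‖f c‖ * Real.exp B) :
    ‖deriv f c / f c‖ ≤ 4 * B / r := by
  have hcb : c ∈ Metric.ball c r := Metric.mem_ball_self hr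
  have hop : IsOpen (Metric.ball c r) := Metric.isOpen_ball
  have hd : DifferentiableOn ℂ (fun z => deriv f z / f z) (Metric.ball c r) :=
    (hf.deriv hop).div hf hne
  obtain ⟨g, hg⟩ := hd.isExactOn_ball.with_val_at c 0
  obtain ⟨hg0, hg1⟩ := hg
  have hgd : DifferentiableOn ℂ g (Metric.ball c r) := fun z hz =>
    (hg1 z hz).differentiableAt.differentiableWithinAt
  -- f = f c * exp g
  have hq : ∀ z ∈ Metric.ball c r, f z * Complex.exp (-g z) = f c := by
    intro z hz
    have hconst := (convex_ball c r).is_const_of_fderivWithin_eq_zero (𝕜 := ℂ)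
      (f := fun z => f z * Complex.exp (-g z)) (s := Metric.ball c r) ?_ ?_ hz hcb
    · simpa [hg0] using hconst
    · exact hf.mul (hgd.neg.cexp)
    · intro x hx
      have h1 : HasDerivAt f (deriv f x) x :=
        (hf.differentiableAt (hop.mem_nhds hx)).hasDerivAt
      have h2 := h1.mul ((hg1 x hx).neg.cexp)
      have h3 : HasDerivAt (fun z => f z * Complex.exp (-g z)) 0 x := by
        have hfx := hne x hx
        have h5 : f x * (deriv f x / f x) = deriv f x := by
          field_simp
        have h6 : deriv f x * Complex.exp (-g x) +
          f x * (Complex.exp (-g x) * -(deriv f x / f x)) = 0 := by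
          linear_combination -Complex.exp (-g x) * h5
        rw [← h6]
        exact h2
      rw [fderivWithin_of_isOpen hop hx]
      have h4 := h3.hasFDerivAt.fderiv
      rw [h4]; ext; simp
  have hre : ∀ z ∈ Metric.ball c r, (g z).re ≤ B := by
    intro z hz
    have h1 := hM z hz
    have h2 : f z = f c * Complex.exp (g z) := by
      rw [← hq z hz, mul_assoc, ← Complex.exp_add]; simp
    rw [h2, norm_mul, Complex.norm_exp] at h1
    have h3 : 0 < ‖f c‖ := norm_pos_iff.mpr (hne c hcb)
    exact Real.exp_le_exp.mp (le_of_mul_le_mul_left h1 h3)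
  have hbc : ∀ z ∈ Metric.ball (0:ℂ) r, ‖g (c + z)‖ ≤ 2 * B * ‖z‖ / (r - ‖z‖) := by
    intro z hz
    have hmap : ∀ w ∈ Metric.ball (0:ℂ) r, c + w ∈ Metric.ball c r := by
      intro w hw; simpa using hw
    apply Complex.borelCaratheodory_zero (f := fun z => g (c + z)) hB _ _ hr hz (by simpa using hg0)
    · exact hgd.comp (by fun_prop) hmap
    · intro w hw; exact hre _ (hmap w hw)
  have hgc : deriv g c = deriv f c / f c := (hg1 c hcb).deriv
  rw [← hgc]
  have h5 := Complex.norm_deriv_le_of_forall_mem_sphere_norm_le (c := c) (R := r / 2) (C := 2 * B)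
    (f := g) (by positivity) ?_ ?_
  · refine h5.trans (le_of_eq ?_); field_simp; ring
  · apply DifferentiableOn.diffContOnCl
    apply hgd.mono
    rw [closure_ball _ (by positivity)]
    exact Metric.closedBall_subset_ball (by linarith)
  · intro z hz
    have hz' : ‖z - c‖ = r / 2 := by simpa using hz
    have := hbc (z - c) (by simp [hz', hr])
    rw [hz'] at this
    have h6 : c + (z - c) = z := by ring
    rw [h6] at this
    refine this.trans (le_of_eq ?_)
    field_simp; ring

end ZS
end

section
namespace ZS
open Complex Set MeasureTheory

lemma hasDerivAt_cpow_neg {t : ℝ} (ht : 0 < t) (w : ℂ) :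
    HasDerivAt (fun t : ℝ => (t : ℂ) ^ (-w)) (-w * (t : ℂ) ^ (-w - 1)) t := by
  have h1 : HasDerivAt (fun t : ℝ => (t : ℂ)) 1 t := Complex.ofRealCLM.hasDerivAt
  have h2 : (t : ℂ) ∈ Complex.slitPlane := by simp [ht]
  have := HasDerivAt.comp t (HasDerivAt.cpow_const (c := -w) (hasDerivAt_id (t : ℂ)) h2) h1
  simpa [Function.comp_def] using this

/-- restricted coefficient partial sums -/
lemma sum_ite_Icc (c : ℕ → ℂ) (m N : ℕ) :
    ∑ k ∈ Finset.Icc 0 N, (if m < k then c k else 0) = ∑ k ∈ Finset.Ioc m N, c k := by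
  rw [← Finset.sum_filter]
  congr 1
  ext k; simp [and_comm]

lemma intervalIntegrable_norm_sum_div (c : ℕ → ℂ) (m : ℕ) {a b : ℝ} (ha : 0 < a) (hab : a ≤ b) :
    IntervalIntegrable (fun x => ‖∑ k ∈ Finset.Ioc m ⌊x⌋₊, c k‖ / x) volume a b := by
  rw [intervalIntegrable_iff_integrableOn_Icc_of_le hab]
  have h1 : IntegrableOn (fun t : ℝ => ((t⁻¹ : ℝ) : ℂ)) (Icc a b) := by
    apply ContinuousOn.integrableOn_Icc
    apply Complex.continuous_ofReal.comp_continuousOn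
    apply ContinuousOn.inv₀ continuousOn_id
    intro x hx; exact (ha.trans_le hx.1).ne'
  have h2 : IntegrableOn _ (Icc a b) := (integrableOn_mul_sum_Icc (c := fun k => if m < k then c k else 0) (m := 0) ha.le h1).norm
  apply h2.congr_fun _ measurableSet_Icc
  intro x hx
  have hx0 : 0 < x := ha.trans_le hx.1
  simp only [sum_ite_Icc, norm_mul, Complex.norm_real, norm_inv, Real.norm_eq_abs, abs_of_pos hx0]
  rw [div_eq_inv_mul]

/-- Abel summation bound. -/
lemma abel_bound (c : ℕ → ℂ) (m : ℕ) {a b K : ℝ} (ha : 0 < a) (hab : a ≤ b) (w : ℂ)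
    (hm : m ≤ ⌊a⌋₊) (hK : ∀ x ∈ Icc a b, x ^ (-w.re) ≤ K) :
    ‖∑ n ∈ Finset.Ioc ⌊a⌋₊ ⌊b⌋₊, c n * (n : ℂ) ^ (-w)‖ ≤
      K * (‖∑ k ∈ Finset.Ioc m ⌊b⌋₊, c k‖ + ‖∑ k ∈ Finset.Ioc m ⌊a⌋₊, c k‖ +
        ‖w‖ * ∫ x in a..b, ‖∑ k ∈ Finset.Ioc m ⌊x⌋₊, c k‖ / x) := by
  have hpos : ∀ x ∈ Icc a b, 0 < x := fun x hx => ha.trans_le hx.1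
  have hder : ∀ x ∈ Icc a b, deriv (fun t : ℝ => (t : ℂ) ^ (-w)) x = -w * (x : ℂ) ^ (-w - 1) :=
    fun x hx => (hasDerivAt_cpow_neg (hpos x hx) w).deriv
  have hIntg : IntegrableOn (deriv (fun t : ℝ => (t : ℂ) ^ (-w))) (Icc a b) := by
    have : IntegrableOn (fun x : ℝ => -w * (x : ℂ) ^ (-w - 1)) (Icc a b) := by
      apply ContinuousOn.integrableOn_Icc
      intro x hx
      apply ContinuousAt.continuousWithinAt
      have h2 : (x : ℂ) ∈ Complex.slitPlane := by simp [hpos x hx]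
      exact continuousAt_const.mul ((continuousAt_cpow_const h2).comp
        Complex.continuous_ofReal.continuousAt)
    exact this.congr_fun (fun x hx => (hder x hx).symm) measurableSet_Icc
  have key := sum_mul_eq_sub_sub_integral_mul (fun k => if m < k then c k else 0) ha.le hab
    (fun t ht => (hasDerivAt_cpow_neg (hpos t ht) w).differentiableAt) hIntg
  simp only [sum_ite_Icc] at key
  have hL : ∑ n ∈ Finset.Ioc ⌊a⌋₊ ⌊b⌋₊, c n * (n : ℂ) ^ (-w) =
      ∑ k ∈ Finset.Ioc ⌊a⌋₊ ⌊b⌋₊, ((k : ℝ) : ℂ) ^ (-w) * (if m < k then c k else 0) := by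
    apply Finset.sum_congr rfl
    intro k hk
    rw [if_pos (hm.trans_lt (Finset.mem_Ioc.mp hk).1), mul_comm]; simp
  rw [hL, key, ← intervalIntegral.integral_of_le hab]
  have hnorm : ∀ x ∈ Icc a b, ‖(x : ℂ) ^ (-w)‖ ≤ K := by
    intro x hx
    rw [Complex.norm_cpow_eq_rpow_re_of_pos (hpos x hx)]
    simpa using hK x hx
  have hb := hnorm b ⟨hab, le_rfl⟩
  have ha' := hnorm a ⟨le_rfl, hab⟩
  have hK0 : 0 ≤ K := (norm_nonneg _).trans hb
  have hI : ‖∫ x in a..b, deriv (fun t : ℝ => (t : ℂ) ^ (-w)) x * ∑ k ∈ Finset.Ioc m ⌊x⌋₊, c k‖ ≤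
      ∫ x in a..b, K * ‖w‖ * (‖∑ k ∈ Finset.Ioc m ⌊x⌋₊, c k‖ / x) := by
    apply intervalIntegral.norm_integral_le_of_norm_le hab
    · refine Filter.Eventually.of_forall (fun x hx => ?_)
      have hx' : x ∈ Icc a b := ⟨hx.1.le, hx.2⟩
      have hx0 := hpos x hx'
      rw [hder x hx', norm_mul, norm_mul, norm_neg]
      have h3 : ‖(x : ℂ) ^ (-w - 1)‖ ≤ K / x := by
        rw [Complex.cpow_sub _ _ (by exact_mod_cast hx0.ne'), Complex.cpow_one, norm_div,
          Complex.norm_real, Real.norm_eq_abs, abs_of_pos hx0]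
        gcongr
        exact hnorm x hx'
      calc ‖w‖ * ‖(x : ℂ) ^ (-w - 1)‖ * ‖∑ k ∈ Finset.Ioc m ⌊x⌋₊, c k‖
          ≤ ‖w‖ * (K / x) * ‖∑ k ∈ Finset.Ioc m ⌊x⌋₊, c k‖ := by gcongr
        _ = _ := by ring
    · exact (intervalIntegrable_norm_sum_div c m ha hab).const_mul _
  rw [intervalIntegral.integral_const_mul] at hI
  refine (norm_sub_le _ _).trans ?_
  refine (add_le_add (norm_sub_le _ _) hI).trans ?_
  rw [norm_mul, norm_mul]
  have h4 := mul_le_mul_of_nonneg_right hb (norm_nonneg (∑ k ∈ Finset.Ioc m ⌊b⌋₊, c k))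
  have h5 := mul_le_mul_of_nonneg_right ha' (norm_nonneg (∑ k ∈ Finset.Ioc m ⌊a⌋₊, c k))
  linarith

end ZS
end

section
namespace ZS
open Complex Set

/-- Maximum modulus on a rectangle. -/
lemma rect_max {f : ℂ → ℂ} {a b c d M : ℝ} (hab : a < b) (hcd : c < d)
    (hf : ∀ z : ℂ, z.re ∈ Icc a b → z.im ∈ Icc c d → DifferentiableAt ℂ f z)
    (hv : ∀ z : ℂ, (z.re = a ∨ z.re = b) → z.im ∈ Icc c d → ‖f z‖ ≤ M)
    (hh : ∀ z : ℂ, z.re ∈ Icc a b → (z.im = c ∨ z.im = d) → ‖f z‖ ≤ M)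
    {z : ℂ} (hz1 : z.re ∈ Icc a b) (hz2 : z.im ∈ Icc c d) : ‖f z‖ ≤ M := by
  have hcl : closure (Ioo a b ×ℂ Ioo c d) = Icc a b ×ℂ Icc c d := by
    rw [Complex.closure_reProdIm, closure_Ioo hab.ne, closure_Ioo hcd.ne]
  have hdiff : DiffContOnCl ℂ f (Ioo a b ×ℂ Ioo c d) := by
    apply DifferentiableOn.diffContOnCl
    rw [hcl]
    intro w hw
    exact (hf w hw.1 hw.2).differentiableWithinAt
  have hbd : Bornology.IsBounded (Ioo a b ×ℂ Ioo c d) :=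
    (Metric.isBounded_Ioo a b).reProdIm (Metric.isBounded_Ioo c d)
  apply Complex.norm_le_of_forall_mem_frontier_norm_le hbd hdiff
  · intro w hw
    rw [Complex.frontier_reProdIm, closure_Ioo hab.ne, closure_Ioo hcd.ne, frontier_Ioo hab,
      frontier_Ioo hcd] at hw
    rcases hw with ⟨h1, h2⟩ | ⟨h1, h2⟩
    · exact hh w h1 (by simpa using h2)
    · exact hv w (by simpa using h1) h2
  · rw [hcl]; exact ⟨hz1, hz2⟩

end ZS
end

section
namespace ZS
open Complex Set

lemma norm_Gamma_le_re {z : ℂ} (hz : 0 < z.re) : ‖Complex.Gamma z‖ ≤ Real.Gamma z.re := by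
  rw [Complex.Gamma_eq_integral hz, Real.Gamma_eq_integral hz]
  unfold Complex.GammaIntegral
  refine (MeasureTheory.norm_integral_le_integral_norm _).trans (le_of_eq ?_)
  apply MeasureTheory.setIntegral_congr_fun measurableSet_Ioi
  intro x hx
  have hx0 : (0:ℝ) < x := hx
  simp only [norm_mul]
  rw [Complex.norm_cpow_eq_rpow_re_of_pos hx0, Complex.norm_real, Real.norm_eq_abs, abs_of_pos (Real.exp_pos _)]
  simp

lemma norm_Gamma_le_shift {w : ℂ} (hw : 1 ≤ |w.im|) (k : ℕ) :
    ‖Complex.Gamma w‖ ≤ ‖Complex.Gamma (w + k)‖ := by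
  induction k with
  | zero => simp
  | succ k ih =>
    refine ih.trans ?_
    have him : (w + k).im = w.im := by simp
    have h1 : 1 ≤ ‖w + k‖ := by
      have := Complex.abs_im_le_norm (w + k); rw [him] at this; linarith
    have h0 : w + k ≠ 0 := by intro h; rw [h] at h1; simp at h1; linarith
    have h2 := Complex.Gamma_add_one (w + k) h0
    have h3 : w + ((k + 1 : ℕ) : ℂ) = w + k + 1 := by push_cast; ring
    rw [h3, h2, norm_mul]
    exact le_mul_of_one_le_left (norm_nonneg _) h1

lemma norm_Gamma_le_fact {w : ℂ} (n : ℕ) (hw : 1 ≤ |w.im|) (hn : |w.re| ≤ n) :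
    ‖Complex.Gamma w‖ ≤ ((2 * n + 1).factorial : ℝ) := by
  refine (norm_Gamma_le_shift hw (n + 2)).trans ?_
  have hre : (w + ((n + 2 : ℕ) : ℂ)).re = w.re + (n + 2) := by simp
  have h1 := abs_le.mp hn
  refine (norm_Gamma_le_re (by rw [hre]; linarith)).trans ?_
  rw [hre]
  have h2 : Real.Gamma ((2 * n + 1 : ℕ) + 1) = ((2 * n + 1).factorial : ℝ) :=
    Real.Gamma_nat_eq_factorial _
  rw [← h2]
  apply Real.Gamma_strictMonoOn_Ici.monotoneOn
  · show (2:ℝ) ≤ _; linarith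
  · show (2:ℝ) ≤ _
    push_cast
    have h3 : (0:ℝ) ≤ n := Nat.cast_nonneg n
    linarith
  · push_cast; linarith

lemma norm_sin_le_exp (z : ℂ) : ‖Complex.sin z‖ ≤ Real.exp |z.im| := by
  unfold Complex.sin
  rw [norm_div, norm_mul, Complex.norm_I, mul_one, Complex.norm_two]
  have h1 : ‖Complex.exp (-z * I)‖ ≤ Real.exp |z.im| := by
    rw [Complex.norm_exp]; apply Real.exp_le_exp.mpr; simp; exact le_abs_self _
  have h2 : ‖Complex.exp (z * I)‖ ≤ Real.exp |z.im| := by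
    rw [Complex.norm_exp]; apply Real.exp_le_exp.mpr; simp; exact neg_le_abs _
  have := norm_sub_le (Complex.exp (-z * I)) (Complex.exp (z * I))
  linarith

lemma one_le_Gamma_mul {z : ℂ} (n : ℕ) (hz : 1 ≤ |z.im|) (hn : |z.re| + 1 ≤ n) :
    1 ≤ ‖Complex.Gamma z‖ * (((2 * n + 1).factorial : ℝ) * Real.exp (Real.pi * |z.im|)) := by
  have h1 := Complex.Gamma_mul_Gamma_one_sub z
  have h2 : ‖Complex.Gamma (1 - z)‖ ≤ ((2 * n + 1).factorial : ℝ) := by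
    apply norm_Gamma_le_fact n
    · simpa using hz
    · simp only [sub_re, one_re]
      have := abs_sub 1 z.re
      rw [abs_one] at this; linarith
  have h3 : ‖Complex.sin (Real.pi * z)‖ ≤ Real.exp (Real.pi * |z.im|) := by
    refine (norm_sin_le_exp _).trans (le_of_eq ?_)
    simp [abs_mul, abs_of_pos Real.pi_pos]
  have h4 : Complex.sin (Real.pi * z) ≠ 0 := by
    intro h
    rw [Complex.sin_eq_zero_iff] at h
    obtain ⟨k, hk⟩ := h
    have h5 := congrArg Complex.im hk
    simp at h5
    rw [h5] at hz; simp at hz; linarith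
  have h5 : Complex.Gamma z * (Complex.Gamma (1 - z) * Complex.sin (Real.pi * z)) = Real.pi := by
    rw [← mul_assoc, h1]; field_simp
  have h6 := congrArg norm h5
  rw [norm_mul, norm_mul, Complex.norm_real, Real.norm_eq_abs, abs_of_pos Real.pi_pos] at h6
  have hpi : (1:ℝ) ≤ Real.pi := by linarith [Real.pi_gt_three]
  calc (1:ℝ) ≤ Real.pi := hpi
    _ = _ := h6.symm
    _ ≤ _ := by gcongr

lemma Gamma_differentiableAt {z : ℂ} (hz : z.im ≠ 0) : DifferentiableAt ℂ Complex.Gamma z := by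
  apply Complex.differentiableAt_Gamma
  intro m h; apply hz; rw [h]; simp

lemma Gamma_ne_zero' {z : ℂ} (hz : z.im ≠ 0) : Complex.Gamma z ≠ 0 := by
  apply Complex.Gamma_ne_zero
  intro m h; apply hz; rw [h]; simp

/-- Digamma bound. -/
lemma digamma_bound {z : ℂ} (hre : |z.re| ≤ 2) (him : 2 ≤ |z.im|) :
    ‖deriv Complex.Gamma z / Complex.Gamma z‖ ≤ 96 * Real.log (6 * |z.im|) + 32 := by
  set Y := |z.im| with hY
  set n : ℕ := ⌊Y⌋₊ + 3 with hn
  have hY0 : 0 < Y := by linarith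
  have hfl : (⌊Y⌋₊ : ℝ) ≤ Y := Nat.floor_le hY0.le
  have hfl2 : Y < ⌊Y⌋₊ + 1 := Nat.lt_floor_add_one Y
  have hnr : (n : ℝ) = ⌊Y⌋₊ + 3 := by rw [hn]; push_cast; ring
  have him' : ∀ w ∈ Metric.ball z (Y / 2), 1 ≤ |w.im| := by
    intro w hw
    have h1 : |(w - z).im| < Y / 2 := (Complex.abs_im_le_norm _).trans_lt (by simpa [dist_eq_norm] using hw)
    have h2 := abs_sub_abs_le_abs_sub z.im w.im
    rw [sub_im, abs_sub_comm] at h1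
    linarith
  set B := 2 * (2 * (n:ℝ) + 1) * Real.log (2 * n + 1) + 4 * Y with hB
  have hlogpos : 0 ≤ Real.log (2 * (n:ℝ) + 1) := Real.log_nonneg (by have : (0:ℝ) ≤ n := Nat.cast_nonneg n
                                                                     linarith)
  have hfact : ((2 * n + 1).factorial : ℝ) ≤ Real.exp ((2 * (n:ℝ) + 1) * Real.log (2 * n + 1)) := by
    have h1 : ((2 * n + 1).factorial : ℝ) ≤ ((2 * n + 1 : ℕ) : ℝ) ^ (2 * n + 1) := by
      exact_mod_cast Nat.factorial_le_pow (2 * n + 1)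
    refine h1.trans (le_of_eq ?_)
    have h2 : (0:ℝ) < ((2 * n + 1 : ℕ) : ℝ) := by positivity
    rw [← Real.rpow_natCast, Real.rpow_def_of_pos h2]
    push_cast; ring_nf
  have hBpos : 0 < B := by positivity
  have key := logDeriv_bound (f := Complex.Gamma) (c := z) (r := Y / 2) (B := B) (by positivity) hBpos
    (fun w hw => (Gamma_differentiableAt (by
      intro h; have := him' w hw; rw [h] at this; simp at this; linarith)).differentiableWithinAt)
    (fun w hw => Gamma_ne_zero' (by
      intro h; have := him' w hw; rw [h] at this; simp at this; linarith)) ?_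
  · refine key.trans ?_
    have h6 : 2 * (n:ℝ) + 1 ≤ 6 * Y := by rw [hnr]; linarith
    have h7 : Real.log (2 * n + 1) ≤ Real.log (6 * Y) := by
      apply Real.log_le_log _ h6
      positivity
    rw [div_le_iff₀ (by positivity)]
    have : (2 * (n:ℝ) + 1) * Real.log (2 * n + 1) ≤ 6 * Y * Real.log (6 * Y) := by gcongr
    rw [hB]; nlinarith
  · intro w hw
    have hwre : |w.re| ≤ n := by
      have h1 : |(w - z).re| < Y / 2 := (Complex.abs_re_le_norm _).trans_lt (by simpa [dist_eq_norm] using hw)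
      rw [sub_re] at h1
      have h2 := abs_sub_abs_le_abs_sub w.re z.re
      rw [hnr]; linarith
    have h1 := norm_Gamma_le_fact n (him' w hw) hwre
    have h2 := one_le_Gamma_mul (z := z) n (by rw [← hY]; linarith) (by rw [hnr]; linarith)
    rw [← hY] at h2
    calc ‖Complex.Gamma w‖ ≤ ((2 * n + 1).factorial : ℝ) * 1 := by linarith
      _ ≤ ((2 * n + 1).factorial : ℝ) * (‖Complex.Gamma z‖ * (((2 * n + 1).factorial : ℝ) * Real.exp (Real.pi * Y))) := by
          gcongr
      _ = ‖Complex.Gamma z‖ * (((2 * n + 1).factorial : ℝ) * ((2 * n + 1).factorial : ℝ) * Real.exp (Real.pi * Y)) := by ring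
      _ ≤ ‖Complex.Gamma z‖ * (Real.exp ((2 * (n:ℝ) + 1) * Real.log (2 * n + 1)) * Real.exp ((2 * (n:ℝ) + 1) * Real.log (2 * n + 1)) * Real.exp (4 * Y)) := by
          gcongr
          exact Real.pi_lt_four.le
      _ = _ := by
          rw [← Real.exp_add, ← Real.exp_add, hB]; ring_nf

end ZS
end

section
namespace ZS
open Complex Set

/-- quotient of archimedean factors -/
def gQ (a : ℝ) (s : ℂ) : ℂ := Gammaℝ (1 - s + a) / Gammaℝ (s + a)

lemma GammaR_ne_zero_of_im {s : ℂ} (hs : s.im ≠ 0) : Gammaℝ s ≠ 0 := by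
  rw [Ne, Gammaℝ_eq_zero_iff]
  rintro ⟨n, rfl⟩
  apply hs; simp

lemma conj_GammaR (s : ℂ) : (starRingEnd ℂ) (Gammaℝ s) = Gammaℝ ((starRingEnd ℂ) s) := by
  rw [Gammaℝ_def, Gammaℝ_def, map_mul, ← Complex.Gamma_conj]
  congr 1
  · have h := Complex.cpow_conj (Real.pi : ℂ) (-s / 2)
      (by rw [Complex.arg_ofReal_of_nonneg Real.pi_pos.le]; exact Real.pi_ne_zero.symm)
    have e : (starRingEnd ℂ) (-s / 2) = -(starRingEnd ℂ) s / 2 := by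
      rw [map_div₀, map_neg, Complex.conj_ofNat]
    rw [e, Complex.conj_ofReal] at h
    exact h.symm
  · rw [map_div₀, Complex.conj_ofNat]

lemma differentiableAt_GammaR {s : ℂ} (hs : s.im ≠ 0) : DifferentiableAt ℂ Gammaℝ s := by
  have h := (differentiable_Gammaℝ_inv s).inv (inv_ne_zero (GammaR_ne_zero_of_im hs))
  have e : (fun s => (Gammaℝ s)⁻¹)⁻¹ = Gammaℝ := by ext; simp
  rwa [e] at h

lemma gQ_ne_zero {a : ℝ} {s : ℂ} (hs : s.im ≠ 0) : gQ a s ≠ 0 := by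
  apply div_ne_zero <;> apply GammaR_ne_zero_of_im <;> simpa using hs

lemma gQ_diff {a : ℝ} {s : ℂ} (hs : s.im ≠ 0) : DifferentiableAt ℂ (gQ a) s := by
  have h1 : DifferentiableAt ℂ Gammaℝ (1 - s + a) := differentiableAt_GammaR (by simpa using hs)
  have h2 : DifferentiableAt ℂ Gammaℝ (s + a) := differentiableAt_GammaR (by simpa using hs)
  have h3 : DifferentiableAt ℂ (fun s : ℂ => 1 - s + a) s := by fun_prop
  have h4 : DifferentiableAt ℂ (fun s : ℂ => s + a) s := by fun_prop
  have h5 : DifferentiableAt ℂ (fun s : ℂ => Gammaℝ (1 - s + a)) s :=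
    DifferentiableAt.comp (g := Gammaℝ) s h1 h3
  have h6 : DifferentiableAt ℂ (fun s : ℂ => Gammaℝ (s + a)) s :=
    DifferentiableAt.comp (g := Gammaℝ) s h2 h4
  exact h5.div h6 (GammaR_ne_zero_of_im (by simpa using hs))

lemma gQ_refl {a : ℝ} {s : ℂ} (hs : s.im ≠ 0) :
    gQ a s * (starRingEnd ℂ) (gQ a (1 - (starRingEnd ℂ) s)) = 1 := by
  unfold gQ
  rw [map_div₀, conj_GammaR, conj_GammaR]
  have e1 : (starRingEnd ℂ) (1 - (1 - (starRingEnd ℂ) s) + (a : ℂ)) = s + a := by simp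
  have e2 : (starRingEnd ℂ) (1 - (starRingEnd ℂ) s + (a : ℂ)) = 1 - s + a := by simp
  rw [e1, e2]
  have h1 : Gammaℝ (1 - s + a) ≠ 0 := GammaR_ne_zero_of_im (by simpa using hs)
  have h2 : Gammaℝ (s + a) ≠ 0 := GammaR_ne_zero_of_im (by simpa using hs)
  field_simp

/-- exact value of `|gQ|` on `Re s = 5/2` -/
lemma gQ_norm {a : ℝ} {s : ℂ} (hs : s.im ≠ 0) (hre : s.re = 5 / 2) :
    ‖gQ a s‖ * (‖1 - s + a‖ * ‖1 - s + a + 2‖) = (2 * Real.pi) ^ 2 := by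
  set z : ℂ := 1 - s + a with hz
  have hzi : z.im ≠ 0 := by simpa [hz] using hs
  have hz0 : z ≠ 0 := by intro h; rw [h] at hzi; simp at hzi
  have hz2 : z + 2 ≠ 0 := by
    intro h; apply hzi; have := congrArg Complex.im h; simpa using this
  have h1 : (starRingEnd ℂ) (s + a) = z + 2 + 2 := by
    apply Complex.ext
    · simp [hz, hre]; ring
    · simp [hz]
  have h2 : ‖Gammaℝ (s + a)‖ = ‖Gammaℝ (z + 2 + 2)‖ := by
    rw [← h1, ← conj_GammaR, RCLike.norm_conj]
  have h3 : Gammaℝ z ≠ 0 := GammaR_ne_zero_of_im hzi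
  unfold gQ
  rw [norm_div, h2, Gammaℝ_add_two hz2, Gammaℝ_add_two hz0, ← hz]
  simp only [norm_div, norm_mul, Complex.norm_real, Real.norm_eq_abs, abs_of_pos Real.pi_pos,
    Complex.norm_two]
  have h4 := norm_ne_zero_iff.mpr h3
  have h5 := norm_ne_zero_iff.mpr hz0
  have h6 := norm_ne_zero_iff.mpr hz2
  have h7 := Real.pi_ne_zero
  field_simp

lemma logDeriv_GammaR {s : ℂ} (hs : s.im ≠ 0) :
    logDeriv Gammaℝ s = -(Real.log Real.pi : ℝ) / 2 +
      (deriv Complex.Gamma (s / 2) / Complex.Gamma (s / 2)) / 2 := by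
  have hpi : (Real.pi : ℂ) ≠ 0 := by exact_mod_cast Real.pi_ne_zero
  have hs2 : (s / 2).im ≠ 0 := by simpa using hs
  have h1 : HasDerivAt (fun s : ℂ => (Real.pi : ℂ) ^ (-s / 2))
      ((Real.pi : ℂ) ^ (-s / 2) * Complex.log Real.pi * (-1 / 2)) s := by
    have : HasDerivAt (fun s : ℂ => -s / 2) (-1 / 2) s := (hasDerivAt_id s).neg.div_const 2
    exact this.const_cpow (Or.inl hpi)
  have h2 : HasDerivAt (fun s : ℂ => Complex.Gamma (s / 2)) (deriv Complex.Gamma (s / 2) * (1 / 2)) s := by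
    have h3 : HasDerivAt (fun s : ℂ => s / 2) (1 / 2) s := (hasDerivAt_id s).div_const 2
    exact (Gamma_differentiableAt hs2).hasDerivAt.comp s h3
  have h3 := h1.mul h2
  have h4 : HasDerivAt Gammaℝ _ s := h3
  have hG := Gamma_ne_zero' hs2
  have hp : (Real.pi : ℂ) ^ (-s / 2) ≠ 0 := by simp [hpi]
  rw [logDeriv_apply, h4.deriv, Gammaℝ_def, ← Complex.ofReal_log Real.pi_pos.le]
  field_simp

lemma gQ_logDeriv {a : ℝ} {s : ℂ} (hs : s.im ≠ 0) :
    deriv (gQ a) s / gQ a s = (Real.log Real.pi : ℝ) -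
      (deriv Complex.Gamma ((1 - s + a) / 2) / Complex.Gamma ((1 - s + a) / 2)) / 2 -
      (deriv Complex.Gamma ((s + a) / 2) / Complex.Gamma ((s + a) / 2)) / 2 := by
  have i1 : (1 - s + (a:ℂ)).im ≠ 0 := by simpa using hs
  have i2 : (s + (a:ℂ)).im ≠ 0 := by simpa using hs
  have h3 : HasDerivAt (fun s : ℂ => 1 - s + a) (-1) s := by
    simpa using ((hasDerivAt_id s).const_sub 1).add_const (a : ℂ)
  have h4 : HasDerivAt (fun s : ℂ => s + a) 1 s := (hasDerivAt_id s).add_const (a:ℂ)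
  have g1 : HasDerivAt (fun s : ℂ => Gammaℝ (1 - s + a)) (deriv Gammaℝ (1 - s + a) * (-1)) s :=
    HasDerivAt.comp (h₂ := Gammaℝ) s (differentiableAt_GammaR i1).hasDerivAt h3
  have g2 : HasDerivAt (fun s : ℂ => Gammaℝ (s + a)) (deriv Gammaℝ (s + a) * 1) s :=
    HasDerivAt.comp (h₂ := Gammaℝ) s (differentiableAt_GammaR i2).hasDerivAt h4
  have n1 := GammaR_ne_zero_of_im i1
  have n2 := GammaR_ne_zero_of_im i2
  have h5 : HasDerivAt (gQ a) _ s := g1.div g2 n2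
  have l1 := logDeriv_GammaR i1
  have l2 := logDeriv_GammaR i2
  rw [logDeriv_apply] at l1 l2
  rw [h5.deriv]
  have : (deriv Gammaℝ (1 - s + a) * (-1) * Gammaℝ (s + a) - Gammaℝ (1 - s + a) * (deriv Gammaℝ (s + a) * 1)) / Gammaℝ (s + a) ^ 2 / gQ a s =
      -(deriv Gammaℝ (1 - s + a) / Gammaℝ (1 - s + a)) - deriv Gammaℝ (s + a) / Gammaℝ (s + a) := by
    unfold gQ
    field_simp
  rw [this, l1, l2]
  ring

lemma gQ_logDeriv_bound {a : ℝ} (ha0 : 0 ≤ a) (ha1 : a ≤ 1) {s : ℂ} (hy : 4 ≤ s.im)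
    (h1 : -(3/2) ≤ s.re) (h2 : s.re ≤ 5/2) :
    ‖deriv (gQ a) s / gQ a s‖ ≤ 96 * Real.log (3 * s.im) + 34 := by
  have hs : s.im ≠ 0 := by linarith
  rw [gQ_logDeriv hs]
  have e1 : |((1 - s + (a:ℂ)) / 2).im| = s.im / 2 := by
    simp [abs_div, abs_of_pos (by linarith : (0:ℝ) < s.im)]
  have e2 : |((s + (a:ℂ)) / 2).im| = s.im / 2 := by
    simp [abs_div, abs_of_pos (by linarith : (0:ℝ) < s.im)]
  have d1 := digamma_bound (z := (1 - s + a) / 2)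
    (by simp only [Complex.div_ofNat_re, sub_re, add_re, one_re, ofReal_re]; rw [abs_le]; constructor <;> linarith)
    (by rw [e1]; linarith)
  have d2 := digamma_bound (z := (s + a) / 2)
    (by simp only [Complex.div_ofNat_re, add_re, ofReal_re]; rw [abs_le]; constructor <;> linarith)
    (by rw [e2]; linarith)
  rw [e1] at d1
  rw [e2] at d2
  have e3 : 6 * (s.im / 2) = 3 * s.im := by ring
  rw [e3] at d1 d2
  have hlog : ‖((Real.log Real.pi : ℝ) : ℂ)‖ ≤ 2 := by
    rw [Complex.norm_real, Real.norm_eq_abs, abs_of_nonneg (Real.log_nonneg (by linarith [Real.pi_gt_three]))]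
    rw [Real.log_le_iff_le_exp Real.pi_pos]
    have := Real.add_one_le_exp (1:ℝ)
    have h3 : Real.exp 2 = Real.exp 1 * Real.exp 1 := by rw [← Real.exp_add]; norm_num
    have := Real.pi_lt_four
    nlinarith
  refine (norm_sub_le _ _).trans ?_
  refine (add_le_add (norm_sub_le _ _) le_rfl).trans ?_
  rw [norm_div (_ / _), norm_div (_ / _), Complex.norm_two]
  linarith

end ZS
end

section
namespace ZS
open Complex Set

lemma conj_char {N : ℕ} [NeZero N] (θ : DirichletCharacter ℂ N) (a : ZMod N) :
    (starRingEnd ℂ) (θ a) = θ⁻¹ a := by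
  rw [MulChar.inv_apply_eq_inv']
  by_cases h : IsUnit a
  · rw [Complex.inv_def]
    have h1 : ‖θ a‖ = 1 := by
      obtain ⟨u, rfl⟩ := h
      exact θ.unit_norm_eq_one u
    rw [Complex.normSq_eq_norm_sq, h1]; simp
  · rw [MulChar.map_nonunit _ h]; simp

lemma conj_natCast_cpow (n : ℕ) (s : ℂ) :
    (starRingEnd ℂ) ((n : ℂ) ^ s) = (n : ℂ) ^ ((starRingEnd ℂ) s) := by
  have h := Complex.cpow_conj (n : ℂ) s (by
    rw [Complex.natCast_arg]; exact Real.pi_ne_zero.symm)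
  rw [Complex.conj_natCast] at h
  exact h.symm

lemma LFunction_conj {N : ℕ} [NeZero N] (θ : DirichletCharacter ℂ N) (hθ : θ ≠ 1) (s : ℂ) :
    DirichletCharacter.LFunction θ⁻¹ s =
      (starRingEnd ℂ) (DirichletCharacter.LFunction θ ((starRingEnd ℂ) s)) := by
  have hθ' : θ⁻¹ ≠ 1 := by simpa using hθ
  have h1 : AnalyticOnNhd ℂ (DirichletCharacter.LFunction θ⁻¹) univ :=
    (DirichletCharacter.differentiable_LFunction hθ').differentiableOn.analyticOnNhd isOpen_univ
  have h2d : Differentiable ℂ (fun s => (starRingEnd ℂ) (DirichletCharacter.LFunction θ ((starRingEnd ℂ) s))) := by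
    intro z
    have h := DifferentiableAt.conj_conj (x := (starRingEnd ℂ) z)
      (DirichletCharacter.differentiable_LFunction hθ ((starRingEnd ℂ) z))
    rw [Complex.conj_conj] at h
    exact h
  have h2 : AnalyticOnNhd ℂ (fun s => (starRingEnd ℂ) (DirichletCharacter.LFunction θ ((starRingEnd ℂ) s))) univ :=
    h2d.differentiableOn.analyticOnNhd isOpen_univ
  have h3 := h1.eqOn_of_preconnected_of_eventuallyEq h2 isPreconnected_univ (mem_univ (2:ℂ)) ?_
  · exact h3 (mem_univ s)
  · have hop : IsOpen {z : ℂ | 1 < z.re} := isOpen_lt continuous_const Complex.continuous_re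
    filter_upwards [hop.mem_nhds (show (2:ℂ) ∈ {z : ℂ | 1 < z.re} by simp)] with z hz
    have hz' : 1 < ((starRingEnd ℂ) z).re := by simpa using hz
    rw [DirichletCharacter.LFunction_eq_LSeries _ hz, DirichletCharacter.LFunction_eq_LSeries _ hz']
    unfold LSeries
    rw [Complex.conj_tsum]
    apply tsum_congr
    intro n
    rcases eq_or_ne n 0 with rfl | hn
    · simp
    · rw [LSeries.term_of_ne_zero hn, LSeries.term_of_ne_zero hn, map_div₀, conj_natCast_cpow,
        conj_char, Complex.conj_conj]

/-- the factor of the functional equation -/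
def ZN (N : ℕ) (W : ℂ) (a : ℝ) (s : ℂ) : ℂ := W * (N : ℂ) ^ (1 / 2 - s) * gQ a s

lemma func_eq {N : ℕ} [NeZero N] (hN : 2 ≤ N) (θ : DirichletCharacter ℂ N) (hθ : θ.IsPrimitive) :
    ∃ W : ℂ, ∃ a : ℝ, 0 ≤ a ∧ a ≤ 1 ∧ ‖W‖ = 1 ∧ ∀ s : ℂ, s.im ≠ 0 →
      DirichletCharacter.LFunction θ s = ZN N W a s *
        (starRingEnd ℂ) (DirichletCharacter.LFunction θ (1 - (starRingEnd ℂ) s)) := by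
  have hθ1 : θ ≠ 1 := by
    rintro rfl
    have : (1 : DirichletCharacter ℂ N).conductor = N := hθ
    rw [DirichletCharacter.conductor_one] at this
    omega
  obtain ⟨a, ha, hγ, hγ'⟩ : ∃ a : ℝ, (0 ≤ a ∧ a ≤ 1) ∧ (∀ s, DirichletCharacter.gammaFactor θ s = Gammaℝ (s + a)) ∧
      (∀ s, DirichletCharacter.gammaFactor θ⁻¹ s = Gammaℝ (s + a)) := by
    have hinv : θ⁻¹ (-1) = (θ (-1))⁻¹ := MulChar.inv_apply_eq_inv' θ (-1)
    rcases θ.even_or_odd with h | h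
    · have h' : θ⁻¹.Even := by
        unfold DirichletCharacter.Even at h ⊢
        rw [hinv, h]; simp
      exact ⟨0, by norm_num, fun s => by rw [h.gammaFactor_def]; simp,
        fun s => by rw [h'.gammaFactor_def]; simp⟩
    · have h' : θ⁻¹.Odd := by
        unfold DirichletCharacter.Odd at h ⊢
        rw [hinv, h]; norm_num
      exact ⟨1, by norm_num, fun s => by rw [h.gammaFactor_def]; simp,
        fun s => by rw [h'.gammaFactor_def]; simp⟩
  have hN1 : N ≠ 1 := by omega
  have hfe : ∀ s : ℂ, s.im ≠ 0 →
      DirichletCharacter.LFunction θ s = ZN N (DirichletCharacter.rootNumber θ) a s *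
        (starRingEnd ℂ) (DirichletCharacter.LFunction θ (1 - (starRingEnd ℂ) s)) := by
    intro s hs
    have h1 := hθ.completedLFunction_one_sub (1 - s)
    rw [sub_sub_cancel] at h1
    have h2 := DirichletCharacter.LFunction_eq_completed_div_gammaFactor θ s (Or.inr hN1)
    have h3 := DirichletCharacter.LFunction_eq_completed_div_gammaFactor θ⁻¹ (1 - s) (Or.inr hN1)
    have h4 := LFunction_conj θ hθ1 (1 - s)
    have e1 : (starRingEnd ℂ) (1 - s) = 1 - (starRingEnd ℂ) s := by simp
    rw [e1] at h4
    rw [hγ] at h2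
    rw [hγ'] at h3
    have n1 : Gammaℝ (1 - s + a) ≠ 0 := GammaR_ne_zero_of_im (by simpa using hs)
    have h5 : DirichletCharacter.completedLFunction θ⁻¹ (1 - s) =
        DirichletCharacter.LFunction θ⁻¹ (1 - s) * Gammaℝ (1 - s + a) := by
      rw [h3]; field_simp
    rw [← h4, h2, h1, h5]
    unfold ZN gQ
    have e2 : (1 - s - 1 / 2 : ℂ) = 1 / 2 - s := by ring
    rw [e2]
    ring
  refine ⟨DirichletCharacter.rootNumber θ, a, ha.1, ha.2, ?_, hfe⟩
  -- norm of the root number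
  set W := DirichletCharacter.rootNumber θ
  have hs : (2 + I : ℂ).im ≠ 0 := by simp
  have hs' : (1 - (starRingEnd ℂ) (2 + I : ℂ)).im ≠ 0 := by simp
  have h1 := hfe _ hs
  have h2 := hfe _ hs'
  have e : 1 - (starRingEnd ℂ) (1 - (starRingEnd ℂ) (2 + I : ℂ)) = 2 + I := by simp
  rw [e] at h2
  rw [h2, map_mul, Complex.conj_conj, ← mul_assoc] at h1
  have hL : DirichletCharacter.LFunction θ (2 + I) ≠ 0 :=
    DirichletCharacter.LFunction_ne_zero_of_one_le_re θ (Or.inl hθ1) (by simp)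
  have h3 : ZN N W a (2 + I) * (starRingEnd ℂ) (ZN N W a (1 - (starRingEnd ℂ) (2 + I : ℂ))) = 1 := by
    have := mul_right_cancel₀ hL (h1.symm.trans (one_mul _).symm)
    exact this
  unfold ZN at h3
  rw [map_mul, map_mul, conj_natCast_cpow] at h3
  have h4 := gQ_refl (a := a) hs
  have hN0 : (N : ℂ) ≠ 0 := by exact_mod_cast NeZero.ne N
  have h5 : (N : ℂ) ^ (1 / 2 - (2 + I)) * (N : ℂ) ^ ((starRingEnd ℂ) (1 / 2 - (1 - (starRingEnd ℂ) (2 + I)))) = 1 := by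
    rw [← Complex.cpow_add _ _ hN0]
    have : (1 / 2 - (2 + I) + (starRingEnd ℂ) (1 / 2 - (1 - (starRingEnd ℂ) (2 + I))) : ℂ) = 0 := by
      simp [Complex.conj_ofNat]; try ring
    rw [this, Complex.cpow_zero]
  have h6 : W * (starRingEnd ℂ) W = 1 := by
    linear_combination h3 - W * (starRingEnd ℂ) W * (N : ℂ) ^ (1 / 2 - (2 + I)) * (N : ℂ) ^ ((starRingEnd ℂ) (1 / 2 - (1 - (starRingEnd ℂ) (2 + I)))) * h4 - W * (starRingEnd ℂ) W * h5
  rw [Complex.mul_conj, Complex.normSq_eq_norm_sq] at h6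
  have h7 : ‖W‖ ^ 2 = 1 := by exact_mod_cast h6
  nlinarith [norm_nonneg W]

section
variable {N : ℕ} {W : ℂ} {a : ℝ}

lemma ZN_ne_zero (hN : 2 ≤ N) (hW : ‖W‖ = 1) {s : ℂ} (hs : s.im ≠ 0) : ZN N W a s ≠ 0 := by
  unfold ZN
  have hN0 : (N : ℂ) ≠ 0 := by exact_mod_cast (by omega : N ≠ 0)
  have hW0 : W ≠ 0 := by intro h; rw [h] at hW; simp at hW
  refine mul_ne_zero (mul_ne_zero hW0 ?_) (gQ_ne_zero hs)
  simp [hN0]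

lemma ZN_hasDeriv (hN : 2 ≤ N) {s : ℂ} (hs : s.im ≠ 0) :
    HasDerivAt (ZN N W a) (ZN N W a s * (-(Real.log N : ℝ) + deriv (gQ a) s / gQ a s)) s := by
  have hN0 : (N : ℂ) ≠ 0 := by exact_mod_cast (by omega : N ≠ 0)
  have h1 : HasDerivAt (fun s : ℂ => (N : ℂ) ^ (1 / 2 - s)) ((N : ℂ) ^ (1 / 2 - s) * Complex.log N * (-1)) s := by
    have : HasDerivAt (fun s : ℂ => 1 / 2 - s) (-1) s := (hasDerivAt_id s).const_sub (1 / 2)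
    exact this.const_cpow (Or.inl hN0)
  have h2 := (h1.const_mul W).mul (gQ_diff (a := a) hs).hasDerivAt
  have h3 := gQ_ne_zero (a := a) hs
  have e : ZN N W a s * (-(Real.log N : ℝ) + deriv (gQ a) s / gQ a s) =
      W * ((N : ℂ) ^ (1 / 2 - s) * Complex.log N * (-1)) * gQ a s +
        W * (N : ℂ) ^ (1 / 2 - s) * deriv (gQ a) s := by
    rw [← Complex.natCast_log]
    unfold ZN
    field_simp
  rw [e]
  exact h2

lemma ZN_refl (hN : 2 ≤ N) (hW : ‖W‖ = 1) {s : ℂ} (hs : s.im ≠ 0) :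
    ZN N W a s * (starRingEnd ℂ) (ZN N W a (1 - (starRingEnd ℂ) s)) = 1 := by
  have hN0 : (N : ℂ) ≠ 0 := by exact_mod_cast (by omega : N ≠ 0)
  unfold ZN
  rw [map_mul, map_mul, conj_natCast_cpow]
  have h4 := gQ_refl (a := a) hs
  have h5 : (N : ℂ) ^ (1 / 2 - s) * (N : ℂ) ^ ((starRingEnd ℂ) (1 / 2 - (1 - (starRingEnd ℂ) s))) = 1 := by
    rw [← Complex.cpow_add _ _ hN0]
    have : (1 / 2 - s + (starRingEnd ℂ) (1 / 2 - (1 - (starRingEnd ℂ) s)) : ℂ) = 0 := by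
      simp [Complex.conj_ofNat]; try ring
    rw [this, Complex.cpow_zero]
  have h6 : W * (starRingEnd ℂ) W = 1 := by
    rw [Complex.mul_conj, Complex.normSq_eq_norm_sq, hW]; simp
  linear_combination h6 * (N : ℂ) ^ (1 / 2 - s) * (N : ℂ) ^ ((starRingEnd ℂ) (1 / 2 - (1 - (starRingEnd ℂ) s))) * gQ a s * (starRingEnd ℂ) (gQ a (1 - (starRingEnd ℂ) s)) + h5 * gQ a s * (starRingEnd ℂ) (gQ a (1 - (starRingEnd ℂ) s)) + h4

lemma ZN_norm_right (hN : 2 ≤ N) (hW : ‖W‖ = 1) (ha0 : 0 ≤ a) (ha1 : a ≤ 1) {s : ℂ} (hs : 4 ≤ s.im)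
    (hre : s.re = 5 / 2) :
    ‖ZN N W a s‖ ≤ 40 / (N * s.im) ^ 2 ∧ 1 / (N * (s.im + 4)) ^ 2 ≤ ‖ZN N W a s‖ := by
  have hNpos : (0:ℝ) < N := by exact_mod_cast (by omega : 0 < N)
  have h0 : s.im ≠ 0 := by linarith
  have h1 := gQ_norm (a := a) h0 hre
  have h2 : ‖ZN N W a s‖ = ‖gQ a s‖ / (N:ℝ) ^ 2 := by
    unfold ZN
    rw [norm_mul, norm_mul, hW, one_mul]
    have : ((N : ℂ)) = ((N : ℝ) : ℂ) := by simp
    rw [this, Complex.norm_cpow_eq_rpow_re_of_pos hNpos]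
    have e : (1 / 2 - s : ℂ).re = -2 := by simp [hre]; norm_num
    rw [e, Real.rpow_neg hNpos.le, Real.rpow_two]
    field_simp
  have i1 : (1 - s + (a:ℂ)).im = -s.im := by simp
  have i2 : (1 - s + (a:ℂ) + 2).im = -s.im := by simp
  have l1 : s.im ≤ ‖1 - s + (a:ℂ)‖ := by
    have := Complex.abs_im_le_norm (1 - s + (a:ℂ))
    rw [i1, abs_neg] at this; exact (le_abs_self _).trans this
  have l2 : s.im ≤ ‖1 - s + (a:ℂ) + 2‖ := by
    have := Complex.abs_im_le_norm (1 - s + (a:ℂ) + 2)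
    rw [i2, abs_neg] at this; exact (le_abs_self _).trans this
  have u1 : ‖1 - s + (a:ℂ)‖ ≤ s.im + 4 := by
    have := Complex.norm_le_abs_re_add_abs_im (1 - s + (a:ℂ))
    rw [i1, abs_neg, abs_of_pos (by linarith : (0:ℝ) < s.im)] at this
    have h3 : |(1 - s + (a:ℂ)).re| ≤ 4 := by
      simp only [sub_re, add_re, one_re, ofReal_re, hre]; rw [abs_le]; constructor <;> linarith
    linarith
  have u2 : ‖1 - s + (a:ℂ) + 2‖ ≤ s.im + 4 := by
    have := Complex.norm_le_abs_re_add_abs_im (1 - s + (a:ℂ) + 2)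
    rw [i2, abs_neg, abs_of_pos (by linarith : (0:ℝ) < s.im)] at this
    have h3 : |(1 - s + (a:ℂ) + 2).re| ≤ 4 := by
      simp only [sub_re, add_re, one_re, ofReal_re, hre, Complex.re_ofNat]; rw [abs_le]; constructor <;> linarith
    linarith
  have hpi1 := Real.pi_lt_d2
  have hpi2 := Real.pi_gt_three
  have hg := norm_nonneg (gQ a s)
  rw [h2]
  constructor
  · rw [div_le_div_iff₀ (by positivity) (by positivity), mul_pow]
    have : ‖gQ a s‖ * s.im ^ 2 ≤ 40 := by
      calc ‖gQ a s‖ * s.im ^ 2 = ‖gQ a s‖ * (s.im * s.im) := by ring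
        _ ≤ ‖gQ a s‖ * (‖1 - s + (a:ℂ)‖ * ‖1 - s + (a:ℂ) + 2‖) := by gcongr
        _ = _ := h1
        _ ≤ 40 := by nlinarith
    nlinarith [sq_nonneg (N:ℝ)]
  · rw [div_le_div_iff₀ (by positivity) (by positivity), mul_pow]
    have : 1 ≤ ‖gQ a s‖ * (s.im + 4) ^ 2 := by
      calc (1:ℝ) ≤ (2 * Real.pi) ^ 2 := by nlinarith
        _ = ‖gQ a s‖ * (‖1 - s + (a:ℂ)‖ * ‖1 - s + (a:ℂ) + 2‖) := h1.symm
        _ ≤ ‖gQ a s‖ * ((s.im + 4) * (s.im + 4)) := by gcongr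
        _ = _ := by ring
    nlinarith [sq_nonneg (N:ℝ)]

end

end ZS
end

section
namespace ZS
open Complex Set

lemma chiPsi_primitive {D p : ℕ} (hD : D ≠ 0) (hp : p ≠ 0) (hc : Nat.Coprime D p)
    (χ : DirichletCharacter ℂ D) (ψ : DirichletCharacter ℂ p)
    (hχ : χ.IsPrimitive) (hψ : ψ.IsPrimitive) : (chiPsi D χ ψ).IsPrimitive := by
  haveI : NeZero D := ⟨hD⟩
  haveI : NeZero p := ⟨hp⟩
  haveI : NeZero (D * p) := ⟨mul_ne_zero hD hp⟩
  set A := DirichletCharacter.changeLevel (dvd_mul_right D p) χ with hA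
  set B := DirichletCharacter.changeLevel (dvd_mul_left p D) ψ with hB
  have hχ' : χ.conductor = D := hχ
  have hψ' : ψ.conductor = p := hψ
  have cA : A.conductor = D := by
    rw [hA, DirichletCharacter.conductor_changeLevel, hχ']
  have cB : B.conductor = p := by
    rw [hB, DirichletCharacter.conductor_changeLevel, hψ']
  have e : chiPsi D χ ψ = A * B := rfl
  have h1 : A = (A * B) * B⁻¹ := by simp
  have h2 : B = (A * B) * A⁻¹ := by rw [mul_comm A B]; simp
  have d1 := DirichletCharacter.conductor_mul_dvd_lcm_conductor (A * B) B⁻¹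
  have d2 := DirichletCharacter.conductor_mul_dvd_lcm_conductor (A * B) A⁻¹
  rw [← h1, DirichletCharacter.conductor_inv, cA, cB] at d1
  rw [← h2, DirichletCharacter.conductor_inv, cA, cB] at d2
  have d1' : D ∣ (A * B).conductor := by
    have : D ∣ (A * B).conductor * p := d1.trans (Nat.lcm_dvd_mul _ _)
    exact hc.dvd_of_dvd_mul_right this
  have d2' : p ∣ (A * B).conductor := by
    have : p ∣ (A * B).conductor * D := d2.trans (Nat.lcm_dvd_mul _ _)
    exact hc.symm.dvd_of_dvd_mul_right this
  have d3 : D * p ∣ (A * B).conductor := hc.mul_dvd_of_dvd_of_dvd d1' d2'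
  rw [e]
  exact Nat.dvd_antisymm (DirichletCharacter.conductor_dvd_level _) d3

lemma chiPsi_apply {D p : ℕ} (χ : DirichletCharacter ℂ D) (ψ : DirichletCharacter ℂ p) (n : ℕ) :
    chiPsi D χ ψ (n : ZMod (D * p)) = χ (n : ZMod D) * ψ (n : ZMod p) := by
  unfold chiPsi
  rw [MulChar.mul_apply]
  by_cases h : IsUnit (n : ZMod (D * p))
  · have := DirichletCharacter.changeLevel_eq_cast_of_dvd χ (dvd_mul_right D p)
    obtain ⟨u, hu⟩ := h
    rw [← hu, DirichletCharacter.changeLevel_eq_cast_of_dvd, DirichletCharacter.changeLevel_eq_cast_of_dvd, hu]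
    rw [ZMod.cast_natCast (dvd_mul_right D p), ZMod.cast_natCast (dvd_mul_left p D)]
  · rw [MulChar.map_nonunit _ h, zero_mul]
    rw [ZMod.isUnit_iff_coprime] at h
    rw [Nat.coprime_mul_iff_right, not_and_or] at h
    rcases h with h | h
    · rw [MulChar.map_nonunit χ (by rwa [ZMod.isUnit_iff_coprime]), zero_mul]
    · rw [MulChar.map_nonunit ψ (by rwa [ZMod.isUnit_iff_coprime]), mul_zero]

end ZS
end

section
namespace ZS
open Complex Set

lemma sum_range_char {N : ℕ} [NeZero N] (θ : DirichletCharacter ℂ N) (hθ : θ ≠ 1) :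
    ∑ k ∈ Finset.range N, θ (k : ZMod N) = 0 := by
  rw [← MulChar.sum_eq_zero_of_ne_one hθ]
  apply Finset.sum_nbij (fun k : ℕ => (k : ZMod N))
  · intro k _; exact Finset.mem_univ _
  · intro i hi j hj h
    have hi' : i < N := by simpa using hi
    have hj' : j < N := by simpa using hj
    have h' : (i : ZMod N) = (j : ZMod N) := h
    rw [ZMod.natCast_eq_natCast_iff'] at h'
    rwa [Nat.mod_eq_of_lt hi', Nat.mod_eq_of_lt hj'] at h'
  · intro a _
    exact ⟨a.val, by simpa using ZMod.val_lt a, by simp⟩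
  · intro k _; rfl

lemma norm_sum_range_char {N : ℕ} [NeZero N] (θ : DirichletCharacter ℂ N) (hθ : θ ≠ 1) (n : ℕ) :
    ‖∑ k ∈ Finset.range n, θ (k : ZMod N)‖ ≤ N := by
  induction n using Nat.strong_induction_on with
  | _ n ih =>
    by_cases h : n < N
    · calc ‖∑ k ∈ Finset.range n, θ (k : ZMod N)‖ ≤ ∑ k ∈ Finset.range n, (1:ℝ) :=
            norm_sum_le_of_le _ (fun k _ => θ.norm_le_one _)
        _ = n := by simp
        _ ≤ N := by exact_mod_cast h.le
    · obtain ⟨m, rfl⟩ := Nat.exists_eq_add_of_le (not_lt.mp h)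
      rw [Finset.sum_range_add, sum_range_char θ hθ, zero_add]
      have hN := Nat.pos_of_ne_zero (NeZero.ne N)
      have := ih m (by omega)
      simpa using this

lemma norm_sum_Icc_char {N : ℕ} [NeZero N] (θ : DirichletCharacter ℂ N) (hθ : θ ≠ 1) (n : ℕ) :
    ‖∑ k ∈ Finset.Icc 1 n, θ (k : ZMod N)‖ ≤ N + 1 := by
  have h := norm_sum_range_char θ hθ (n + 1)
  rw [Finset.range_eq_Ico, Finset.sum_eq_sum_Ico_succ_bot (by omega)] at h
  have e : Finset.Ico (0+1) (n+1) = Finset.Icc 1 n := by ext; simp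
  rw [e] at h
  have h1 : ‖θ ((0:ℕ) : ZMod N)‖ ≤ 1 := θ.norm_le_one _
  calc ‖∑ k ∈ Finset.Icc 1 n, θ (k : ZMod N)‖
      = ‖(θ ((0:ℕ) : ZMod N) + ∑ k ∈ Finset.Icc 1 n, θ (k : ZMod N)) - θ ((0:ℕ) : ZMod N)‖ := by
        rw [add_sub_cancel_left]
    _ ≤ _ := norm_sub_le _ _
    _ ≤ N + 1 := by linarith

/-- the summatory function cut at one -/
def SF {N : ℕ} (θ : DirichletCharacter ℂ N) (t : ℝ) : ℂ :=
  (Ioi (1:ℝ)).indicator (fun t => ∑ k ∈ Finset.Icc 1 ⌊t⌋₊, θ (k : ZMod N)) t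

lemma SF_norm {N : ℕ} [NeZero N] (θ : DirichletCharacter ℂ N) (hθ : θ ≠ 1) (t : ℝ) :
    ‖SF θ t‖ ≤ N + 1 := by
  unfold SF
  refine (norm_indicator_le_norm_self _ _).trans (norm_sum_Icc_char θ hθ _)

lemma SF_meas {N : ℕ} (θ : DirichletCharacter ℂ N) : Measurable (SF θ) := by
  unfold SF
  apply Measurable.indicator _ measurableSet_Ioi
  exact (measurable_from_nat (f := fun m : ℕ => ∑ k ∈ Finset.Icc 1 m, θ (k : ZMod N))).comp Nat.measurable_floor

lemma mellin_SF_diff {N : ℕ} [NeZero N] (θ : DirichletCharacter ℂ N) (hθ : θ ≠ 1) {s : ℂ}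
    (hs : s.re < 0) : DifferentiableAt ℂ (mellin (SF θ)) s := by
  refine mellin_differentiableAt_of_isBigO_rpow (a := 0) (b := s.re - 1) ?_ ?_ hs ?_ (by linarith)
  · have : MeasureTheory.LocallyIntegrable (SF θ) := by
      intro x
      refine ⟨Metric.closedBall x 1, Metric.closedBall_mem_nhds _ one_pos, ?_⟩
      refine MeasureTheory.Measure.integrableOn_of_bounded (M := N + 1) ?_ (SF_meas θ).aestronglyMeasurable ?_
      · exact MeasureTheory.measure_closedBall_lt_top.ne
      · exact Filter.Eventually.of_forall (SF_norm θ hθ)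
    exact this.locallyIntegrableOn _
  · simp only [neg_zero, Real.rpow_zero]
    refine Asymptotics.IsBigO.of_bound (N + 1) (Filter.Eventually.of_forall fun t => ?_)
    simpa using SF_norm θ hθ t
  · refine Asymptotics.IsBigO.of_bound 1 ?_
    filter_upwards [mem_nhdsWithin_of_mem_nhds (Iio_mem_nhds (show (0:ℝ) < 1 by norm_num))] with t ht
    have : SF θ t = 0 := by
      unfold SF; rw [indicator_of_notMem]; simpa using (le_of_lt ht)
    rw [this]; simp

lemma LFunction_eq_mellin {N : ℕ} [NeZero N] (θ : DirichletCharacter ℂ N) (hθ : θ ≠ 1) {s : ℂ}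
    (hs : 0 < s.re) : DirichletCharacter.LFunction θ s = s * mellin (SF θ) (-s) := by
  have hop : IsOpen {z : ℂ | 0 < z.re} := isOpen_lt continuous_const Complex.continuous_re
  have h1 : AnalyticOnNhd ℂ (DirichletCharacter.LFunction θ) {z : ℂ | 0 < z.re} :=
    (DirichletCharacter.differentiable_LFunction hθ).differentiableOn.analyticOnNhd hop
  have h2 : AnalyticOnNhd ℂ (fun s => s * mellin (SF θ) (-s)) {z : ℂ | 0 < z.re} := by
    apply DifferentiableOn.analyticOnNhd _ hop
    intro z hz
    have hz' : (-z).re < 0 := by simpa using hz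
    have hd := mellin_SF_diff θ hθ hz'
    have hc : DifferentiableAt ℂ (fun s => mellin (SF θ) (-s)) z :=
      DifferentiableAt.comp (g := mellin (SF θ)) z hd (by fun_prop)
    exact (differentiableAt_id.mul hc).differentiableWithinAt
  have hconn : IsPreconnected {z : ℂ | 0 < z.re} :=
    (convex_halfSpace_re_gt 0).isPreconnected
  refine h1.eqOn_of_preconnected_of_eventuallyEq h2 hconn (show (2:ℂ) ∈ {z : ℂ | 0 < z.re} by simp) ?_ hs
  have hop1 : IsOpen {z : ℂ | 1 < z.re} := isOpen_lt continuous_const Complex.continuous_re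
  filter_upwards [hop1.mem_nhds (show (2:ℂ) ∈ {z : ℂ | 1 < z.re} by simp)] with z hz
  have hz1 : 1 < z.re := hz
  rw [DirichletCharacter.LFunction_eq_LSeries _ hz1]
  rw [LSeries_eq_mul_integral (fun n => θ (n : ZMod N)) (r := 0) le_rfl (by linarith)
    (DirichletCharacter.LSeriesSummable_of_one_lt_re θ hz1) ?_]
  · congr 1
    unfold mellin
    have : Ioi (1:ℝ) ⊆ Ioi 0 := Ioi_subset_Ioi zero_le_one
    rw [← MeasureTheory.integral_indicator measurableSet_Ioi, ← MeasureTheory.integral_indicator measurableSet_Ioi]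
    congr 1
    ext t
    by_cases ht : t ∈ Ioi (1:ℝ)
    · rw [indicator_of_mem ht, indicator_of_mem (this ht), SF, indicator_of_mem ht, smul_eq_mul, mul_comm]
      congr 2; ring
    · rw [indicator_of_notMem ht]
      by_cases h0 : t ∈ Ioi (0:ℝ)
      · rw [indicator_of_mem h0, SF, indicator_of_notMem ht, smul_zero]
      · rw [indicator_of_notMem h0]
  · simp only [Real.rpow_zero]
    refine Asymptotics.IsBigO.of_bound (N + 1) (Filter.Eventually.of_forall fun n => ?_)
    simpa using norm_sum_Icc_char θ hθ n

/-- crude bound for the L-function -/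
lemma LFunction_bound {N : ℕ} [NeZero N] (θ : DirichletCharacter ℂ N) (hθ : θ ≠ 1) {s : ℂ}
    (hs : 1 / 2 ≤ s.re) : ‖DirichletCharacter.LFunction θ s‖ ≤ 2 * (N + 1) * ‖s‖ := by
  have hs0 : 0 < s.re := by linarith
  rw [LFunction_eq_mellin θ hθ hs0, norm_mul, mul_comm]
  gcongr
  unfold mellin
  have hIntg : MeasureTheory.IntegrableOn (fun t : ℝ => (N + 1 : ℝ) * t ^ (-(3/2) : ℝ)) (Ioi 1) :=
    (integrableOn_Ioi_rpow_of_lt (by norm_num) one_pos).const_mul _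
  have key : ‖∫ t in Ioi (0:ℝ), (t : ℂ) ^ (-s - 1) • SF θ t‖ ≤
      ∫ t in Ioi (1:ℝ), (N + 1 : ℝ) * t ^ (-(3/2) : ℝ) := by
    have e : ∫ t in Ioi (0:ℝ), (t : ℂ) ^ (-s - 1) • SF θ t = ∫ t in Ioi (1:ℝ), (t : ℂ) ^ (-s - 1) • SF θ t := by
      have : Ioi (1:ℝ) ⊆ Ioi 0 := Ioi_subset_Ioi zero_le_one
      apply MeasureTheory.setIntegral_eq_of_subset_of_forall_sdiff_eq_zero measurableSet_Ioi this
      intro t ht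
      rw [SF, indicator_of_notMem ht.2, smul_zero]
    rw [e]
    apply MeasureTheory.norm_integral_le_of_norm_le hIntg
    rw [MeasureTheory.ae_restrict_iff' measurableSet_Ioi]
    refine Filter.Eventually.of_forall fun t ht => ?_
    have ht1 : (1:ℝ) < t := ht
    rw [norm_smul, mul_comm, Complex.norm_cpow_eq_rpow_re_of_pos (by linarith)]
    gcongr
    · exact SF_norm θ hθ t
    · exact ht1.le
    · simp; linarith
  refine key.trans ?_
  rw [MeasureTheory.integral_const_mul, integral_Ioi_rpow_of_lt (by norm_num) one_pos]
  norm_num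
  linarith

end ZS
end

section
namespace ZS
open Complex Set

lemma gron {f f' : ℝ → ℂ} {b K δ : ℝ} (hb : 0 ≤ b) (hf : ∀ x ∈ Icc 0 b, HasDerivAt f (f' x) x)
    (hK : ∀ x ∈ Icc 0 b, ‖f' x‖ ≤ K * ‖f x‖) (h0 : ‖f 0‖ ≤ δ) : ‖f b‖ ≤ δ * Real.exp (K * b) := by
  have h := norm_le_gronwallBound_of_norm_deriv_right_le (f := f) (f' := f') (δ := δ) (K := K) (ε := 0)
    (a := 0) (b := b) (fun x hx => (hf x hx).continuousAt.continuousWithinAt)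
    (fun x hx => (hf x ⟨hx.1, hx.2.le⟩).hasDerivWithinAt) h0
    (fun x hx => by simpa using hK x ⟨hx.1, hx.2.le⟩) b ⟨hb, le_rfl⟩
  rw [gronwallBound_ε0] at h
  simpa using h

lemma ZN_norm_crit {N : ℕ} {W : ℂ} {a : ℝ} (hN : 2 ≤ N) (hW : ‖W‖ = 1) {s : ℂ} (hs : s.im ≠ 0)
    (hre : s.re = 1 / 2) : ‖ZN N W a s‖ = 1 := by
  have h := ZN_refl (a := a) hN hW hs
  have e : 1 - (starRingEnd ℂ) s = s := by
    apply Complex.ext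
    · simp [hre]; norm_num
    · simp
  rw [e, Complex.mul_conj, Complex.normSq_eq_norm_sq] at h
  have h7 : ‖ZN N W a s‖ ^ 2 = 1 := by exact_mod_cast h
  nlinarith [norm_nonneg (ZN N W a s)]

lemma ZN_logDeriv_bound {N : ℕ} {a : ℝ} (hN : 2 ≤ N) (ha0 : 0 ≤ a) (ha1 : a ≤ 1) {s : ℂ}
    (hy : 4 ≤ s.im) (h1 : -(3/2) ≤ s.re) (h2 : s.re ≤ 5/2) :
    ‖-(Real.log N : ℝ) + deriv (gQ a) s / gQ a s‖ ≤ Real.log N + (96 * Real.log (3 * s.im) + 34) := by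
  refine (norm_add_le _ _).trans (add_le_add ?_ (gQ_logDeriv_bound ha0 ha1 hy h1 h2))
  rw [norm_neg, Complex.norm_real, Real.norm_of_nonneg]
  exact Real.log_natCast_nonneg N

lemma ZN_strip {N : ℕ} {W : ℂ} {a : ℝ} (hN : 2 ≤ N) (hW : ‖W‖ = 1) (ha0 : 0 ≤ a) (ha1 : a ≤ 1)
    {s : ℂ} (hy : 4 ≤ s.im) (h1 : -(3/2) ≤ s.re) (h2 : s.re ≤ 5/2) :
    ‖ZN N W a s‖ ≤ Real.exp ((Real.log N + (96 * Real.log (3 * s.im) + 34)) * |s.re - 1 / 2|) := by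
  obtain ⟨ε, hε, hε'⟩ : ∃ ε : ℝ, (ε = 1 ∨ ε = -1) ∧ s.re - 1 / 2 = ε * |s.re - 1 / 2| := by
    rcases le_total 0 (s.re - 1 / 2) with h | h
    · exact ⟨1, Or.inl rfl, by rw [abs_of_nonneg h]; ring⟩
    · exact ⟨-1, Or.inr rfl, by rw [abs_of_nonpos h]; ring⟩
  have hεn : ‖(ε : ℂ)‖ = 1 := by rcases hε with h | h <;> simp [h]
  set g : ℝ → ℂ := fun x => (1 / 2 + ε * x : ℝ) + (s.im : ℝ) * I with hg
  have gim : ∀ x, (g x).im = s.im := by intro x; simp [hg]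
  have gre : ∀ x, (g x).re = 1 / 2 + ε * x := by intro x; simp [hg]
  have gd : ∀ x, HasDerivAt g (ε : ℂ) x := by
    intro x
    have h : HasDerivAt (fun x : ℝ => 1 / 2 + ε * x) ε x := by
      simpa using ((hasDerivAt_id x).const_mul ε).const_add (1 / 2)
    exact (h.ofReal_comp).add_const _
  have hb : ∀ x ∈ Icc 0 (|s.re - 1 / 2|), -(3/2) ≤ (g x).re ∧ (g x).re ≤ 5 / 2 := by
    intro x hx
    have := abs_le.mp (show |s.re - 1/2| ≤ 2 by rw [abs_le]; constructor <;> linarith)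
    rw [gre]
    rcases hε with rfl | rfl
    · constructor <;> linarith [hx.1, hx.2, (abs_le.mpr ⟨by linarith, by linarith⟩ : |s.re - 1/2| ≤ 2)]
    · constructor <;> linarith [hx.1, hx.2, (abs_le.mpr ⟨by linarith, by linarith⟩ : |s.re - 1/2| ≤ 2)]
  have key := gron (f := fun x => ZN N W a (g x))
    (f' := fun x => (ε : ℂ) * (ZN N W a (g x) * (-(Real.log N : ℝ) + deriv (gQ a) (g x) / gQ a (g x))))
    (b := |s.re - 1 / 2|) (K := Real.log N + (96 * Real.log (3 * s.im) + 34)) (δ := 1) (abs_nonneg _) ?_ ?_ ?_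
  · rw [one_mul] at key
    have e : g |s.re - 1 / 2| = s := by
      apply Complex.ext
      · rw [gre, ← hε']; ring
      · rw [gim]
    simpa only [e] using key
  · intro x hx
    have hz := ZN_hasDeriv (W := W) (a := a) hN (s := g x) (by rw [gim]; linarith)
    have := hz.scomp x (gd x)
    exact this
  · intro x hx
    rw [norm_mul, hεn, one_mul, norm_mul, mul_comm]
    gcongr
    have := ZN_logDeriv_bound (s := g x) hN ha0 ha1 (by rw [gim]; exact hy) (hb x hx).1 (hb x hx).2
    rwa [gim] at this
  · refine (ZN_norm_crit hN hW ?_ ?_).le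
    · rw [gim]; linarith
    · rw [gre]; simp

end ZS
end

section
namespace ZS
open Complex Set

/-- the product of the two L-functions -/
def AA (D : ℕ) (χ : DirichletCharacter ℂ D) {p : ℕ} (ψ : DirichletCharacter ℂ p) (s : ℂ) : ℂ :=
  Lfun ψ s * Lfun (chiPsi D χ ψ) s

/-- properties of the factor in the functional equation of the product -/
structure ZProp (D p : ℕ) (A Z q : ℂ → ℂ) : Prop where
  fe : ∀ s : ℂ, s.im ≠ 0 → A s = Z s * (starRingEnd ℂ) (A (1 - (starRingEnd ℂ) s))
  refl : ∀ s : ℂ, s.im ≠ 0 → Z s * (starRingEnd ℂ) (Z (1 - (starRingEnd ℂ) s)) = 1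
  right1 : ∀ s : ℂ, 4 ≤ s.im → s.re = 5 / 2 → ‖Z s‖ ≤ 1600 / ((p : ℝ) ^ 2 * D * s.im ^ 2) ^ 2
  right2 : ∀ s : ℂ, 4 ≤ s.im → s.re = 5 / 2 → 1 / ((p : ℝ) ^ 2 * D * (s.im + 4) ^ 2) ^ 2 ≤ ‖Z s‖
  strip : ∀ s : ℂ, 4 ≤ s.im → -(3/2) ≤ s.re → s.re ≤ 5/2 →
    ‖Z s‖ ≤ Real.exp ((2 * Real.log p + Real.log D + (192 * Real.log (3 * s.im) + 68)) * |s.re - 1 / 2|)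
  der : ∀ s : ℂ, s.im ≠ 0 → HasDerivAt Z (Z s * q s) s
  q_bd : ∀ s : ℂ, 4 ≤ s.im → -(3/2) ≤ s.re → s.re ≤ 5/2 →
    ‖q s + ((2 * Real.log p + Real.log D : ℝ) : ℂ)‖ ≤ 192 * Real.log (3 * s.im) + 68

lemma Lfun_eq {N : ℕ} [NeZero N] (θ : DirichletCharacter ℂ N) (s : ℂ) :
    Lfun θ s = DirichletCharacter.LFunction θ s := by
  unfold Lfun
  rw [dif_neg (NeZero.ne N)]

lemma primitive_ne_one {N : ℕ} (hN : 2 ≤ N) (θ : DirichletCharacter ℂ N) (hθ : θ.IsPrimitive) : θ ≠ 1 := by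
  have : NeZero N := ⟨by omega⟩
  rintro rfl
  have : (1 : DirichletCharacter ℂ N).conductor = N := hθ
  rw [DirichletCharacter.conductor_one] at this
  omega

lemma exists_Z {D p : ℕ} (hD : 2 ≤ D) (hp : 2 ≤ p) (hc : Nat.Coprime D p)
    (χ : DirichletCharacter ℂ D) (ψ : DirichletCharacter ℂ p)
    (hχ : χ.IsPrimitive) (hψ : ψ.IsPrimitive) :
    ∃ Z q : ℂ → ℂ, ZProp D p (AA D χ ψ) Z q := by
  have : NeZero D := ⟨by omega⟩
  have : NeZero p := ⟨by omega⟩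
  have : NeZero (D * p) := ⟨mul_ne_zero (NeZero.ne D) (NeZero.ne p)⟩
  have hDp : 2 ≤ D * p := by nlinarith
  have hprim := chiPsi_primitive (NeZero.ne D) (NeZero.ne p) hc χ ψ hχ hψ
  obtain ⟨W, a, ha0, ha1, hW, hfe⟩ := func_eq hp ψ hψ
  obtain ⟨W', a', ha0', ha1', hW', hfe'⟩ := func_eq hDp _ hprim
  have hD0 : (0:ℝ) < D := by exact_mod_cast (by omega : 0 < D)
  have hp0 : (0:ℝ) < p := by exact_mod_cast (by omega : 0 < p)
  have hlog : Real.log ((D * p : ℕ) : ℝ) = Real.log D + Real.log p := by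
    push_cast; rw [Real.log_mul hD0.ne' hp0.ne']
  refine ⟨fun s => ZN p W a s * ZN (D * p) W' a' s,
    fun s => (-(Real.log p : ℝ) + deriv (gQ a) s / gQ a s) +
      (-(Real.log (D * p : ℕ) : ℝ) + deriv (gQ a') s / gQ a' s), ?_, ?_, ?_, ?_, ?_, ?_, ?_⟩
  · intro s hs
    unfold AA
    rw [Lfun_eq, Lfun_eq, Lfun_eq, Lfun_eq, hfe s hs, hfe' s hs, map_mul]
    ring
  · intro s hs
    have h1 := ZN_refl (a := a) hp hW hs
    have h2 := ZN_refl (a := a') hDp hW' hs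
    simp only [map_mul]
    linear_combination h1 * ZN (D * p) W' a' s * (starRingEnd ℂ) (ZN (D * p) W' a' (1 - (starRingEnd ℂ) s)) + h2
  · intro s hs hre
    have h1 := (ZN_norm_right hp hW ha0 ha1 hs hre).1
    have h2 := (ZN_norm_right hDp hW' ha0' ha1' hs hre).1
    rw [norm_mul]
    calc _ ≤ 40 / ((p:ℝ) * s.im) ^ 2 * (40 / (((D * p : ℕ) : ℝ) * s.im) ^ 2) := by gcongr
      _ = _ := by push_cast; field_simp; norm_num
  · intro s hs hre
    have h1 := (ZN_norm_right hp hW ha0 ha1 hs hre).2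
    have h2 := (ZN_norm_right hDp hW' ha0' ha1' hs hre).2
    rw [norm_mul]
    calc _ = 1 / ((p:ℝ) * (s.im + 4)) ^ 2 * (1 / (((D * p : ℕ) : ℝ) * (s.im + 4)) ^ 2) := by
          push_cast; field_simp
      _ ≤ _ := by gcongr
  · intro s hs h1 h2
    have k1 := ZN_strip hp hW ha0 ha1 hs h1 h2
    have k2 := ZN_strip hDp hW' ha0' ha1' hs h1 h2
    rw [norm_mul]
    calc _ ≤ _ := mul_le_mul k1 k2 (norm_nonneg _) (Real.exp_nonneg _)
      _ = _ := by rw [← Real.exp_add, hlog]; congr 1; ring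
  · intro s hs
    have k1 := ZN_hasDeriv (W := W) (a := a) hp hs
    have k2 := ZN_hasDeriv (W := W') (a := a') hDp hs
    have := k1.mul k2
    have e : ZN p W a s * ZN (D * p) W' a' s * ((-(Real.log p : ℝ) + deriv (gQ a) s / gQ a s) +
      (-(Real.log (D * p : ℕ) : ℝ) + deriv (gQ a') s / gQ a' s)) =
        ZN p W a s * (-(Real.log p : ℝ) + deriv (gQ a) s / gQ a s) * ZN (D * p) W' a' s +
          ZN p W a s * (ZN (D * p) W' a' s * (-(Real.log (D * p : ℕ) : ℝ) + deriv (gQ a') s / gQ a' s)) := by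
      ring
    beta_reduce
    rw [e]
    exact this
  · intro s hs h1 h2
    have k1 := gQ_logDeriv_bound ha0 ha1 hs h1 h2
    have k2 := gQ_logDeriv_bound ha0' ha1' hs h1 h2
    have e : (-(Real.log p : ℝ) + deriv (gQ a) s / gQ a s) +
      (-(Real.log (D * p : ℕ) : ℝ) + deriv (gQ a') s / gQ a' s) + ((2 * Real.log p + Real.log D : ℝ) : ℂ)
      = deriv (gQ a) s / gQ a s + deriv (gQ a') s / gQ a' s := by
      rw [hlog]; push_cast; ring
    rw [e]
    refine (norm_add_le _ _).trans ?_
    linarith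

lemma AA_bound {D p : ℕ} (hD : 2 ≤ D) (hp : 2 ≤ p) (hc : Nat.Coprime D p)
    (χ : DirichletCharacter ℂ D) (ψ : DirichletCharacter ℂ p)
    (hχ : χ.IsPrimitive) (hψ : ψ.IsPrimitive) :
    Differentiable ℂ (AA D χ ψ) ∧ ∀ s : ℂ, 1 / 2 ≤ s.re →
      ‖AA D χ ψ s‖ ≤ (2 * (p + 1) * ‖s‖) * (2 * (D * p + 1) * ‖s‖) := by
  have : NeZero D := ⟨by omega⟩
  have : NeZero p := ⟨by omega⟩
  have : NeZero (D * p) := ⟨mul_ne_zero (NeZero.ne D) (NeZero.ne p)⟩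
  have hDp : 2 ≤ D * p := by nlinarith
  have hprim := chiPsi_primitive (NeZero.ne D) (NeZero.ne p) hc χ ψ hχ hψ
  have n1 := primitive_ne_one hp ψ hψ
  have n2 := primitive_ne_one hDp _ hprim
  have e : AA D χ ψ = fun s => DirichletCharacter.LFunction ψ s * DirichletCharacter.LFunction (chiPsi D χ ψ) s := by
    ext s; unfold AA; rw [Lfun_eq, Lfun_eq]
  rw [e]
  constructor
  · exact (DirichletCharacter.differentiable_LFunction n1).mul (DirichletCharacter.differentiable_LFunction n2)
  · intro s hs
    have h1 := LFunction_bound ψ n1 hs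
    have h2 := LFunction_bound _ n2 hs
    push_cast at h2
    simp only [norm_mul]
    gcongr

end ZS
end

section
namespace ZS
open Complex Set

lemma conv_sum (f g : ArithmeticFunction ℂ) (c : ℕ → ℂ) (hc : ∀ m n, c (m * n) = c m * c n) (M M' : ℕ)
    (hf : ∀ n, M < n → f n = 0) (hg : ∀ n, M' < n → g n = 0) :
    (∑ n ∈ Finset.Icc 1 (M * M'), (f * g) n * c n) =
      (∑ n ∈ Finset.Icc 1 M, f n * c n) * (∑ n ∈ Finset.Icc 1 M', g n * c n) := by
  rw [Finset.sum_mul_sum, ← Finset.sum_product']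
  have hmap : ∀ x ∈ Finset.Icc 1 M ×ˢ Finset.Icc 1 M', x.1 * x.2 ∈ Finset.Icc 1 (M * M') := by
    intro x hx
    simp only [Finset.mem_product, Finset.mem_Icc] at hx ⊢
    exact ⟨Nat.mul_pos hx.1.1 hx.2.1, Nat.mul_le_mul hx.1.2 hx.2.2⟩
  rw [← Finset.sum_fiberwise_of_maps_to hmap]
  apply Finset.sum_congr rfl
  intro n hn
  rw [ArithmeticFunction.mul_apply, Finset.sum_mul]
  have hn0 : n ≠ 0 := by simp at hn; omega
  symm
  have hsub : (Finset.Icc 1 M ×ˢ Finset.Icc 1 M').filter (fun x => x.1 * x.2 = n) ⊆ n.divisorsAntidiagonal := by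
    intro x hx
    rw [Finset.mem_filter] at hx
    rw [Nat.mem_divisorsAntidiagonal]
    exact ⟨hx.2, hn0⟩
  rw [← Finset.sum_subset hsub]
  · apply Finset.sum_congr rfl
    intro x hx
    rw [Finset.mem_filter] at hx
    rw [← hx.2, hc]; ring
  · intro x hx hx'
    rw [Nat.mem_divisorsAntidiagonal] at hx
    simp only [Finset.mem_filter, Finset.mem_product, Finset.mem_Icc, not_and] at hx'
    have h1 : 1 ≤ x.1 := by
      rcases Nat.eq_zero_or_pos x.1 with h | h
      · rw [h] at hx; omega
      · exact h
    have h2 : 1 ≤ x.2 := by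
      rcases Nat.eq_zero_or_pos x.2 with h | h
      · rw [h] at hx; omega
      · exact h
    by_cases h3 : x.1 ≤ M
    · by_cases h4 : x.2 ≤ M'
      · exact absurd hx.1 (hx' ⟨⟨h1, h3⟩, h2, h4⟩)
      · rw [hg _ (not_le.mp h4)]; ring
    · rw [hf _ (not_le.mp h3)]; ring

lemma conv_supp (f g : ArithmeticFunction ℂ) (M M' : ℕ)
    (hf : ∀ n, M < n → f n = 0) (hg : ∀ n, M' < n → g n = 0) (n : ℕ) (hn : M * M' < n) : (f * g) n = 0 := by
  rw [ArithmeticFunction.mul_apply]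
  apply Finset.sum_eq_zero
  intro x hx
  rw [Nat.mem_divisorsAntidiagonal] at hx
  by_cases h3 : x.1 ≤ M
  · by_cases h4 : x.2 ≤ M'
    · have := Nat.mul_le_mul h3 h4
      omega
    · rw [hg _ (not_le.mp h4)]; ring
  · rw [hf _ (not_le.mp h3)]; ring

lemma conv_pow (f : ArithmeticFunction ℂ) (c : ℕ → ℂ) (hc : ∀ m n, c (m * n) = c m * c n) (hc1 : c 1 = 1) (M : ℕ)
    (hM : 1 ≤ M) (hf : ∀ n, M < n → f n = 0) (k : ℕ) :
    (∑ n ∈ Finset.Icc 1 (M ^ k), (f ^ k) n * c n) = (∑ n ∈ Finset.Icc 1 M, f n * c n) ^ k ∧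
    ∀ n, M ^ k < n → (f ^ k) n = 0 := by
  induction k with
  | zero =>
    refine ⟨by simp [hc1], ?_⟩
    intro n hn
    rw [pow_zero, ArithmeticFunction.one_apply_ne]
    simp at hn; omega
  | succ k ih =>
    rw [pow_succ, pow_succ, pow_succ, conv_sum _ _ c hc _ _ ih.2 hf, ih.1]
    exact ⟨rfl, conv_supp _ _ _ _ ih.2 hf⟩

lemma pow_apply_one (f : ArithmeticFunction ℂ) (hf : f 1 = 1) (k : ℕ) : (f ^ k) 1 = 1 := by
  induction k with
  | zero => simp
  | succ k ih => rw [pow_succ, ArithmeticFunction.mul_apply_one, ih, hf, one_mul]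

/-- the completely multiplicative twist -/
def tw {p : ℕ} (ψ : DirichletCharacter ℂ p) (s : ℂ) (n : ℕ) : ℂ := ψ (n : ZMod p) * (n : ℂ) ^ (-s)

lemma tw_mul {p : ℕ} (ψ : DirichletCharacter ℂ p) (s : ℂ) (m n : ℕ) : tw ψ s (m * n) = tw ψ s m * tw ψ s n := by
  unfold tw
  push_cast
  rw [map_mul, Complex.natCast_mul_natCast_cpow]; ring

lemma tw_one {p : ℕ} (ψ : DirichletCharacter ℂ p) (s : ℂ) : tw ψ s 1 = 1 := by simp [tw]

lemma cpow_split (n : ℕ) (hn : 1 ≤ n) (s s' : ℂ) : (n : ℂ) ^ (-s) = (n : ℂ) ^ (-s') * (n : ℂ) ^ (-(s - s')) := by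
  rw [← Complex.cpow_add _ _ (by exact_mod_cast (by omega : n ≠ 0))]
  congr 1; ring

section
variable {D p : ℕ} (χ : DirichletCharacter ℂ D) (ψ : DirichletCharacter ℂ p)

lemma Ffun_pow (hD : 1 ≤ D) (s : ℂ) :
    Ffun D χ ψ s ^ 20 = ∑ n ∈ Finset.Icc 1 (D ^ 80), nu20 D χ n * tw ψ s n := by
  have hM : 1 ≤ D ^ 4 := Nat.one_le_pow _ _ hD
  have h := (conv_pow (nuT D χ) (tw ψ s) (tw_mul ψ s) (tw_one ψ s) (D ^ 4) hM (by
    intro n hn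
    simp only [nuT, ArithmeticFunction.coe_mk]
    rw [if_neg (by omega), if_neg (by omega)]) 20).1
  rw [← pow_mul] at h
  rw [show (4 * 20) = 80 by norm_num] at h
  unfold nu20
  rw [h]
  congr 1
  unfold Ffun
  apply Finset.sum_congr rfl
  intro n hn
  rw [Finset.mem_Icc] at hn
  simp only [nuT, ArithmeticFunction.coe_mk, tw]
  rw [if_neg (by omega), if_pos hn.2]; ring

lemma Gfun_pow (hD : 1 ≤ D) (s : ℂ) :
    Gfun D χ ψ s ^ 20 = ∑ n ∈ Finset.Icc 1 (D ^ 80), ups20 D χ n * tw ψ s n := by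
  have hM : 1 ≤ D ^ 4 := Nat.one_le_pow _ _ hD
  have h := (conv_pow (upsT D χ) (tw ψ s) (tw_mul ψ s) (tw_one ψ s) (D ^ 4) hM (by
    intro n hn
    simp only [upsT, ArithmeticFunction.coe_mk]
    rw [if_neg (by omega), if_neg (by omega)]) 20).1
  rw [← pow_mul] at h
  rw [show (4 * 20) = 80 by norm_num] at h
  unfold ups20
  rw [h]
  congr 1
  unfold Gfun
  apply Finset.sum_congr rfl
  intro n hn
  rw [Finset.mem_Icc] at hn
  simp only [upsT, ArithmeticFunction.coe_mk, tw]
  rw [if_neg (by omega), if_pos hn.2]; ring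

lemma nu20_one (hD : 1 ≤ D) : nu20 D χ 1 = 1 := by
  have hM : 1 ≤ D ^ 4 := Nat.one_le_pow _ _ hD
  apply pow_apply_one
  simp [nuT, hM, nuF]

lemma ups20_one (hD : 1 ≤ D) : ups20 D χ 1 = 1 := by
  have hM : 1 ≤ D ^ 4 := Nat.one_le_pow _ _ hD
  apply pow_apply_one
  simp [upsT, hM, upsF]

lemma sigF_eq (n : ℕ) (hn : n ≠ 0) : sigF D χ n = (nuT D χ * upsT D χ) n := by
  rw [ArithmeticFunction.mul_apply, Nat.sum_divisorsAntidiagonal (f := fun a b => nuT D χ a * upsT D χ b)]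
  unfold sigF
  apply Finset.sum_congr rfl
  intro d hd
  have hd0 : d ≠ 0 := (Nat.pos_of_mem_divisors hd).ne'
  have hnd : n / d ≠ 0 := by
    have := Nat.div_pos (Nat.divisor_le hd) (Nat.pos_of_mem_divisors hd); omega
  simp only [nuT, upsT, ArithmeticFunction.coe_mk]
  rw [if_neg hd0, if_neg hnd]
  by_cases h1 : d ≤ D ^ 4 <;> by_cases h2 : n / d ≤ D ^ 4 <;> simp [h1, h2]

lemma FG_eq (s : ℂ) :
    Ffun D χ ψ s * Gfun D χ ψ s = ∑ n ∈ Finset.Icc 1 (D ^ 8), sigF D χ n * tw ψ s n := by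
  have h := conv_sum (nuT D χ) (upsT D χ) (tw ψ s) (tw_mul ψ s) (D ^ 4) (D ^ 4) (by
    intro n hn
    simp only [nuT, ArithmeticFunction.coe_mk]
    rw [if_neg (by omega), if_neg (by omega)]) (by
    intro n hn
    simp only [upsT, ArithmeticFunction.coe_mk]
    rw [if_neg (by omega), if_neg (by omega)])
  rw [← pow_add] at h
  have e1 : (∑ n ∈ Finset.Icc 1 (D ^ 8), sigF D χ n * tw ψ s n) = ∑ n ∈ Finset.Icc 1 (D ^ (4 + 4)), (nuT D χ * upsT D χ) n * tw ψ s n := by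
    apply Finset.sum_congr rfl
    intro n hn
    rw [Finset.mem_Icc] at hn
    rw [sigF_eq _ _ (by omega)]
  rw [e1, h]
  congr 1
  · unfold Ffun
    apply Finset.sum_congr rfl
    intro n hn
    rw [Finset.mem_Icc] at hn
    simp only [nuT, ArithmeticFunction.coe_mk, tw]
    rw [if_neg (by omega), if_pos hn.2]; ring
  · unfold Gfun
    apply Finset.sum_congr rfl
    intro n hn
    rw [Finset.mem_Icc] at hn
    simp only [upsT, ArithmeticFunction.coe_mk, tw]
    rw [if_neg (by omega), if_pos hn.2]; ring

/-- the character as an arithmetic function -/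
def chA : ArithmeticFunction ℂ := ⟨fun n => if n = 0 then 0 else χ (n : ZMod D), by simp⟩

/-- the Moebius twisted character as an arithmetic function -/
def muchA : ArithmeticFunction ℂ :=
  ⟨fun n => if n = 0 then 0 else ((ArithmeticFunction.moebius n : ℤ) : ℂ) * χ (n : ZMod D), by simp⟩

lemma chA_mul : chA χ * muchA χ = 1 := by
  ext n
  rcases eq_or_ne n 0 with rfl | hn
  · simp
  have key : (chA χ * muchA χ) n = χ (n : ZMod D) *
      (((ArithmeticFunction.zeta : ArithmeticFunction ℂ) * (ArithmeticFunction.moebius : ArithmeticFunction ℂ)) n) := by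
    rw [ArithmeticFunction.mul_apply, ArithmeticFunction.mul_apply, Finset.mul_sum]
    apply Finset.sum_congr rfl
    intro x hx
    rw [Nat.mem_divisorsAntidiagonal] at hx
    have h1 : x.1 ≠ 0 := by intro h; rw [h] at hx; omega
    have h2 : x.2 ≠ 0 := by intro h; rw [h] at hx; omega
    simp only [chA, muchA, ArithmeticFunction.coe_mk, if_neg h1, if_neg h2]
    rw [← hx.1]
    push_cast
    rw [map_mul]
    simp [ArithmeticFunction.natCoe_apply, ArithmeticFunction.intCoe_apply, ArithmeticFunction.zeta_apply, h1]
    ring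
  rw [key, ArithmeticFunction.coe_zeta_mul_coe_moebius]
  rcases eq_or_ne n 1 with rfl | h1
  · simp
  · rw [ArithmeticFunction.one_apply_ne h1, mul_zero]

lemma nu_conv_ups (n : ℕ) (hn : n ≠ 0) :
    ∑ d ∈ n.divisors, nuF D χ d * upsF D χ (n / d) = if n = 1 then 1 else 0 := by
  have hnu : ∀ m, m ≠ 0 → nuF D χ m = (chA χ * (ArithmeticFunction.zeta : ArithmeticFunction ℂ)) m := by
    intro m hm
    rw [ArithmeticFunction.coe_mul_zeta_apply]
    unfold nuF
    apply Finset.sum_congr rfl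
    intro d hd
    simp [chA, (Nat.pos_of_mem_divisors hd).ne']
  have hup : ∀ m, m ≠ 0 → upsF D χ m = (muchA χ * (ArithmeticFunction.moebius : ArithmeticFunction ℂ)) m := by
    intro m hm
    rw [ArithmeticFunction.mul_apply,
      Nat.sum_divisorsAntidiagonal (f := fun a b => muchA χ a * (ArithmeticFunction.moebius : ArithmeticFunction ℂ) b)]
    unfold upsF
    apply Finset.sum_congr rfl
    intro d hd
    simp [muchA, (Nat.pos_of_mem_divisors hd).ne', ArithmeticFunction.intCoe_apply]
    ring
  have h1 : ∑ d ∈ n.divisors, nuF D χ d * upsF D χ (n / d) =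
      ((chA χ * (ArithmeticFunction.zeta : ArithmeticFunction ℂ)) * (muchA χ * (ArithmeticFunction.moebius : ArithmeticFunction ℂ))) n := by
    rw [ArithmeticFunction.mul_apply (f := chA χ * _),
      Nat.sum_divisorsAntidiagonal (f := fun a b => (chA χ * (ArithmeticFunction.zeta : ArithmeticFunction ℂ)) a * (muchA χ * (ArithmeticFunction.moebius : ArithmeticFunction ℂ)) b)]
    apply Finset.sum_congr rfl
    intro d hd
    have hd0 : d ≠ 0 := (Nat.pos_of_mem_divisors hd).ne'
    have hnd : n / d ≠ 0 := by
      have := Nat.div_pos (Nat.divisor_le hd) (Nat.pos_of_mem_divisors hd); omega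
    rw [hnu d hd0, hup _ hnd]
  have h2 : (chA χ * (ArithmeticFunction.zeta : ArithmeticFunction ℂ)) * (muchA χ * (ArithmeticFunction.moebius : ArithmeticFunction ℂ)) = 1 := by
    calc _ = (chA χ * muchA χ) * ((ArithmeticFunction.zeta : ArithmeticFunction ℂ) * (ArithmeticFunction.moebius : ArithmeticFunction ℂ)) := by ring
      _ = 1 := by rw [chA_mul, ArithmeticFunction.coe_zeta_mul_coe_moebius, one_mul]
  rw [h1, h2, ArithmeticFunction.one_apply]

lemma sigF_small (n : ℕ) (hn : n ≠ 0) (hn4 : n ≤ D ^ 4) : sigF D χ n = if n = 1 then 1 else 0 := by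
  rw [← nu_conv_ups χ n hn]
  unfold sigF
  apply Finset.sum_congr rfl
  intro d hd
  rw [if_pos]
  exact ⟨(Nat.divisor_le hd).trans hn4, (Nat.div_le_self _ _).trans hn4⟩

lemma FG_eq' (hD : 1 ≤ D) (s : ℂ) :
    Ffun D χ ψ s * Gfun D χ ψ s = 1 + ∑ n ∈ Finset.Ioc (D ^ 4) (D ^ 8), sigF D χ n * tw ψ s n := by
  have hM : 1 ≤ D ^ 4 := Nat.one_le_pow _ _ hD
  have h48 : D ^ 4 ≤ D ^ 8 := Nat.pow_le_pow_right hD (by norm_num)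
  rw [FG_eq]
  have e : Finset.Icc 1 (D ^ 8) = Finset.Icc 1 (D ^ 4) ∪ Finset.Ioc (D ^ 4) (D ^ 8) := by
    ext x; simp only [Finset.mem_union, Finset.mem_Icc, Finset.mem_Ioc]; omega
  rw [e, Finset.sum_union]
  · congr 1
    rw [Finset.sum_eq_single 1]
    · rw [sigF_small χ 1 (by norm_num) hM, tw_one]; simp
    · intro b hb hb1
      rw [Finset.mem_Icc] at hb
      rw [sigF_small χ b (by omega) hb.2, if_neg hb1, zero_mul]
    · intro h; exact absurd (Finset.mem_Icc.mpr ⟨le_rfl, hM⟩) h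
  · rw [Finset.disjoint_left]
    intro x hx hx'
    simp only [Finset.mem_Icc, Finset.mem_Ioc] at hx hx'
    omega

end

end ZS
end

section
namespace ZS
open Complex Set

lemma s0_re (D : ℕ) : (s0 D).re = 1 / 2 := by simp [s0]
lemma s0_im (D : ℕ) : (s0 D).im = 2 * Real.pi * t0 D := by simp [s0]

lemma D_gt {D : ℕ} (h : 100 ≤ bigL D) : 1 < (D : ℝ) := by
  by_contra h1
  have h2 : bigL D ≤ 0 := by
    unfold bigL
    exact Real.log_nonpos (Nat.cast_nonneg _) (not_lt.mp h1)
  linarith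

lemma exp_bigL {D : ℕ} (h : 100 ≤ bigL D) : Real.exp (bigL D) = D := by
  unfold bigL; rw [Real.exp_log (by linarith [D_gt h])]

lemma D_nat {D : ℕ} (h : 100 ≤ bigL D) : 2 ≤ D := by
  have := D_gt h
  have : 1 < D := by exact_mod_cast this
  omega

lemma Kbound {D : ℕ} (h : 100 ≤ bigL D) {x w : ℝ} (hx1 : 1 ≤ x) (hx2 : x ≤ (D:ℝ) ^ 80)
    (hw : -(Real.log (bigL D) / (100 * bigL D)) ≤ w) : x ^ (-w) ≤ bigL D := by
  set ℓ := bigL D with hl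
  have hℓ0 : 0 < ℓ := by linarith
  have hlog : 0 ≤ Real.log ℓ := Real.log_nonneg (by linarith)
  have hr : 0 ≤ Real.log ℓ / (100 * ℓ) := by positivity
  calc x ^ (-w) ≤ x ^ (Real.log ℓ / (100 * ℓ)) := Real.rpow_le_rpow_of_exponent_le hx1 (by linarith)
    _ ≤ ((D:ℝ) ^ 80) ^ (Real.log ℓ / (100 * ℓ)) := Real.rpow_le_rpow (by linarith) hx2 hr
    _ = Real.exp (80 / 100 * Real.log ℓ) := by
        rw [← exp_bigL h, ← Real.exp_nat_mul, ← Real.exp_mul]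
        congr 1
        rw [← hl]
        field_simp
        norm_num
        ring
    _ ≤ Real.exp (Real.log ℓ) := by
        apply Real.exp_le_exp.mpr; linarith
    _ = ℓ := Real.exp_log hℓ0

lemma w_norm {D : ℕ} {s : ℂ} {T : ℝ} (h1 : 1 / 2 - 1 ≤ s.re) (h2 : s.re ≤ 1 / 2 + 1)
    (h3 : |s.im - 2 * Real.pi * t0 D| ≤ T) : ‖s - s0 D‖ ≤ T + 1 := by
  refine (Complex.norm_le_abs_re_add_abs_im _).trans ?_
  rw [sub_re, sub_im, s0_re, s0_im]
  have : |s.re - 1 / 2| ≤ 1 := by rw [abs_le]; constructor <;> linarith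
  linarith

lemma big20 {D p : ℕ} (h : 100 ≤ bigL D) (ψ : DirichletCharacter ℂ p) (u : ℕ → ℂ) (hu : u 1 = 1)
    (B : ℝ) (hB : B ≤ bigL D ^ 1171)
    (hS : ‖∑ n ∈ Finset.Icc 1 ⌊(D:ℝ) ^ 80⌋₊, u n * ψ (n : ZMod p) * (n : ℂ) ^ (-s0 D)‖ +
      (∫ x in (1 : ℝ)..((D : ℝ) ^ 80), ‖∑ n ∈ Finset.Icc 1 ⌊x⌋₊, u n * ψ (n : ZMod p) * (n : ℂ) ^ (-s0 D)‖ / x) ≤ B)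
    {s : ℂ} (h1 : 1 / 2 - Real.log (bigL D) / (100 * bigL D) ≤ s.re) (h2 : s.re ≤ 3 / 2)
    (h3 : |s.im - 2 * Real.pi * t0 D| ≤ bigL1 D + 5) :
    ‖∑ n ∈ Finset.Icc 1 (D ^ 80), u n * tw ψ s n‖ ≤ (bigL D ^ 79) ^ 20 := by
  set ℓ := bigL D with hl
  have hD1 := D_gt h
  have hDn := D_nat h
  have hℓ0 : 0 < ℓ := by linarith
  have hlog : Real.log ℓ ≤ ℓ := (Real.log_le_sub_one_of_pos hℓ0).trans (by linarith)
  have hr1 : Real.log ℓ / (100 * ℓ) ≤ 1 := by rw [div_le_one (by positivity)]; linarith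
  set c : ℕ → ℂ := fun n => u n * ψ (n : ZMod p) * (n : ℂ) ^ (-s0 D) with hc
  have hfl : ⌊(D:ℝ) ^ 80⌋₊ = D ^ 80 := by
    rw [show (D:ℝ) ^ 80 = ((D ^ 80 : ℕ) : ℝ) by push_cast; rfl, Nat.floor_natCast]
  have hIoc : ∀ n, Finset.Icc 1 n = Finset.Ioc 0 n := by
    intro n; ext x; simp only [Finset.mem_Icc, Finset.mem_Ioc]; omega
  simp_rw [hIoc] at hS
  have hab : (1:ℝ) ≤ (D:ℝ) ^ 80 := one_le_pow₀ hD1.le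
  have hA := abel_bound c 0 (a := 1) (b := (D:ℝ) ^ 80) (K := ℓ) one_pos hab (s - s0 D) (by simp) (by
    intro x hx
    apply Kbound h hx.1 hx.2
    rw [sub_re, s0_re]; linarith)
  have hw : ‖s - s0 D‖ ≤ bigL1 D + 5 + 1 := w_norm (by linarith) (by linarith) h3
  have hc1 : c 1 = 1 := by simp [hc, hu]
  have hIntg0 : 0 ≤ ∫ x in (1 : ℝ)..((D : ℝ) ^ 80), ‖∑ n ∈ Finset.Ioc 0 ⌊x⌋₊, c n‖ / x := by
    apply intervalIntegral.integral_nonneg hab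
    intro x hx
    have : 0 < x := by linarith [hx.1]
    positivity
  have hsum1 : ∑ k ∈ Finset.Ioc 0 ⌊(1:ℝ)⌋₊, c k = 1 := by
    rw [Nat.floor_one]
    rw [show Finset.Ioc 0 1 = {1} by rfl, Finset.sum_singleton, hc1]
  rw [hsum1, norm_one, Nat.floor_one, hfl] at hA
  rw [hfl] at hS
  have hsplit : ∑ n ∈ Finset.Icc 1 (D ^ 80), u n * tw ψ s n = 1 + ∑ n ∈ Finset.Ioc 1 (D ^ 80), c n * (n : ℂ) ^ (-(s - s0 D)) := by
    have e : Finset.Icc 1 (D ^ 80) = insert 1 (Finset.Ioc 1 (D ^ 80)) := by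
      have : 1 ≤ D ^ 80 := Nat.one_le_pow _ _ (by omega)
      ext x; simp only [Finset.mem_Icc, Finset.mem_insert, Finset.mem_Ioc]; omega
    rw [e, Finset.sum_insert (by simp), hu, tw_one, one_mul]
    congr 1
    apply Finset.sum_congr rfl
    intro n hn
    rw [Finset.mem_Ioc] at hn
    simp only [hc, tw]
    rw [cpow_split n (by omega) s (s0 D)]; ring
  rw [hsplit]
  set V1 := ‖∑ k ∈ Finset.Ioc 0 (D ^ 80), c k‖ with hV1
  set V2 := ∫ x in (1 : ℝ)..((D : ℝ) ^ 80), ‖∑ n ∈ Finset.Ioc 0 ⌊x⌋₊, c n‖ / x with hV2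
  have hS' : V1 + V2 ≤ B := hS
  have hV1n : 0 ≤ V1 := norm_nonneg _
  have hL1 : bigL1 D = ℓ ^ 405 := rfl
  have hp405 : (100:ℝ) ≤ ℓ ^ 405 := by
    calc (100:ℝ) ≤ ℓ := h
      _ ≤ ℓ ^ 405 := le_self_pow₀ (by linarith) (by norm_num)
  have hp1171 : (100:ℝ) ≤ ℓ ^ 1171 := by
    calc (100:ℝ) ≤ ℓ := h
      _ ≤ ℓ ^ 1171 := le_self_pow₀ (by linarith) (by norm_num)
  have hw2 : ‖s - s0 D‖ ≤ 2 * ℓ ^ 405 := by rw [hL1] at hw; linarith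
  calc _ ≤ ‖(1:ℂ)‖ + _ := norm_add_le _ _
    _ ≤ 1 + ℓ * (V1 + 1 + ‖s - s0 D‖ * V2) := by rw [norm_one]; linarith
    _ ≤ 1 + ℓ * (ℓ ^ 1171 + 1 + (2 * ℓ ^ 405) * ℓ ^ 1171) := by
        gcongr
        · linarith
        · linarith
    _ ≤ ℓ ^ 3 * ℓ ^ 405 * ℓ ^ 1171 := by
        set x := ℓ ^ 405
        set y := ℓ ^ 1171
        have hxy : 10000 ≤ x * y := by nlinarith
        have h3 : 100 * ℓ ≤ ℓ ^ 3 := by nlinarith [sq_nonneg ℓ]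
        have e1 : 100 * ℓ * (x * y) ≤ ℓ ^ 3 * (x * y) := by gcongr
        have e2 : y ≤ x * y := by nlinarith
        have e3 : ℓ * y ≤ ℓ * (x * y) := by gcongr
        have e4 : ℓ * 10000 ≤ ℓ * (x * y) := by gcongr
        nlinarith
    _ = ℓ ^ 1579 := by rw [← pow_add, ← pow_add]
    _ ≤ (ℓ ^ 79) ^ 20 := by rw [← pow_mul]; exact pow_le_pow_right₀ (by linarith) (by norm_num)

section
variable {D p : ℕ} (χ : DirichletCharacter ℂ D) (ψ : DirichletCharacter ℂ p)

lemma FG_upper (h : 100 ≤ bigL D) (hI : Ineq1 D χ ψ) {s : ℂ}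
    (h1 : 1 / 2 - Real.log (bigL D) / (100 * bigL D) ≤ s.re) (h2 : s.re ≤ 3 / 2)
    (h3 : |s.im - 2 * Real.pi * t0 D| ≤ bigL1 D + 5) :
    ‖Ffun D χ ψ s‖ ≤ bigL D ^ 79 ∧ ‖Gfun D χ ψ s‖ ≤ bigL D ^ 79 := by
  have hD1 := D_gt h
  have hDn := D_nat h
  have hab : (1:ℝ) ≤ (D:ℝ) ^ 80 := one_le_pow₀ hD1.le
  have hIoc : ∀ n, Finset.Icc 1 n = Finset.Ioc 0 n := by
    intro n; ext x; simp only [Finset.mem_Icc, Finset.mem_Ioc]; omega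
  have i1 : IntervalIntegrable (fun x => ‖X1 D χ ψ x‖ / x) MeasureTheory.volume 1 ((D:ℝ) ^ 80) := by
    unfold X1; simp_rw [hIoc]
    exact intervalIntegrable_norm_sum_div _ 0 one_pos hab
  have i2 : IntervalIntegrable (fun x => ‖X2 D χ ψ x‖ / x) MeasureTheory.volume 1 ((D:ℝ) ^ 80) := by
    unfold X2; simp_rw [hIoc]
    exact intervalIntegrable_norm_sum_div _ 0 one_pos hab
  have n1 : 0 ≤ ∫ x in (1 : ℝ)..((D : ℝ) ^ 80), ‖X1 D χ ψ x‖ / x := by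
    apply intervalIntegral.integral_nonneg hab
    intro x hx
    have : 0 < x := by linarith [hx.1]
    positivity
  have n2 : 0 ≤ ∫ x in (1 : ℝ)..((D : ℝ) ^ 80), ‖X2 D χ ψ x‖ / x := by
    apply intervalIntegral.integral_nonneg hab
    intro x hx
    have : 0 < x := by linarith [hx.1]
    positivity
  unfold Ineq1 at hI
  simp_rw [add_div] at hI
  rw [intervalIntegral.integral_add i1 i2] at hI
  have m1 := norm_nonneg (X1 D χ ψ ((D:ℝ) ^ 80))
  have m2 := norm_nonneg (X2 D χ ψ ((D:ℝ) ^ 80))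
  have hℓ79 : 0 ≤ bigL D ^ 79 := by positivity
  constructor
  · refine le_of_pow_le_pow_left₀ (n := 20) (by norm_num) hℓ79 ?_
    rw [← norm_pow, Ffun_pow χ ψ (by omega)]
    exact big20 h ψ (nu20 D χ) (nu20_one χ (by omega))
      (‖X1 D χ ψ ((D:ℝ) ^ 80)‖ + ∫ x in (1 : ℝ)..((D : ℝ) ^ 80), ‖X1 D χ ψ x‖ / x) (by linarith) le_rfl h1 h2 h3
  · refine le_of_pow_le_pow_left₀ (n := 20) (by norm_num) hℓ79 ?_
    rw [← norm_pow, Gfun_pow χ ψ (by omega)]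
    exact big20 h ψ (ups20 D χ) (ups20_one χ (by omega))
      (‖X2 D χ ψ ((D:ℝ) ^ 80)‖ + ∫ x in (1 : ℝ)..((D : ℝ) ^ 80), ‖X2 D χ ψ x‖ / x) (by linarith) le_rfl h1 h2 h3

lemma FG_near_one (h : 100 ≤ bigL D) (hI : Ineq3 D χ ψ) {s : ℂ}
    (h1 : 1 / 2 - Real.log (bigL D) / (100 * bigL D) ≤ s.re) (h2 : s.re ≤ 3 / 2)
    (h3 : |s.im - 2 * Real.pi * t0 D| ≤ bigL1 D + 5) :
    ‖Ffun D χ ψ s * Gfun D χ ψ s - 1‖ ≤ 1 / 2 := by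
  set ℓ := bigL D with hl
  have hD1 := D_gt h
  have hDn := D_nat h
  have hℓ0 : 0 < ℓ := by linarith
  have hlog : Real.log ℓ ≤ ℓ := (Real.log_le_sub_one_of_pos hℓ0).trans (by linarith)
  have hr1 : Real.log ℓ / (100 * ℓ) ≤ 1 := by rw [div_le_one (by positivity)]; linarith
  set c : ℕ → ℂ := fun n => sigF D χ n * ψ (n : ZMod p) * (n : ℂ) ^ (-s0 D) with hc
  have hfl : ∀ k : ℕ, ⌊(D:ℝ) ^ k⌋₊ = D ^ k := by
    intro k
    rw [show (D:ℝ) ^ k = ((D ^ k : ℕ) : ℝ) by push_cast; rfl, Nat.floor_natCast]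
  have hab : (D:ℝ) ^ 4 ≤ (D:ℝ) ^ 8 := pow_le_pow_right₀ hD1.le (by norm_num)
  have h80 : (D:ℝ) ^ 8 ≤ (D:ℝ) ^ 80 := pow_le_pow_right₀ hD1.le (by norm_num)
  have h4 : (1:ℝ) ≤ (D:ℝ) ^ 4 := one_le_pow₀ hD1.le
  have hA := abel_bound c (D ^ 4) (a := (D:ℝ) ^ 4) (b := (D:ℝ) ^ 8) (K := ℓ) (by linarith) hab (s - s0 D)
    (by rw [hfl]) (by
    intro x hx
    apply Kbound h (h4.trans hx.1) (hx.2.trans h80)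
    rw [sub_re, s0_re]; linarith)
  have hw : ‖s - s0 D‖ ≤ bigL1 D + 5 + 1 := w_norm (by linarith) (by linarith) h3
  have hIntg0 : 0 ≤ ∫ x in ((D : ℝ) ^ 4)..((D : ℝ) ^ 8), ‖∑ n ∈ Finset.Ioc (D ^ 4) ⌊x⌋₊, c n‖ / x := by
    apply intervalIntegral.integral_nonneg hab
    intro x hx
    have : 0 < x := by linarith [hx.1]
    positivity
  unfold Ineq3 X4 at hI
  rw [hfl] at hI
  rw [hfl, hfl] at hA
  rw [Finset.Ioc_self, Finset.sum_empty, norm_zero, add_zero] at hA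
  rw [FG_eq' χ ψ (by omega), add_sub_cancel_left]
  have e : ∑ n ∈ Finset.Ioc (D ^ 4) (D ^ 8), sigF D χ n * tw ψ s n =
      ∑ n ∈ Finset.Ioc (D ^ 4) (D ^ 8), c n * (n : ℂ) ^ (-(s - s0 D)) := by
    apply Finset.sum_congr rfl
    intro n hn
    rw [Finset.mem_Ioc] at hn
    simp only [hc, tw]
    rw [cpow_split n (by omega) s (s0 D)]; ring
  rw [e]
  refine hA.trans ?_
  set V1 := ‖∑ k ∈ Finset.Ioc (D ^ 4) (D ^ 8), c k‖ with hV1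
  set V2 := ∫ x in ((D : ℝ) ^ 4)..((D : ℝ) ^ 8), ‖∑ n ∈ Finset.Ioc (D ^ 4) ⌊x⌋₊, c n‖ / x with hV2
  have hI' : V1 + V2 < ℓ ^ (-633 : ℤ) := hI
  have hV1n : 0 ≤ V1 := norm_nonneg _
  have hL1 : bigL1 D = ℓ ^ 405 := rfl
  have hp405 : (100:ℝ) ≤ ℓ ^ 405 := by
    calc (100:ℝ) ≤ ℓ := h
      _ ≤ ℓ ^ 405 := le_self_pow₀ (by linarith) (by norm_num)
  have hw2 : ‖s - s0 D‖ ≤ 2 * ℓ ^ 405 := by rw [hL1] at hw; linarith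
  have hz : ℓ ^ (-633 : ℤ) = (ℓ ^ 633)⁻¹ := by
    rw [show (-633 : ℤ) = -((633 : ℕ) : ℤ) by norm_num, zpow_neg, zpow_natCast]
  rw [hz] at hI'
  calc _ ≤ ℓ * ((2 * ℓ ^ 405) * V1 + (2 * ℓ ^ 405) * V2) := by
        gcongr
        nlinarith
    _ = ℓ * (2 * ℓ ^ 405) * (V1 + V2) := by ring
    _ ≤ ℓ * (2 * ℓ ^ 405) * (ℓ ^ 633)⁻¹ := by gcongr
    _ ≤ 1 / 2 := by
        rw [← div_eq_mul_inv, div_le_div_iff₀ (by positivity) (by norm_num)]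
        calc ℓ * (2 * ℓ ^ 405) * 2 = 4 * ℓ ^ 406 := by ring
          _ ≤ ℓ * ℓ ^ 406 := by gcongr; linarith
          _ = ℓ ^ 407 := by ring
          _ ≤ ℓ ^ 633 := pow_le_pow_right₀ (by linarith) (by norm_num)
          _ = 1 * ℓ ^ 633 := by ring

lemma F_lower (h : 100 ≤ bigL D) (hI1 : Ineq1 D χ ψ) (hI : Ineq3 D χ ψ) {s : ℂ}
    (h1 : 1 / 2 - Real.log (bigL D) / (100 * bigL D) ≤ s.re) (h2 : s.re ≤ 3 / 2)
    (h3 : |s.im - 2 * Real.pi * t0 D| ≤ bigL1 D + 5) :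
    1 ≤ ‖Ffun D χ ψ s‖ * (2 * bigL D ^ 79) := by
  have k1 := FG_near_one χ ψ h hI h1 h2 h3
  have k2 := (FG_upper χ ψ h hI1 h1 h2 h3).2
  have k3 : 1 / 2 ≤ ‖Ffun D χ ψ s * Gfun D χ ψ s‖ := by
    have := norm_sub_norm_le (1:ℂ) (1 - Ffun D χ ψ s * Gfun D χ ψ s)
    rw [sub_sub_cancel, norm_one, norm_sub_rev] at this
    linarith
  rw [norm_mul] at k3
  have k4 : ‖Ffun D χ ψ s‖ * ‖Gfun D χ ψ s‖ ≤ ‖Ffun D χ ψ s‖ * bigL D ^ 79 := by gcongr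
  linarith

lemma F_diff (s : ℂ) : DifferentiableAt ℂ (Ffun D χ ψ) s := by
  unfold Ffun
  apply DifferentiableAt.fun_sum
  intro n hn
  rw [Finset.mem_Icc] at hn
  apply DifferentiableAt.const_mul
  have hn0 : (n : ℂ) ≠ 0 := by exact_mod_cast (by omega : n ≠ 0)
  exact (differentiableAt_id.neg).const_cpow (Or.inl hn0)

lemma F_logDeriv (h : 100 ≤ bigL D) (hI1 : Ineq1 D χ ψ) (hI : Ineq3 D χ ψ) {s : ℂ}
    (h1 : s.re = 1 / 2) (h3 : |s.im - 2 * Real.pi * t0 D| ≤ bigL1 D + 4) :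
    ‖deriv (Ffun D χ ψ) s / Ffun D χ ψ s‖ ≤ 63600 * bigL D := by
  set ℓ := bigL D with hl
  have hℓ0 : 0 < ℓ := by linarith
  have hlog0 : 0 < Real.log ℓ := Real.log_pos (by linarith)
  have hlog : Real.log ℓ ≤ ℓ := (Real.log_le_sub_one_of_pos hℓ0).trans (by linarith)
  have hr1 : Real.log ℓ / (100 * ℓ) ≤ 1 := by rw [div_le_one (by positivity)]; linarith
  set r := Real.log ℓ / (100 * ℓ) with hr
  have hr0 : 0 < r := by positivity
  have hball : ∀ z ∈ Metric.ball s r, 1 / 2 - r ≤ z.re ∧ z.re ≤ 3 / 2 ∧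
      |z.im - 2 * Real.pi * t0 D| ≤ bigL1 D + 5 := by
    intro z hz
    rw [Metric.mem_ball, dist_eq_norm] at hz
    have a1 := Complex.abs_re_le_norm (z - s)
    have a2 := Complex.abs_im_le_norm (z - s)
    rw [sub_re, h1] at a1
    rw [sub_im] at a2
    have b1 := abs_le.mp (a1.trans hz.le)
    have b2 := abs_le.mp (a2.trans hz.le)
    have b3 := abs_le.mp h3
    refine ⟨by linarith, by linarith, ?_⟩
    rw [abs_le]; constructor <;> linarith
  have hb := logDeriv_bound (f := Ffun D χ ψ) (c := s) (r := r) (B := 159 * Real.log ℓ) hr0 (by positivity)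
    (fun z _ => (F_diff χ ψ z).differentiableWithinAt) (by
      intro z hz h0
      obtain ⟨c1, c2, c3⟩ := hball z hz
      have := F_lower χ ψ h hI1 hI c1 c2 c3
      rw [h0] at this
      simp at this
      linarith) (by
      intro z hz
      obtain ⟨c1, c2, c3⟩ := hball z hz
      obtain ⟨d1, d2, d3⟩ := hball s (Metric.mem_ball_self hr0)
      have u := (FG_upper χ ψ h hI1 c1 c2 c3).1
      have l := F_lower χ ψ h hI1 hI d1 d2 d3
      have e : Real.exp (159 * Real.log ℓ) = ℓ ^ 159 := by
        rw [show (159:ℝ) * Real.log ℓ = ((159:ℕ):ℝ) * Real.log ℓ by norm_num, Real.exp_nat_mul, Real.exp_log hℓ0]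
      rw [e]
      calc _ ≤ ℓ ^ 79 := u
        _ ≤ (‖Ffun D χ ψ s‖ * (2 * ℓ ^ 79)) * ℓ ^ 79 := le_mul_of_one_le_left (by positivity) l
        _ = ‖Ffun D χ ψ s‖ * (2 * ℓ ^ 158) := by ring
        _ ≤ ‖Ffun D χ ψ s‖ * (ℓ * ℓ ^ 158) := by gcongr; linarith
        _ = _ := by ring)
  refine hb.trans (le_of_eq ?_)
  rw [hr]; field_simp; norm_num

end
end ZS
end

section
namespace ZS
open Complex Set

lemma norm_nuF_le {D : ℕ} (χ : DirichletCharacter ℂ D) (n : ℕ) : ‖nuF D χ n‖ ≤ n.divisors.card := by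
  unfold nuF
  refine (norm_sum_le _ _).trans ?_
  refine (Finset.sum_le_card_nsmul _ _ 1 (fun d _ => χ.norm_le_one _)).trans ?_
  simp

lemma card_summable : Summable (fun n : ℕ => (n.divisors.card : ℝ) * (n : ℝ) ^ (-(5/4) : ℝ)) := by
  have h1 : LSeriesSummable (1 : ℕ → ℂ) ((5/4 : ℝ) : ℂ) := by
    rw [LSeriesSummable_one_iff]
    simp; norm_num
  have h2 := (h1.convolution h1).norm
  refine h2.congr ?_
  intro n
  rcases Nat.eq_zero_or_pos n with rfl | hn
  · simp
  rw [LSeries.term_of_ne_zero hn.ne', LSeries.convolution_def]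
  simp only [Pi.one_apply, mul_one, Finset.sum_const, nsmul_eq_mul]
  rw [norm_div, Complex.norm_natCast_cpow_of_pos hn, Complex.ofReal_re, Complex.norm_natCast,
    show n.divisorsAntidiagonal.card = n.divisors.card by rw [← Nat.map_div_right_divisors, Finset.card_map], Real.rpow_neg (by positivity), div_eq_mul_inv]

lemma AA_hasSum {D p : ℕ} (hD : 2 ≤ D) (hp : 2 ≤ p) 
    (χ : DirichletCharacter ℂ D) (ψ : DirichletCharacter ℂ p) {s : ℂ} (hs : 1 < s.re) :
    HasSum (fun n : ℕ => nuF D χ n * ψ (n : ZMod p) * (n : ℂ) ^ (-s)) (AA D χ ψ s) := by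
  have : NeZero D := ⟨by omega⟩
  have : NeZero p := ⟨by omega⟩
  have : NeZero (D * p) := ⟨mul_ne_zero (NeZero.ne D) (NeZero.ne p)⟩
  have s1 : LSeriesHasSum (fun n : ℕ => ψ (n : ZMod p)) s (Lfun ψ s) := by
    rw [Lfun_eq, DirichletCharacter.LFunction_eq_LSeries ψ hs]
    exact (ZMod.LSeriesSummable_of_one_lt_re ψ hs).LSeriesHasSum
  have s2 : LSeriesHasSum (fun n : ℕ => chiPsi D χ ψ (n : ZMod (D * p))) s (Lfun (chiPsi D χ ψ) s) := by
    rw [Lfun_eq, DirichletCharacter.LFunction_eq_LSeries _ hs]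
    exact (ZMod.LSeriesSummable_of_one_lt_re _ hs).LSeriesHasSum
  have h := s1.convolution s2
  unfold AA
  unfold LSeriesHasSum at h
  convert h using 1
  ext n
  rcases Nat.eq_zero_or_pos n with rfl | hn
  · simp [nuF]
  rw [LSeries.term_of_ne_zero hn.ne', LSeries.convolution_def, div_eq_mul_inv, ← Complex.cpow_neg]
  congr 1
  show _ = ∑ q ∈ n.divisorsAntidiagonal, ψ (q.1 : ZMod p) * chiPsi D χ ψ (q.2 : ZMod (D * p))
  rw [Nat.sum_divisorsAntidiagonal' (f := fun a b => ψ (a : ZMod p) * chiPsi D χ ψ (b : ZMod (D * p)))]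
  unfold nuF
  rw [Finset.sum_mul]
  apply Finset.sum_congr rfl
  intro d hd
  have hdn : n / d * d = n := Nat.div_mul_cancel (Nat.dvd_of_mem_divisors hd)
  rw [chiPsi_apply, mul_left_comm, ← map_mul, ← Nat.cast_mul, hdn]

lemma AA_tail : ∃ C : ℝ, 0 < C ∧ ∀ (D p : ℕ) (_ : 2 ≤ D) (_ : 2 ≤ p) 
    (χ : DirichletCharacter ℂ D) (ψ : DirichletCharacter ℂ p) (s : ℂ) (_ : s.re = 5 / 2) (Y : ℝ) (_ : 1 ≤ Y),
    ‖AA D χ ψ s - ∑ n ∈ Finset.Icc 1 ⌊Y⌋₊, nuF D χ n * ψ (n : ZMod p) * (n : ℂ) ^ (-s)‖ ≤ C * Y ^ (-(5/4) : ℝ) := by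
  set g : ℕ → ℝ := fun n => (n.divisors.card : ℝ) * (n : ℝ) ^ (-(5/4) : ℝ) with hg
  have hg0 : ∀ n, 0 ≤ g n := fun n => by positivity
  have hgs : Summable g := card_summable
  refine ⟨∑' n, g n + 1, add_pos_of_nonneg_of_pos (tsum_nonneg hg0) one_pos, ?_⟩
  intro D p hD hp χ ψ s hs Y hY
  have hsum := AA_hasSum hD hp χ ψ (s := s) (by rw [hs]; norm_num)
  set f : ℕ → ℂ := fun n : ℕ => nuF D χ n * ψ (n : ZMod p) * (n : ℂ) ^ (-s) with hf
  set T := Finset.Icc 1 ⌊Y⌋₊ with hT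
  have h1 := hsum.summable.sum_add_tsum_compl (s := T)
  rw [hsum.tsum_eq] at h1
  rw [← h1, add_sub_cancel_left]
  have hb : ∀ x : ↑(((T : Finset ℕ) : Set ℕ)ᶜ), ‖f x‖ ≤ g x * Y ^ (-(5/4) : ℝ) := by
    rintro ⟨n, hn⟩
    simp only [hT, Set.mem_compl_iff, Finset.mem_coe, Finset.mem_Icc, not_and, not_le] at hn
    rcases Nat.eq_zero_or_pos n with rfl | hn0
    · simp [hf, hg, nuF]
    have hYn : Y ≤ n := by
      have := Nat.lt_of_floor_lt (hn hn0)
      exact this.le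
    simp only [hf, hg]
    rw [norm_mul, norm_mul, Complex.norm_natCast_cpow_of_pos hn0, neg_re, hs]
    have e : (n:ℝ) ^ (-(5/2) : ℝ) = (n:ℝ) ^ (-(5/4) : ℝ) * (n:ℝ) ^ (-(5/4) : ℝ) := by
      rw [← Real.rpow_add (by exact_mod_cast hn0)]; norm_num
    rw [e]
    have h3 : (n:ℝ) ^ (-(5/4) : ℝ) ≤ Y ^ (-(5/4) : ℝ) :=
      Real.rpow_le_rpow_of_nonpos (by linarith) hYn (by norm_num)
    have h4 := norm_nuF_le χ n
    have h5 := ψ.norm_le_one (n : ZMod p)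
    calc _ ≤ (n.divisors.card : ℝ) * 1 * ((n:ℝ) ^ (-(5/4) : ℝ) * Y ^ (-(5/4) : ℝ)) := by gcongr
      _ = _ := by ring
  have hgs' : Summable (fun x : ↑(((T : Finset ℕ) : Set ℕ)ᶜ) => g x) := hgs.subtype _
  refine (tsum_of_norm_bounded (hgs'.mul_right _).hasSum hb).trans ?_
  rw [tsum_mul_right]
  gcongr
  have := Summable.tsum_subtype_le g (((T : Finset ℕ) : Set ℕ)ᶜ) hg0 hgs
  linarith

end ZS
end

section
namespace ZS
open Complex Set

lemma X3_int (D : ℕ) (χ : DirichletCharacter ℂ D) {p : ℕ} (ψ : DirichletCharacter ℂ p) {a b : ℝ} (ha : 0 < a) (hab : a ≤ b) :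
    IntervalIntegrable (fun x => ‖X3 D χ ψ x‖ / x) MeasureTheory.volume a b :=
  intervalIntegrable_norm_sum_div (fun n : ℕ => nuF D χ n * ψ (n : ZMod p) * (n : ℂ) ^ (-s0 D)) (D ^ 4) ha hab

lemma X3_int_le {D : ℕ} (χ : DirichletCharacter ℂ D) {p : ℕ} (ψ : DirichletCharacter ℂ p)
    (hD : 2 ≤ D) (hI : Ineq2 D χ ψ)
    {a b : ℝ} (ha : (D:ℝ) ^ 4 ≤ a) (hab : a ≤ b) (hb : b ≤ bigP D ^ 2) :
    (∫ x in a..b, ‖X3 D χ ψ x‖ / x) ≤ bigL D ^ (-585 : ℤ) := by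
  have hD4 : (0:ℝ) < (D:ℝ) ^ 4 := by positivity
  have h1 : (∫ x in a..b, ‖X3 D χ ψ x‖ / x) ≤ ∫ x in ((D : ℝ) ^ 4)..(bigP D ^ 2), ‖X3 D χ ψ x‖ / x := by
    apply intervalIntegral.integral_mono_interval ha hab hb
    · rw [Filter.EventuallyLE, MeasureTheory.ae_restrict_iff' measurableSet_Ioc]
      refine Filter.Eventually.of_forall fun x hx => ?_
      have : 0 < x := hD4.trans hx.1
      simp only [Pi.zero_apply]
      positivity
    · exact X3_int D χ ψ hD4 (by linarith)
  unfold Ineq2 at hI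
  linarith [norm_nonneg (X3 D χ ψ (bigP D ^ 2))]

lemma X3_int_nonneg {D : ℕ} (χ : DirichletCharacter ℂ D) {p : ℕ} (ψ : DirichletCharacter ℂ p)
    {a b : ℝ} (ha : 0 < a) (hab : a ≤ b) :
    0 ≤ (∫ x in a..b, ‖X3 D χ ψ x‖ / x) := by
  apply intervalIntegral.integral_nonneg hab
  intro x hx
  have : 0 < x := by linarith [hx.1]
  positivity

lemma X3_end {D : ℕ} (χ : DirichletCharacter ℂ D) {p : ℕ} (ψ : DirichletCharacter ℂ p)
    (hD : 2 ≤ D) (hI : Ineq2 D χ ψ) (h : (D:ℝ) ^ 4 ≤ bigP D ^ 2) : ‖X3 D χ ψ (bigP D ^ 2)‖ ≤ bigL D ^ (-585 : ℤ) := by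
  have := X3_int_nonneg χ ψ (a := (D:ℝ) ^ 4) (by positivity) h
  unfold Ineq2 at hI
  linarith

lemma X3_start {D : ℕ} (χ : DirichletCharacter ℂ D) {p : ℕ} (ψ : DirichletCharacter ℂ p) : X3 D χ ψ ((D:ℝ) ^ 4) = 0 := by
  unfold X3
  rw [show (D:ℝ) ^ 4 = ((D ^ 4 : ℕ) : ℝ) by push_cast; rfl, Nat.floor_natCast]
  simp

lemma B_bound {D : ℕ} (χ : DirichletCharacter ℂ D) {p : ℕ} (ψ : DirichletCharacter ℂ p)
    (hD : 2 ≤ D) (hI : Ineq2 D χ ψ)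
    {a b K : ℝ} (ha : (D:ℝ) ^ 4 ≤ a) (hab : a ≤ b) (hb : b ≤ bigP D ^ 2) (s : ℂ) 
    (hK : ∀ x ∈ Icc a b, x ^ (-(s - s0 D).re) ≤ K) :
    ‖∑ n ∈ Finset.Ioc ⌊a⌋₊ ⌊b⌋₊, nuF D χ n * ψ (n : ZMod p) * (n : ℂ) ^ (-s)‖ ≤
      K * (‖X3 D χ ψ b‖ + ‖X3 D χ ψ a‖ + ‖s - s0 D‖ * bigL D ^ (-585 : ℤ)) := by
  have hD4 : (0:ℝ) < (D:ℝ) ^ 4 := by positivity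
  have ha0 : 0 < a := by linarith
  have hK0 : 0 ≤ K := le_trans (by positivity) (hK a ⟨le_rfl, hab⟩)
  have h := abel_bound (fun n : ℕ => nuF D χ n * ψ (n : ZMod p) * (n : ℂ) ^ (-s0 D)) (D ^ 4) ha0 hab (s - s0 D)
    (Nat.le_floor (by push_cast; exact ha)) hK
  have e : ∑ n ∈ Finset.Ioc ⌊a⌋₊ ⌊b⌋₊, nuF D χ n * ψ (n : ZMod p) * (n : ℂ) ^ (-s) = 
      ∑ n ∈ Finset.Ioc ⌊a⌋₊ ⌊b⌋₊, nuF D χ n * ψ (n : ZMod p) * (n : ℂ) ^ (-s0 D) * (n : ℂ) ^ (-(s - s0 D)) := by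
    apply Finset.sum_congr rfl
    intro n hn
    rw [Finset.mem_Ioc] at hn
    rw [cpow_split n (by omega) s (s0 D)]; ring
  rw [e]
  refine h.trans ?_
  gcongr
  · exact le_rfl
  · exact le_rfl
  · exact X3_int_le χ ψ hD hI ha hab hb

lemma choose_X {D : ℕ} (χ : DirichletCharacter ℂ D) {p : ℕ} (ψ : DirichletCharacter ℂ p)
    (hD : 2 ≤ D) (hL : 0 < bigL D) (hI : Ineq2 D χ ψ)
    {a : ℝ} (ha : (D:ℝ) ^ 4 ≤ a) (hb : 2 * a ≤ bigP D ^ 2) :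
    ∃ X, a ≤ X ∧ X ≤ 2 * a ∧ ‖X3 D χ ψ X‖ ≤ 2 * bigL D ^ (-585 : ℤ) := by
  by_contra hcon
  push Not at hcon
  have hD4 : (0:ℝ) < (D:ℝ) ^ 4 := by positivity
  have ha0 : 0 < a := by linarith
  have hab : a ≤ 2 * a := by linarith
  have h1 := X3_int_le χ ψ hD hI ha hab hb
  have hδ : 0 < bigL D ^ (-585 : ℤ) := by positivity
  set δ := bigL D ^ (-585 : ℤ)
  have h2 : ∫ x in a..(2*a), (2 * δ) * (1 / x) ≤ ∫ x in a..(2*a), ‖X3 D χ ψ x‖ / x := by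
    apply intervalIntegral.integral_mono_on hab
    · apply IntervalIntegrable.const_mul
      apply intervalIntegral.intervalIntegrable_one_div
      · intro x hx; rw [uIcc_of_le hab] at hx; linarith [hx.1]
      · exact continuousOn_id
    · exact X3_int D χ ψ ha0 hab
    · intro x hx
      have hx0 : 0 < x := by linarith [hx.1]
      rw [mul_one_div]
      have := hcon x hx.1 hx.2
      gcongr
  rw [intervalIntegral.integral_const_mul, integral_one_div (by rw [uIcc_of_le hab]; intro h; linarith [h.1]),
    mul_div_assoc, div_self ha0.ne', mul_one] at h2
  have := Real.log_two_gt_d9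
  nlinarith

end ZS
end

section
namespace ZS
open Complex Set

lemma pow_le_exp {x : ℝ} (hx : 0 ≤ x) (k : ℕ) : x ^ k ≤ Real.exp (k * x) := by
  rw [Real.exp_nat_mul]
  have := Real.add_one_le_exp x
  gcongr
  linarith

lemma l9_big {x : ℝ} (hx : 10 ^ 20 ≤ x) : 10 ^ 20 * x ≤ x ^ 9 := by
  have h1 : (1:ℝ) ≤ x := le_trans (by norm_num) hx
  calc 10 ^ 20 * x ≤ x * x := by gcongr
    _ = x ^ 2 := by ring
    _ ≤ x ^ 9 := pow_le_pow_right₀ h1 (by norm_num)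

/-- the balancing length -/
def XX (D : ℕ) : ℝ := bigP D * Real.sqrt D * t0 D


lemma h100 {D : ℕ} (h : 10 ^ 20 ≤ bigL D) : 100 ≤ bigL D := le_trans (by norm_num) h

lemma sqrtD {D : ℕ} (h : 10 ^ 20 ≤ bigL D) : Real.sqrt D = Real.exp (bigL D / 2) := by
  rw [← exp_bigL (h100 h), show Real.exp (bigL D) = Real.exp (bigL D / 2) ^ 2 by rw [sq, ← Real.exp_add]; ring_nf]
  exact Real.sqrt_sq (Real.exp_pos _).le

lemma t0_ge {D : ℕ} (h : 10 ^ 20 ≤ bigL D) : 1 ≤ t0 D := one_le_pow₀ (le_trans (by norm_num) h)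

lemma XX_ge {D : ℕ} (h : 10 ^ 20 ≤ bigL D) : Real.exp (bigL D ^ 9) ≤ XX D := by
  unfold XX
  rw [sqrtD h]
  have h1 := h100 h
  have h2 : 1 ≤ Real.exp (bigL D / 2) := Real.one_le_exp (by linarith)
  have h3 := t0_ge h
  have h4 : 1 ≤ Real.exp (bigL D / 2) * t0 D := one_le_mul_of_one_le_of_one_le h2 h3
  have : 0 < bigP D := Real.exp_pos _
  unfold bigP at *
  nlinarith

lemma XX_le {D : ℕ} (h : 10 ^ 20 ≤ bigL D) : 2 * XX D ≤ Real.exp (bigL D ^ 9 + 521 * bigL D) := by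
  unfold XX
  rw [sqrtD h]
  have h1 := h100 h
  have h3 : t0 D ≤ Real.exp (519 * bigL D) := by
    have := pow_le_exp (x := bigL D) (by linarith) 519
    exact_mod_cast this
  have h4 : (2:ℝ) ≤ Real.exp (bigL D) := by linarith [Real.add_one_le_exp (bigL D)]
  calc 2 * (bigP D * Real.exp (bigL D / 2) * t0 D) ≤ Real.exp (bigL D) * (Real.exp (bigL D ^ 9) * Real.exp (bigL D / 2) * Real.exp (519 * bigL D)) := by
        have := t0_ge h
        unfold bigP; gcongr
    _ = Real.exp (bigL D ^ 9 + 520.5 * bigL D) := by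
        rw [← Real.exp_add, ← Real.exp_add, ← Real.exp_add]; congr 1; ring
    _ ≤ _ := by apply Real.exp_le_exp.mpr; linarith

lemma XX_sq (D : ℕ) : XX D ^ 2 = bigP D ^ 2 * D * t0 D ^ 2 := by
  unfold XX
  rw [mul_pow, mul_pow, Real.sq_sqrt (Nat.cast_nonneg _)]

lemma Dpow_eq {D : ℕ} (h : 10 ^ 20 ≤ bigL D) (k : ℕ) : (D:ℝ) ^ k = Real.exp (k * bigL D) := by
  rw [← exp_bigL (h100 h), Real.exp_nat_mul, exp_bigL (h100 h)]

lemma D4_le {D : ℕ} (h : 10 ^ 20 ≤ bigL D) : (D:ℝ) ^ 4 ≤ XX D := by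
  refine le_trans ?_ (XX_ge h)
  rw [Dpow_eq h]
  apply Real.exp_le_exp.mpr
  have := l9_big h
  have := h100 h
  push_cast
  linarith

lemma P2_eq (D : ℕ) : bigP D ^ 2 = Real.exp (2 * bigL D ^ 9) := by
  unfold bigP
  rw [← Real.exp_nat_mul]; norm_num

lemma XX_le_P2 {D : ℕ} (h : 10 ^ 20 ≤ bigL D) : 2 * XX D ≤ bigP D ^ 2 := by
  refine (XX_le h).trans ?_
  rw [P2_eq]
  apply Real.exp_le_exp.mpr
  have := l9_big h
  have := h100 h
  linarith

lemma inv_pow_ge {D : ℕ} (h : 10 ^ 20 ≤ bigL D) (k : ℕ) : Real.exp (-(k * bigL D)) ≤ (bigL D ^ k)⁻¹ := by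
  rw [Real.exp_neg]
  have h1 := h100 h
  have := pow_le_exp (x := bigL D) (by linarith) k
  gcongr


/-- all the data available for the main argument -/
structure Ctx (D : ℕ) (χ : DirichletCharacter ℂ D) {p : ℕ} (ψ : DirichletCharacter ℂ p) (Z q : ℂ → ℂ) (X : ℝ) : Prop where
  big : 10 ^ 20 ≤ bigL D
  hp2 : 2 ≤ p
  pl : bigP D ≤ p
  pu : (p : ℝ) ≤ 2 * bigP D
  I1 : Ineq1 D χ ψ
  I2 : Ineq2 D χ ψ
  I3 : Ineq3 D χ ψ
  zp : ZProp D p (AA D χ ψ) Z q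
  adiff : Differentiable ℂ (AA D χ ψ)
  abd : ∀ s : ℂ, 1 / 2 ≤ s.re → ‖AA D χ ψ s‖ ≤ (2 * (p + 1) * ‖s‖) * (2 * (D * p + 1) * ‖s‖)
  tail : ∀ s : ℂ, s.re = 5 / 2 → ∀ Y : ℝ, 1 ≤ Y →
    ‖AA D χ ψ s - ∑ n ∈ Finset.Icc 1 ⌊Y⌋₊, nuF D χ n * ψ (n : ZMod p) * (n : ℂ) ^ (-s)‖ ≤ bigL D * Y ^ (-(5/4) : ℝ)
  Xl : XX D ≤ X
  Xu : X ≤ 2 * XX D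
  X3X : ‖X3 D χ ψ X‖ ≤ 2 * bigL D ^ (-585 : ℤ)

lemma exists_ctx : ∃ L0 : ℝ, ∀ D : ℕ, L0 ≤ bigL D → ∀ (χ : DirichletCharacter ℂ D) (p : ℕ) (ψ : DirichletCharacter ℂ p),
    χ.IsPrimitive → MemPsi1 D χ ψ → ∃ (Z q : ℂ → ℂ) (X : ℝ), Ctx D χ ψ Z q X := by
  obtain ⟨C, hC0, hC⟩ := AA_tail
  refine ⟨max (10 ^ 20) C, ?_⟩
  intro D hD χ p ψ hχ ⟨⟨hp, hp1, hp2⟩, hψ, I1, I2, I3⟩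
  have big : 10 ^ 20 ≤ bigL D := (le_max_left _ _).trans hD
  have hCl : C ≤ bigL D := (le_max_right _ _).trans hD
  have hDn := D_nat (h100 big)
  have hco : Nat.Coprime D p := by
    rw [Nat.coprime_comm, hp.coprime_iff_not_dvd]
    intro hdvd
    have h1 : p ≤ D := Nat.le_of_dvd (by omega) hdvd
    have h2 : (p:ℝ) ≤ D := by exact_mod_cast h1
    rw [← exp_bigL (h100 big)] at h2
    have h3 : bigP D ≤ Real.exp (bigL D) := by linarith
    unfold bigP at h3
    rw [Real.exp_le_exp] at h3
    have := l9_big big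
    have := h100 big
    linarith
  obtain ⟨Z, q, hz⟩ := exists_Z hDn hp.two_le hco χ ψ hχ hψ
  obtain ⟨a1, a2⟩ := AA_bound hDn hp.two_le hco χ ψ hχ hψ
  obtain ⟨X, x1, x2, x3⟩ := choose_X χ ψ hDn (by linarith [h100 big]) I2 (D4_le big) (XX_le_P2 big)
  refine ⟨Z, q, X, big, hp.two_le, hp1.le, ?_, I1, I2, I3, hz, a1, a2, ?_, x1, x2, x3⟩
  · have : bigL D ^ (-68 : ℤ) ≤ 1 := by
      apply zpow_le_one_of_nonpos₀ (by linarith [h100 big]) (by norm_num)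
    have hP : 0 < bigP D := Real.exp_pos _
    nlinarith
  · intro s hs Y hY
    refine (hC D p hDn hp.two_le χ ψ s hs Y hY).trans ?_
    gcongr

end ZS
end

section
namespace ZS
open Complex Set

/-- the middle part of the Dirichlet series -/
def BB (D : ℕ) (χ : DirichletCharacter ℂ D) {p : ℕ} (ψ : DirichletCharacter ℂ p) (X : ℝ) (s : ℂ) : ℂ :=
  ∑ n ∈ Finset.Ioc (D ^ 4) ⌊X⌋₊, nuF D χ n * ψ (n : ZMod p) * (n : ℂ) ^ (-s)

/-- the truncated series -/
def HH (D : ℕ) (χ : DirichletCharacter ℂ D) {p : ℕ} (ψ : DirichletCharacter ℂ p) (X : ℝ) (s : ℂ) : ℂ :=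
  Ffun D χ ψ s + BB D χ ψ X s

/-- the remainder in the approximate functional equation -/
def R2 (D : ℕ) (χ : DirichletCharacter ℂ D) {p : ℕ} (ψ : DirichletCharacter ℂ p) (Z : ℂ → ℂ) (X : ℝ) (s : ℂ) : ℂ :=
  AA D χ ψ s - HH D χ ψ X s - Z s * (starRingEnd ℂ) (HH D χ ψ X (1 - (starRingEnd ℂ) s))

lemma star_re (s : ℂ) : (1 - (starRingEnd ℂ) s).re = 1 - s.re := by simp
lemma star_im (s : ℂ) : (1 - (starRingEnd ℂ) s).im = s.im := by simp
lemma star_star (s : ℂ) : 1 - (starRingEnd ℂ) (1 - (starRingEnd ℂ) s) = s := by simp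

section
variable {D : ℕ} {χ : DirichletCharacter ℂ D} {p : ℕ} {ψ : DirichletCharacter ℂ p} {Z q : ℂ → ℂ} {X : ℝ}

lemma R2_refl (c : Ctx D χ ψ Z q X) {s : ℂ} (hs : s.im ≠ 0) :
    R2 D χ ψ Z X s = Z s * (starRingEnd ℂ) (R2 D χ ψ Z X (1 - (starRingEnd ℂ) s)) := by
  have h1 := c.zp.fe s hs
  have h2 := c.zp.refl s hs
  unfold R2
  rw [star_star, map_sub, map_sub, map_mul, Complex.conj_conj]
  linear_combination h1 + HH D χ ψ X s * h2

lemma geom (c : Ctx D χ ψ Z q X) {s : ℂ} (h1 : -(3/2) ≤ s.re) (h2 : s.re ≤ 5/2)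
    (h3 : |s.im - 2 * Real.pi * t0 D| ≤ bigL1 D + 3 + bigL D ^ 10) :
    t0 D ≤ s.im ∧ s.im + 4 ≤ 8 * t0 D ∧ ‖s - s0 D‖ ≤ 2 * bigL D ^ 405 ∧ 4 ≤ s.im := by
  have hb := c.big
  have hl : (1:ℝ) ≤ bigL D := by linarith [h100 hb]
  have e1 : 100 * bigL D ^ 10 ≤ bigL D ^ 405 := by
    calc 100 * bigL D ^ 10 ≤ bigL D * bigL D ^ 10 := by gcongr; exact h100 hb
      _ = bigL D ^ 11 := by ring
      _ ≤ _ := pow_le_pow_right₀ hl (by norm_num)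
  have e2 : 100 * bigL D ^ 405 ≤ t0 D := by
    calc 100 * bigL D ^ 405 ≤ bigL D * bigL D ^ 405 := by gcongr; exact h100 hb
      _ = bigL D ^ 406 := by ring
      _ ≤ _ := pow_le_pow_right₀ hl (by norm_num)
  have e3 : 100 ≤ bigL D ^ 10 := (h100 hb).trans (le_self_pow₀ hl (by norm_num))
  have hpi := Real.pi_gt_three
  have hpi2 := Real.pi_lt_d2
  have h3' := h3
  rw [abs_le] at h3
  have hL1 : bigL1 D = bigL D ^ 405 := rfl
  rw [hL1] at h3 h3'
  have ht : 0 ≤ t0 D := by linarith [t0_ge hb]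
  have f1 : 6 * t0 D ≤ 2 * Real.pi * t0 D := by nlinarith
  have f2 : 2 * Real.pi * t0 D ≤ 6.3 * t0 D := by nlinarith
  refine ⟨by linarith [h3.1], by linarith [h3.2], ?_, by linarith [h3.1]⟩
  refine (Complex.norm_le_abs_re_add_abs_im _).trans ?_
  rw [sub_re, sub_im, s0_re, s0_im]
  have : |s.re - 1 / 2| ≤ 2 := by rw [abs_le]; constructor <;> linarith
  linarith

lemma BB_bound (c : Ctx D χ ψ Z q X) {K : ℝ} (s : ℂ) (hs : ‖s - s0 D‖ ≤ 2 * bigL D ^ 405)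
    (hK : ∀ x ∈ Icc ((D:ℝ)^4) X, x ^ (-(s.re - 1 / 2)) ≤ K) :
    ‖BB D χ ψ X s‖ ≤ K * (3 * (bigL D ^ 180)⁻¹) := by
  have hb := c.big
  have hl : (1:ℝ) ≤ bigL D := by linarith [h100 hb]
  have hD4 := (D4_le hb).trans c.Xl
  have h1 := B_bound χ ψ (D_nat (h100 hb)) c.I2 (K := K) le_rfl hD4 (c.Xu.trans (XX_le_P2 hb)) s (by
    rw [sub_re, s0_re]; exact hK)
  rw [X3_start, norm_zero, show ⌊(D:ℝ)^4⌋₊ = D ^ 4 by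
    rw [show (D:ℝ) ^ 4 = ((D ^ 4 : ℕ) : ℝ) by push_cast; rfl, Nat.floor_natCast]] at h1
  refine h1.trans ?_
  have hK0 : 0 ≤ K := le_trans (by positivity) (hK _ ⟨le_rfl, hD4⟩)
  have hδ : bigL D ^ (-585 : ℤ) = (bigL D ^ 405)⁻¹ * (bigL D ^ 180)⁻¹ := by
    rw [← mul_inv, ← pow_add, zpow_neg]; norm_cast
  have h405 : 100 ≤ bigL D ^ 405 := (h100 hb).trans (le_self_pow₀ hl (by norm_num))
  have h5 := c.X3X
  have hδ0 : 0 ≤ bigL D ^ (-585 : ℤ) := by positivity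
  gcongr
  calc ‖X3 D χ ψ X‖ + 0 + ‖s - s0 D‖ * bigL D ^ (-585:ℤ) ≤ 2 * bigL D ^ (-585:ℤ) + 0 + (2 * bigL D ^ 405) * bigL D ^ (-585:ℤ) := by
        gcongr
    _ ≤ 3 * bigL D ^ 405 * bigL D ^ (-585:ℤ) := by nlinarith
    _ = _ := by rw [hδ]; field_simp

lemma F_crude (hD : 2 ≤ D) {s : ℂ} (hs : -(3/2) ≤ s.re) : ‖Ffun D χ ψ s‖ ≤ (D:ℝ) ^ 14 := by
  unfold Ffun
  refine (norm_sum_le _ _).trans ?_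
  have hD1 : (1:ℝ) ≤ D := by exact_mod_cast (by omega : 1 ≤ D)
  have : ∀ n ∈ Finset.Icc 1 (D ^ 4), ‖nuF D χ n * ψ (n : ZMod p) * (n : ℂ) ^ (-s)‖ ≤ (D:ℝ) ^ 10 := by
    intro n hn
    rw [Finset.mem_Icc] at hn
    rw [norm_mul, norm_mul, Complex.norm_natCast_cpow_of_pos (by omega), neg_re]
    have h1 : ‖nuF D χ n‖ ≤ (D:ℝ) ^ 4 := by
      refine (norm_nuF_le χ n).trans ?_
      have : n.divisors.card ≤ D ^ 4 := (Nat.card_divisors_le_self n).trans hn.2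
      exact_mod_cast this
    have h2 := ψ.norm_le_one (n : ZMod p)
    have h3 : (n:ℝ) ^ (-s.re) ≤ (D:ℝ) ^ 6 := by
      have hn1 : (1:ℝ) ≤ n := by exact_mod_cast hn.1
      have hn2 : (n:ℝ) ≤ (D:ℝ) ^ 4 := by exact_mod_cast hn.2
      calc (n:ℝ) ^ (-s.re) ≤ (n:ℝ) ^ (3/2 : ℝ) := Real.rpow_le_rpow_of_exponent_le hn1 (by linarith)
        _ ≤ ((D:ℝ) ^ 4) ^ (3/2 : ℝ) := by gcongr
        _ = (D:ℝ) ^ 6 := by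
          rw [← Real.rpow_natCast, ← Real.rpow_mul (by positivity), ← Real.rpow_natCast]; norm_num
    calc _ ≤ (D:ℝ) ^ 4 * 1 * (D:ℝ) ^ 6 := by gcongr
      _ = _ := by ring
  refine (Finset.sum_le_card_nsmul _ _ _ this).trans ?_
  simp only [Nat.card_Icc, nsmul_eq_mul]
  push_cast
  apply le_of_eq; ring

lemma X_pos (c : Ctx D χ ψ Z q X) : 0 < X := lt_of_lt_of_le (Real.exp_pos _) ((XX_ge c.big).trans c.Xl)

lemma D4X (c : Ctx D χ ψ Z q X) : (D:ℝ) ^ 4 ≤ X := (D4_le c.big).trans c.Xl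

lemma X_one (c : Ctx D χ ψ Z q X) : 1 ≤ X := by
  refine le_trans ?_ (D4X c)
  exact one_le_pow₀ (D_gt (h100 c.big)).le

lemma X_le (c : Ctx D χ ψ Z q X) : X ≤ Real.exp (bigL D ^ 9 + 521 * bigL D) := c.Xu.trans (XX_le c.big)

lemma Zright1 (c : Ctx D χ ψ Z q X) {s : ℂ} (h1 : s.re = 5/2) (h2 : t0 D ≤ s.im) (h4 : 4 ≤ s.im) : ‖Z s‖ * X ^ 4 ≤ 25600 := by
  have h := c.zp.right1 s h4 h1
  have ht := t0_ge c.big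
  have hP : 0 < bigP D := Real.exp_pos _
  have hX := X_pos c
  have hD : (0:ℝ) < D := by linarith [D_gt (h100 c.big)]
  have e1 : XX D ^ 2 ≤ (p : ℝ) ^ 2 * D * s.im ^ 2 := by
    rw [XX_sq]
    have := c.pl
    gcongr
  have e2 : X ^ 2 ≤ 4 * XX D ^ 2 := by
    have := pow_le_pow_left₀ hX.le c.Xu 2
    linarith [this]
  set Q := (p : ℝ) ^ 2 * D * s.im ^ 2 with hQ
  have hQ0 : 0 < Q := by
    have : 0 < X ^ 2 := by positivity
    linarith
  have e3 : X ^ 4 ≤ 16 * Q ^ 2 := by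
    have : X ^ 2 ≤ 4 * Q := by linarith
    have := pow_le_pow_left₀ (by positivity) this 2
    nlinarith
  calc ‖Z s‖ * X ^ 4 ≤ 1600 / Q ^ 2 * (16 * Q ^ 2) := by gcongr
    _ = 25600 := by field_simp; norm_num

lemma Zleft (c : Ctx D χ ψ Z q X) {s : ℂ} (h1 : s.re = -(3/2)) (h2 : s.im + 4 ≤ 8 * t0 D) (h4 : 4 ≤ s.im) : ‖Z s‖ ≤ 65536 * X ^ 4 := by
  have h := c.zp.right2 (1 - (starRingEnd ℂ) s) (by rw [star_im]; exact h4) (by rw [star_re, h1]; norm_num)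
  have hr := c.zp.refl s (by linarith)
  have hr' := congrArg norm hr
  rw [norm_mul, RCLike.norm_conj, norm_one] at hr'
  rw [star_im] at h
  have ht := t0_ge c.big
  have hP : 0 < bigP D := Real.exp_pos _
  have hX := X_pos c
  have hD : (0:ℝ) < D := by linarith [D_gt (h100 c.big)]
  set Q := (p : ℝ) ^ 2 * D * (s.im + 4) ^ 2 with hQ
  have hp : (0:ℝ) < p := lt_of_lt_of_le hP c.pl
  have hs4 : 0 < s.im + 4 := by linarith
  have hQ0 : 0 < Q := by positivity
  have e1 : Q ≤ 256 * X ^ 2 := by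
    calc Q ≤ (2 * bigP D) ^ 2 * D * (8 * t0 D) ^ 2 := by
          have := c.pu
          rw [hQ]
          gcongr
      _ = 256 * XX D ^ 2 := by rw [XX_sq]; ring
      _ ≤ _ := by
          have := c.Xl
          have : 0 ≤ XX D := le_trans (Real.exp_pos _).le (XX_ge c.big)
          gcongr
  have e2 : ‖Z s‖ ≤ Q ^ 2 := by
    have : ‖Z s‖ * (1 / Q ^ 2) ≤ 1 := by
      calc _ ≤ ‖Z s‖ * ‖Z (1 - (starRingEnd ℂ) s)‖ := by gcongr
        _ = 1 := hr'
    rw [mul_one_div, div_le_one (by positivity)] at this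
    exact this
  calc ‖Z s‖ ≤ Q ^ 2 := e2
    _ ≤ (256 * X ^ 2) ^ 2 := by gcongr
    _ = _ := by ring

end
end ZS
end

section
namespace ZS
open Complex Set

section
variable {D : ℕ} {χ : DirichletCharacter ℂ D} {p : ℕ} {ψ : DirichletCharacter ℂ p} {Z q : ℂ → ℂ} {X : ℝ}

lemma mid_bound (c : Ctx D χ ψ Z q X) (s : ℂ) (hs : ‖s - s0 D‖ ≤ 2 * bigL D ^ 405) (hr : s.re = 5 / 2) :
    ‖∑ n ∈ Finset.Ioc ⌊X⌋₊ ⌊bigP D ^ 2⌋₊, nuF D χ n * ψ (n : ZMod p) * (n : ℂ) ^ (-s)‖ * X ^ 2 ≤ 3 * (bigL D ^ 180)⁻¹ := by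
  have hb := c.big
  have hX := X_pos c
  have hl : (1:ℝ) ≤ bigL D := by linarith [h100 hb]
  have h1 := B_bound χ ψ (D_nat (h100 hb)) c.I2 (K := (X ^ 2)⁻¹) (D4X c) (c.Xu.trans (XX_le_P2 hb)) le_rfl s (by
    intro x hx
    rw [sub_re, s0_re, hr, show -((5:ℝ)/2 - 1/2) = -((2:ℕ):ℝ) by norm_num, Real.rpow_neg (by linarith [hx.1]), Real.rpow_natCast]
    have := hx.1
    gcongr)
  have hδ : bigL D ^ (-585 : ℤ) = (bigL D ^ 405)⁻¹ * (bigL D ^ 180)⁻¹ := by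
    rw [← mul_inv, ← pow_add, zpow_neg]; norm_cast
  have h405 : 100 ≤ bigL D ^ 405 := (h100 hb).trans (le_self_pow₀ hl (by norm_num))
  have h5 := c.X3X
  have h6 := X3_end χ ψ (D_nat (h100 hb)) c.I2 ((D4X c).trans (c.Xu.trans (XX_le_P2 hb)))
  have hδ0 : 0 ≤ bigL D ^ (-585 : ℤ) := by positivity
  calc _ ≤ (X ^ 2)⁻¹ * (‖X3 D χ ψ (bigP D ^ 2)‖ + ‖X3 D χ ψ X‖ + ‖s - s0 D‖ * bigL D ^ (-585 : ℤ)) * X ^ 2 := by gcongr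
    _ = (‖X3 D χ ψ (bigP D ^ 2)‖ + ‖X3 D χ ψ X‖ + ‖s - s0 D‖ * bigL D ^ (-585 : ℤ)) := by field_simp
    _ ≤ bigL D ^ (-585:ℤ) + 2 * bigL D ^ (-585:ℤ) + (2 * bigL D ^ 405) * bigL D ^ (-585:ℤ) := by
        gcongr
    _ ≤ 3 * bigL D ^ 405 * bigL D ^ (-585:ℤ) := by nlinarith
    _ = _ := by rw [hδ]; field_simp

lemma X_sq_le (c : Ctx D χ ψ Z q X) : X ^ 2 ≤ Real.exp (2 * bigL D ^ 9 + 1042 * bigL D) := by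
  calc X ^ 2 ≤ (Real.exp (bigL D ^ 9 + 521 * bigL D)) ^ 2 := pow_le_pow_left₀ (X_pos c).le (X_le c) 2
    _ = _ := by rw [← Real.exp_nat_mul]; congr 1; push_cast; ring

lemma tail_bound (c : Ctx D χ ψ Z q X) : bigL D * (bigP D ^ 2) ^ (-(5/4) : ℝ) * X ^ 2 ≤ (bigL D ^ 180)⁻¹ := by
  have hb := c.big
  have hl : (1:ℝ) ≤ bigL D := by linarith [h100 hb]
  have h9 := l9_big hb
  have hle : bigL D ≤ Real.exp (bigL D) := by linarith [Real.add_one_le_exp (bigL D)]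
  refine le_trans ?_ (inv_pow_ge hb 180)
  rw [P2_eq, ← Real.exp_mul]
  calc _ ≤ Real.exp (bigL D) * Real.exp (2 * bigL D ^ 9 * -(5 / 4)) * Real.exp (2 * bigL D ^ 9 + 1042 * bigL D) := by
        have := X_sq_le c
        gcongr
    _ = Real.exp (-(bigL D ^ 9 / 2) + 1043 * bigL D) := by
        rw [← Real.exp_add, ← Real.exp_add]; congr 1; ring
    _ ≤ _ := by
        apply Real.exp_le_exp.mpr
        push_cast
        linarith

lemma D14_bound (c : Ctx D χ ψ Z q X) : (D:ℝ) ^ 14 ≤ X ^ 2 * (bigL D ^ 180)⁻¹ := by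
  have hb := c.big
  have hl : (1:ℝ) ≤ bigL D := by linarith [h100 hb]
  have h9 := l9_big hb
  have h1 := inv_pow_ge hb 180
  have h2 : Real.exp (bigL D ^ 9) ≤ X := (XX_ge hb).trans c.Xl
  calc (D:ℝ) ^ 14 = Real.exp (14 * bigL D) := by rw [Dpow_eq hb]; norm_num
    _ ≤ Real.exp (bigL D ^ 9 + bigL D ^ 9 + (-((180:ℕ) * bigL D))) := by
        apply Real.exp_le_exp.mpr
        push_cast
        linarith
    _ = (Real.exp (bigL D ^ 9)) ^ 2 * Real.exp (-((180:ℕ) * bigL D)) := by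
        rw [Real.exp_add, Real.exp_add, sq]
    _ ≤ _ := by gcongr

lemma sum_split (c : Ctx D χ ψ Z q X) (s : ℂ) :
    ∑ n ∈ Finset.Icc 1 ⌊bigP D ^ 2⌋₊, nuF D χ n * ψ (n : ZMod p) * (n : ℂ) ^ (-s) =
      HH D χ ψ X s + ∑ n ∈ Finset.Ioc ⌊X⌋₊ ⌊bigP D ^ 2⌋₊, nuF D χ n * ψ (n : ZMod p) * (n : ℂ) ^ (-s) := by
  unfold HH Ffun BB
  have h1 : D ^ 4 ≤ ⌊X⌋₊ := Nat.le_floor (by push_cast; exact D4X c)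
  have h2 : ⌊X⌋₊ ≤ ⌊bigP D ^ 2⌋₊ := Nat.floor_le_floor (c.Xu.trans (XX_le_P2 c.big))
  have hIoc : ∀ n, Finset.Icc 1 n = Finset.Ioc 0 n := by
    intro n; ext x; simp only [Finset.mem_Icc, Finset.mem_Ioc]; omega
  rw [hIoc, hIoc, Finset.sum_Ioc_consecutive _ (Nat.zero_le _) h1, Finset.sum_Ioc_consecutive _ (Nat.zero_le _) h2]

lemma star_s0 {D : ℕ} (s : ℂ) : ‖(1 - (starRingEnd ℂ) s) - s0 D‖ = ‖s - s0 D‖ := by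
  have e : (1 - (starRingEnd ℂ) s) - s0 D = -(starRingEnd ℂ) (s - s0 D) := by
    apply Complex.ext
    · simp [s0_re]; ring
    · simp [s0_im]; ring
  rw [e, norm_neg, RCLike.norm_conj]

lemma R2_right (c : Ctx D χ ψ Z q X) {s : ℂ} (hr : s.re = 5 / 2)
    (h3 : |s.im - 2 * Real.pi * t0 D| ≤ bigL1 D + 3 + bigL D ^ 10) :
    ‖R2 D χ ψ Z X s‖ * X ^ 2 ≤ (bigL D ^ 179)⁻¹ := by
  have hb := c.big
  have hl : (1:ℝ) ≤ bigL D := by linarith [h100 hb]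
  have hX := X_pos c
  obtain ⟨g1, g2, g3, g4⟩ := geom c (by linarith) (by linarith) h3
  have hP1 : 1 ≤ bigP D ^ 2 := one_le_pow₀ (Real.one_le_exp (by positivity))
  have t1 := c.tail s hr (bigP D ^ 2) hP1
  rw [sum_split c] at t1
  have t2 := mid_bound c s g3 hr
  have t3 := tail_bound c
  have t4 := D14_bound c
  have t5 := Zright1 c hr g1 g4
  have t6 := BB_bound c (K := X ^ 2) (1 - (starRingEnd ℂ) s) (by rw [star_s0]; exact g3) (by
    intro x hx
    rw [star_re, hr, show -((1:ℝ) - 5/2 - 1/2) = ((2:ℕ):ℝ) by norm_num, Real.rpow_natCast]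
    have h4 : (0:ℝ) ≤ (D:ℝ) ^ 4 := by positivity
    have := hx.1
    have := hx.2
    gcongr
    linarith)
  have t7 := F_crude (χ := χ) (ψ := ψ) (D_nat (h100 hb)) (s := 1 - (starRingEnd ℂ) s) (by rw [star_re, hr]; norm_num)
  set M := ∑ n ∈ Finset.Ioc ⌊X⌋₊ ⌊bigP D ^ 2⌋₊, nuF D χ n * ψ (n : ZMod p) * (n : ℂ) ^ (-s)
  have e : R2 D χ ψ Z X s = (AA D χ ψ s - (HH D χ ψ X s + M)) + M - Z s * (starRingEnd ℂ) (HH D χ ψ X (1 - (starRingEnd ℂ) s)) := by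
    unfold R2; ring
  have hH : ‖HH D χ ψ X (1 - (starRingEnd ℂ) s)‖ ≤ 4 * X ^ 2 * (bigL D ^ 180)⁻¹ := by
    unfold HH
    refine (norm_add_le _ _).trans ?_
    linarith
  have hn : ‖R2 D χ ψ Z X s‖ ≤ bigL D * (bigP D ^ 2) ^ (-(5/4) : ℝ) + ‖M‖ + ‖Z s‖ * (4 * X ^ 2 * (bigL D ^ 180)⁻¹) := by
    rw [e]
    refine (norm_sub_le _ _).trans ?_
    refine add_le_add ((norm_add_le _ _).trans (add_le_add t1 le_rfl)) ?_
    rw [norm_mul, RCLike.norm_conj]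
    gcongr
  have hη : 0 < (bigL D ^ 180)⁻¹ := by positivity
  set η := (bigL D ^ 180)⁻¹ with hηd
  calc ‖R2 D χ ψ Z X s‖ * X ^ 2 ≤ (bigL D * (bigP D ^ 2) ^ (-(5/4) : ℝ) + ‖M‖ + ‖Z s‖ * (4 * X ^ 2 * η)) * X ^ 2 := by gcongr
    _ = bigL D * (bigP D ^ 2) ^ (-(5/4) : ℝ) * X ^ 2 + ‖M‖ * X ^ 2 + (‖Z s‖ * X ^ 4) * (4 * η) := by ring
    _ ≤ η + 3 * η + 25600 * (4 * η) := by gcongr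
    _ ≤ bigL D * η := by nlinarith
    _ = _ := by rw [hηd]; field_simp

lemma R2_left (c : Ctx D χ ψ Z q X) {s : ℂ} (hr : s.re = -(3 / 2))
    (h3 : |s.im - 2 * Real.pi * t0 D| ≤ bigL1 D + 3 + bigL D ^ 10) :
    ‖R2 D χ ψ Z X s‖ ≤ 65536 * X ^ 2 * (bigL D ^ 179)⁻¹ := by
  have hX := X_pos c
  obtain ⟨g1, g2, g3, g4⟩ := geom c (by linarith) (by linarith) h3
  have h1 := R2_right c (s := 1 - (starRingEnd ℂ) s) (by rw [star_re, hr]; norm_num) (by rw [star_im]; exact h3)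
  have h2 := Zleft c hr g2 g4
  rw [R2_refl c (by linarith), norm_mul, RCLike.norm_conj]
  set r := ‖R2 D χ ψ Z X (1 - (starRingEnd ℂ) s)‖
  calc ‖Z s‖ * r ≤ 65536 * X ^ 4 * r := by gcongr
    _ = 65536 * X ^ 2 * (r * X ^ 2) := by ring
    _ ≤ _ := by gcongr

end
end ZS
end

section
namespace ZS
open Complex Set

lemma hasDerivAt_star {f : ℂ → ℂ} {f' : ℂ} {s : ℂ} (hf : HasDerivAt f f' (1 - (starRingEnd ℂ) s)) :
    HasDerivAt (fun z => (starRingEnd ℂ) (f (1 - (starRingEnd ℂ) z))) (-(starRingEnd ℂ) f') s := by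
  have h1 : HasDerivAt (fun z : ℂ => f (1 - z)) (-f') ((starRingEnd ℂ) s) := by
    have := hf.comp ((starRingEnd ℂ) s) ((hasDerivAt_id ((starRingEnd ℂ) s)).const_sub 1)
    simpa [Function.comp_def] using this
  have h2 := h1.conj_conj
  rw [Complex.conj_conj, map_neg] at h2
  exact h2

section
variable {D : ℕ} {χ : DirichletCharacter ℂ D} {p : ℕ} {ψ : DirichletCharacter ℂ p} {Z q : ℂ → ℂ} {X : ℝ}

lemma HH_diff (s : ℂ) : DifferentiableAt ℂ (HH D χ ψ X) s := by
  have h2 : DifferentiableAt ℂ (BB D χ ψ X) s := by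
    unfold BB
    apply DifferentiableAt.fun_sum
    intro n hn
    rw [Finset.mem_Ioc] at hn
    apply DifferentiableAt.const_mul
    have hn0 : (n : ℂ) ≠ 0 := by exact_mod_cast (by omega : n ≠ 0)
    exact (differentiableAt_id.neg).const_cpow (Or.inl hn0)
  exact (F_diff χ ψ s).add h2

lemma R2_diff (c : Ctx D χ ψ Z q X) {s : ℂ} (hs : s.im ≠ 0) : DifferentiableAt ℂ (R2 D χ ψ Z X) s := by
  unfold R2
  have h1 := (hasDerivAt_star (HH_diff (D := D) (χ := χ) (ψ := ψ) (X := X) (1 - (starRingEnd ℂ) s)).hasDerivAt).differentiableAt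
  exact ((c.adiff s).sub (HH_diff s)).sub ((c.zp.der s hs).differentiableAt.mul h1)

lemma log3im (c : Ctx D χ ψ Z q X) {s : ℂ} (h2 : s.im + 4 ≤ 8 * t0 D) (h4 : 4 ≤ s.im) :
    192 * Real.log (3 * s.im) + 68 ≤ 10 ^ 5 * bigL D := by
  have hb := c.big
  have hl : (100:ℝ) ≤ bigL D := h100 hb
  have ht := t0_ge hb
  have e1 : Real.log (3 * s.im) ≤ Real.log (24 * t0 D) := Real.log_le_log (by linarith) (by linarith)
  rw [Real.log_mul (x := 24) (by norm_num) (by linarith)] at e1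
  have e2 : Real.log 24 ≤ 23 := by
    have := Real.log_le_sub_one_of_pos (show (0:ℝ) < 24 by norm_num); linarith
  have e3 : Real.log (t0 D) = 519 * Real.log (bigL D) := by
    unfold t0; rw [Real.log_pow]; norm_num
  have e4 : Real.log (bigL D) ≤ bigL D - 1 := Real.log_le_sub_one_of_pos (by linarith)
  have hb' : (10:ℝ) ^ 20 ≤ bigL D := hb
  norm_num at hb'
  linarith

lemma log_p (c : Ctx D χ ψ Z q X) : |Real.log p - bigL D ^ 9| ≤ 1 := by
  have hP : 0 < bigP D := Real.exp_pos _
  have hp : (0:ℝ) < p := lt_of_lt_of_le hP c.pl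
  have h1 : bigL D ^ 9 ≤ Real.log p := by
    have := Real.log_le_log hP c.pl
    unfold bigP at this
    rwa [Real.log_exp] at this
  have h2 : Real.log p ≤ 1 + bigL D ^ 9 := by
    have := Real.log_le_log hp c.pu
    rw [Real.log_mul (by norm_num) hP.ne'] at this
    unfold bigP at this
    rw [Real.log_exp] at this
    linarith [Real.log_two_lt_d9]
  rw [abs_le]; constructor <;> linarith

lemma Zstrip (c : Ctx D χ ψ Z q X) {s : ℂ} (h1 : -(3/2) ≤ s.re) (h1' : s.re ≤ 5/2) (h2 : s.im + 4 ≤ 8 * t0 D) (h4 : 4 ≤ s.im) :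
    ‖Z s‖ ≤ Real.exp (3 * bigL D ^ 9 * |s.re - 1 / 2|) := by
  refine (c.zp.strip s h4 h1 h1').trans ?_
  apply Real.exp_le_exp.mpr
  have h5 := log3im c h2 h4
  have h6 := (abs_le.mp (log_p c)).2
  have h7 := l9_big c.big
  have h8 : Real.log D = bigL D := rfl
  have h9 := h100 c.big
  rw [h8]
  gcongr
  linarith

lemma exp_big {D : ℕ} (h : 10 ^ 20 ≤ bigL D) (k : ℝ) (hk : k ≤ 10 ^ 10) : k ≤ Real.exp (bigL D ^ 9) := by
  have h1 := l9_big h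
  have := h100 h
  linarith [Real.add_one_le_exp (bigL D ^ 9)]

lemma HH_crude (c : Ctx D χ ψ Z q X) {s : ℂ} (h1 : -(3/2) ≤ s.re) (hs : ‖s - s0 D‖ ≤ 2 * bigL D ^ 405) :
    ‖HH D χ ψ X s‖ ≤ Real.exp (5 * bigL D ^ 9) := by
  have hb := c.big
  have hl : (100:ℝ) ≤ bigL D := h100 hb
  have h9 := l9_big hb
  have hX := X_pos c
  have hX1 := X_one c
  have hD1 : (1:ℝ) ≤ (D:ℝ) ^ 4 := one_le_pow₀ (D_gt hl).le
  have t6 := BB_bound c (K := X ^ 2) s hs (by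
    intro x hx
    have hx1 : 1 ≤ x := hD1.trans hx.1
    have hx0 : 0 ≤ x := by linarith
    have := hx.2
    calc x ^ (-(s.re - 1 / 2)) ≤ x ^ ((2:ℕ):ℝ) := Real.rpow_le_rpow_of_exponent_le hx1 (by norm_num; linarith)
      _ = x ^ 2 := Real.rpow_natCast _ _
      _ ≤ X ^ 2 := by gcongr)
  have t7 := F_crude (χ := χ) (ψ := ψ) (D_nat hl) (s := s) h1
  have t8 := D14_bound c
  have t9 : (bigL D ^ 180)⁻¹ ≤ 1 := inv_le_one_of_one_le₀ (one_le_pow₀ (by linarith))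
  have t10 : X ^ 2 * (bigL D ^ 180)⁻¹ ≤ X ^ 2 := mul_le_of_le_one_right (by positivity) t9
  have t11 := X_sq_le c
  have t12 : Real.exp (2 * bigL D ^ 9 + 1042 * bigL D) ≤ Real.exp (4 * bigL D ^ 9) := Real.exp_le_exp.mpr (by linarith)
  unfold HH
  refine (norm_add_le _ _).trans ?_
  have t13 := exp_big hb 4 (by norm_num)
  calc _ ≤ 4 * Real.exp (4 * bigL D ^ 9) := by linarith
    _ ≤ Real.exp (bigL D ^ 9) * Real.exp (4 * bigL D ^ 9) := by gcongr
    _ = _ := by rw [← Real.exp_add]; congr 1; ring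

lemma AA_crude (c : Ctx D χ ψ Z q X) {s : ℂ} (h1 : 1/2 ≤ s.re) (h1' : s.re ≤ 5/2) (h2 : s.im + 4 ≤ 8 * t0 D) (h4 : 4 ≤ s.im) :
    ‖AA D χ ψ s‖ ≤ Real.exp (9 * bigL D ^ 9) := by
  have hb := c.big
  have hl : (100:ℝ) ≤ bigL D := h100 hb
  have h9 := l9_big hb
  have ht := t0_ge hb
  refine (c.abd s h1).trans ?_
  have e1 : ‖s‖ ≤ Real.exp (bigL D ^ 9) := by
    refine (Complex.norm_le_abs_re_add_abs_im _).trans ?_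
    rw [abs_of_nonneg (by linarith), abs_of_nonneg (by linarith)]
    have h3 : t0 D ≤ Real.exp (519 * bigL D) := by
      have := pow_le_exp (x := bigL D) (by linarith) 519
      exact_mod_cast this
    have h4 : (8:ℝ) ≤ Real.exp (bigL D) := by linarith [Real.add_one_le_exp (bigL D)]
    calc s.re + s.im ≤ 8 * t0 D := by linarith
      _ ≤ Real.exp (bigL D) * Real.exp (519 * bigL D) := by gcongr
      _ = Real.exp (520 * bigL D) := by rw [← Real.exp_add]; congr 1; ring
      _ ≤ _ := Real.exp_le_exp.mpr (by linarith)
  set E := Real.exp (bigL D ^ 9) with hE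
  have hE1 : 10 ≤ E := exp_big hb 10 (by norm_num)
  have hpE : (p:ℝ) ≤ 2 * E := c.pu
  have hDE : (D:ℝ) ≤ E := by
    rw [← exp_bigL hl]; exact Real.exp_le_exp.mpr (by linarith)
  have e2 : (2 * ((p:ℝ) + 1)) ≤ E ^ 2 := by nlinarith
  have e3 : (2 * ((D:ℝ) * p + 1)) ≤ E ^ 3 := by
    have : (D:ℝ) * p ≤ E * (2 * E) := by gcongr
    nlinarith
  calc _ ≤ (E ^ 2 * E) * (E ^ 3 * E) := by gcongr
    _ = E ^ 7 := by ring
    _ ≤ E ^ 9 := pow_le_pow_right₀ (by linarith) (by norm_num)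
    _ = _ := by rw [hE, ← Real.exp_nat_mul]; norm_num

lemma R2_crude (c : Ctx D χ ψ Z q X) {s : ℂ} (h1 : -(3/2) ≤ s.re) (h2 : s.re ≤ 5/2)
    (h3 : |s.im - 2 * Real.pi * t0 D| ≤ bigL1 D + 3 + bigL D ^ 10) :
    ‖R2 D χ ψ Z X s‖ ≤ Real.exp (18 * bigL D ^ 9) := by
  have hb := c.big
  have hl : (100:ℝ) ≤ bigL D := h100 hb
  have key : ∀ z : ℂ, 1/2 ≤ z.re → z.re ≤ 5/2 → |z.im - 2 * Real.pi * t0 D| ≤ bigL1 D + 3 + bigL D ^ 10 →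
      ‖R2 D χ ψ Z X z‖ ≤ Real.exp (12 * bigL D ^ 9) := by
    intro z z1 z2 z3
    obtain ⟨g1, g2, g3, g4⟩ := geom c (by linarith) (by linarith) z3
    have a1 := AA_crude c z1 z2 g2 g4
    have a2 := HH_crude c (s := z) (by linarith) g3
    have a3 := HH_crude c (s := 1 - (starRingEnd ℂ) z) (by rw [star_re]; linarith) (by rw [star_s0]; exact g3)
    have a4 := Zstrip c (s := z) (by linarith) z2 g2 g4
    have a5 : Real.exp (3 * bigL D ^ 9 * |z.re - 1 / 2|) ≤ Real.exp (6 * bigL D ^ 9) := by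
      apply Real.exp_le_exp.mpr
      rw [abs_of_nonneg (by linarith)]
      have : 0 < bigL D ^ 9 := by positivity
      nlinarith
    have a6 : ‖R2 D χ ψ Z X z‖ ≤ Real.exp (9 * bigL D ^ 9) + Real.exp (5 * bigL D ^ 9) + Real.exp (6 * bigL D ^ 9) * Real.exp (5 * bigL D ^ 9) := by
      unfold R2
      refine (norm_sub_le _ _).trans (add_le_add ((norm_sub_le _ _).trans (add_le_add a1 a2)) ?_)
      rw [norm_mul, RCLike.norm_conj]
      gcongr
      exact a4.trans a5
    have hpos : 0 ≤ bigL D ^ 9 := by positivity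
    have b1 : Real.exp (9 * bigL D ^ 9) ≤ Real.exp (11 * bigL D ^ 9) := Real.exp_le_exp.mpr (by linarith)
    have b2 : Real.exp (5 * bigL D ^ 9) ≤ Real.exp (11 * bigL D ^ 9) := Real.exp_le_exp.mpr (by linarith)
    rw [← Real.exp_add, show 6 * bigL D ^ 9 + 5 * bigL D ^ 9 = 11 * bigL D ^ 9 by ring] at a6
    have t13 := exp_big hb 3 (by norm_num)
    calc _ ≤ 3 * Real.exp (11 * bigL D ^ 9) := by linarith
      _ ≤ Real.exp (bigL D ^ 9) * Real.exp (11 * bigL D ^ 9) := by gcongr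
      _ = _ := by rw [← Real.exp_add]; congr 1; ring
  have hpos : 0 ≤ bigL D ^ 9 := by positivity
  rcases le_or_gt (1/2) s.re with hs | hs
  · exact (key s hs h2 h3).trans (Real.exp_le_exp.mpr (by linarith))
  · obtain ⟨g1, g2, g3, g4⟩ := geom c h1 h2 h3
    rw [R2_refl c (by linarith), norm_mul, RCLike.norm_conj]
    have a1 := key (1 - (starRingEnd ℂ) s) (by rw [star_re]; linarith) (by rw [star_re]; linarith) (by rw [star_im]; exact h3)
    have a4 := Zstrip c (s := s) h1 h2 g2 g4
    have a5 : Real.exp (3 * bigL D ^ 9 * |s.re - 1 / 2|) ≤ Real.exp (6 * bigL D ^ 9) := by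
      apply Real.exp_le_exp.mpr
      rw [abs_of_neg (by linarith)]
      nlinarith
    calc _ ≤ Real.exp (6 * bigL D ^ 9) * Real.exp (12 * bigL D ^ 9) := by
          gcongr
          exact a4.trans a5
      _ = _ := by rw [← Real.exp_add]; congr 1; ring

end
end ZS
end

section
namespace ZS
open Complex Set

section
variable {D : ℕ} {χ : DirichletCharacter ℂ D} {p : ℕ} {ψ : DirichletCharacter ℂ p} {Z q : ℂ → ℂ} {X : ℝ}

lemma exp9_le : Real.exp 9 ≤ 10 ^ 4 := by
  have h := Real.exp_one_lt_d9
  have h0 := Real.exp_pos 1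
  have e : Real.exp 9 = Real.exp 1 ^ 9 := by rw [← Real.exp_nat_mul]; norm_num
  rw [e]
  calc Real.exp 1 ^ 9 ≤ 2.7182818286 ^ 9 := by gcongr
    _ ≤ _ := by norm_num

lemma exp13_le : Real.exp 13 ≤ 10 ^ 6 := by
  have h := Real.exp_one_lt_d9
  have h0 := Real.exp_pos 1
  have e : Real.exp 13 = Real.exp 1 ^ 13 := by rw [← Real.exp_nat_mul]; norm_num
  rw [e]
  calc Real.exp 1 ^ 13 ≤ 2.7182818286 ^ 13 := by gcongr
    _ ≤ _ := by norm_num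

lemma exp19_le : Real.exp 19 ≤ 10 ^ 9 := by
  have h := Real.exp_one_lt_d9
  have h0 := Real.exp_pos 1
  have e : Real.exp 19 = Real.exp 1 ^ 19 := by rw [← Real.exp_nat_mul]; norm_num
  rw [e]
  calc Real.exp 1 ^ 19 ≤ 2.7182818286 ^ 19 := by gcongr
    _ ≤ _ := by norm_num

/-- `x ^ a ≤ 10 ^ 6` for `1 ≤ x ≤ X`, `|a| ≤ 2 α`. -/
lemma rpow_small (c : Ctx D χ ψ Z q X) {x a : ℝ} (hx : 1 ≤ x) (hxX : x ≤ X) (ha : a * bigL D ^ 9 ≤ 6.3) : x ^ a ≤ 10 ^ 6 := by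
  have hb := c.big
  have hl : (100:ℝ) ≤ bigL D := h100 hb
  have h9 := l9_big hb
  rcases le_or_gt a 0 with h | h
  · exact (Real.rpow_le_one_of_one_le_of_nonpos hx h).trans (by norm_num)
  · have h1 : X ≤ Real.exp (2 * bigL D ^ 9) := (X_le c).trans (Real.exp_le_exp.mpr (by linarith))
    calc x ^ a ≤ (Real.exp (2 * bigL D ^ 9)) ^ a := by gcongr; linarith
      _ = Real.exp (2 * bigL D ^ 9 * a) := by rw [← Real.exp_mul]
      _ ≤ Real.exp 13 := Real.exp_le_exp.mpr (by nlinarith)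
      _ ≤ _ := exp13_le

lemma R2_small (c : Ctx D χ ψ Z q X) {s : ℂ} (h1 : |s.re - 1/2| * bigL D ^ 9 ≤ 6.3)
    (h3 : |s.im - 2 * Real.pi * t0 D| ≤ bigL1 D + 3) :
    ‖R2 D χ ψ Z X s‖ ≤ (bigL D ^ 178)⁻¹ := by
  have hb := c.big
  have hl : (100:ℝ) ≤ bigL D := h100 hb
  have h9 := l9_big hb
  have hX := X_pos c
  have hX1 := X_one c
  have hη : 0 < (bigL D ^ 179)⁻¹ := by positivity
  set η := (bigL D ^ 179)⁻¹ with hηd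
  have hl10 : 0 < bigL D ^ 10 := by positivity
  have hre : |s.re - 1/2| ≤ 1/2 := by
    have : (0:ℝ) ≤ |s.re - 1/2| := abs_nonneg _
    by_contra hcon
    push Not at hcon
    nlinarith
  rw [abs_le] at hre
  have hX0 : (X:ℂ) ≠ 0 := by exact_mod_cast hX.ne'
  set f : ℂ → ℂ := fun z => R2 D χ ψ Z X z * cexp ((z - s) ^ 2) * (X:ℂ) ^ (z - 1 / 2) with hf
  have hreg : ∀ z : ℂ, z.im ∈ Icc (s.im - bigL D ^ 10) (s.im + bigL D ^ 10) →
      |z.im - 2 * Real.pi * t0 D| ≤ bigL1 D + 3 + bigL D ^ 10 := by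
    intro z hz
    have e : z.im - 2 * Real.pi * t0 D = (s.im - 2 * Real.pi * t0 D) + (z.im - s.im) := by ring
    rw [e]
    refine (abs_add_le _ _).trans (add_le_add h3 ?_)
    rw [abs_le]; constructor <;> linarith [hz.1, hz.2]
  have hnorm : ∀ z : ℂ, ‖f z‖ = ‖R2 D χ ψ Z X z‖ * Real.exp ((z.re - s.re) ^ 2 - (z.im - s.im) ^ 2) * X ^ (z.re - 1 / 2) := by
    intro z
    simp only [hf]
    rw [norm_mul, norm_mul, Complex.norm_exp, Complex.norm_cpow_eq_rpow_re_of_pos hX]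
    congr 2
    · congr 1
      simp [sq]
    · simp
  have h_sq : ∀ z : ℂ, z.re ∈ Icc (-(3/2):ℝ) (5/2) → (z.re - s.re) ^ 2 ≤ 9 := by
    intro z hz
    have : |z.re - s.re| ≤ 3 := by rw [abs_le]; constructor <;> linarith [hz.1, hz.2]
    have := pow_le_pow_left₀ (abs_nonneg _) this 2
    rw [sq_abs] at this
    linarith
  have main : ‖f s‖ ≤ 65536 * Real.exp 9 * η := by
    apply rect_max (a := -(3/2)) (b := 5/2) (c := s.im - bigL D ^ 10) (d := s.im + bigL D ^ 10) (by norm_num) (by linarith)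
    · intro z hz1 hz2
      obtain ⟨g1, g2, g3, g4⟩ := geom c hz1.1 hz1.2 (hreg z hz2)
      have d1 := R2_diff c (s := z) (by linarith)
      have d2 : DifferentiableAt ℂ (fun z : ℂ => cexp ((z - s) ^ 2)) z := by fun_prop
      have d3 : DifferentiableAt ℂ (fun z : ℂ => (X:ℂ) ^ (z - 1 / 2)) z :=
        (differentiableAt_id.sub_const _).const_cpow (Or.inl hX0)
      exact (d1.mul d2).mul d3
    · intro z hz1 hz2
      have hz1' : z.re ∈ Icc (-(3/2):ℝ) (5/2) := by
        rcases hz1 with h | h <;> rw [h] <;> constructor <;> norm_num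
      have e1 : Real.exp ((z.re - s.re) ^ 2 - (z.im - s.im) ^ 2) ≤ Real.exp 9 :=
        Real.exp_le_exp.mpr (by linarith [h_sq z hz1', sq_nonneg (z.im - s.im)])
      rw [hnorm]
      rcases hz1 with h | h
      · have r := R2_left c h (hreg z hz2)
        have ex : X ^ (z.re - 1 / 2) = (X ^ 2)⁻¹ := by
          rw [h, show (-(3/2) - 1/2 : ℝ) = -((2:ℕ):ℝ) by norm_num, Real.rpow_neg hX.le, Real.rpow_natCast]
        rw [ex]
        calc _ ≤ (65536 * X ^ 2 * η) * Real.exp 9 * (X ^ 2)⁻¹ := by gcongr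
          _ = _ := by field_simp
      · have r := R2_right c h (hreg z hz2)
        have ex : X ^ (z.re - 1 / 2) = X ^ 2 := by
          rw [h, show (5/2 - 1/2 : ℝ) = ((2:ℕ):ℝ) by norm_num, Real.rpow_natCast]
        rw [ex]
        calc _ ≤ ‖R2 D χ ψ Z X z‖ * Real.exp 9 * X ^ 2 := by gcongr
          _ = (‖R2 D χ ψ Z X z‖ * X ^ 2) * Real.exp 9 := by ring
          _ ≤ η * Real.exp 9 := by gcongr
          _ ≤ _ := by nlinarith [mul_pos hη (Real.exp_pos 9)]
    · intro z hz1 hz2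
      have hz2' : z.im ∈ Icc (s.im - bigL D ^ 10) (s.im + bigL D ^ 10) := by
        rcases hz2 with h | h <;> rw [h] <;> constructor <;> linarith
      have hsq : (z.im - s.im) ^ 2 = bigL D ^ 20 := by
        rcases hz2 with h | h <;> rw [h] <;> ring
      have r := R2_crude c hz1.1 hz1.2 (hreg z hz2')
      have e1 : Real.exp ((z.re - s.re) ^ 2 - (z.im - s.im) ^ 2) ≤ Real.exp (9 - bigL D ^ 20) :=
        Real.exp_le_exp.mpr (by linarith [h_sq z hz1])
      have e2 : X ^ (z.re - 1 / 2) ≤ Real.exp (3 * bigL D ^ 9) := by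
        calc X ^ (z.re - 1 / 2) ≤ X ^ ((2:ℕ):ℝ) := Real.rpow_le_rpow_of_exponent_le hX1 (by norm_num; linarith [hz1.2])
          _ = X ^ 2 := Real.rpow_natCast _ _
          _ ≤ _ := (X_sq_le c).trans (Real.exp_le_exp.mpr (by linarith))
      have e3 := inv_pow_ge hb 179
      have e4 : 100 * bigL D ^ 9 ≤ bigL D ^ 20 := by
        calc 100 * bigL D ^ 9 ≤ bigL D * bigL D ^ 9 := by gcongr
          _ = bigL D ^ 10 := by ring
          _ ≤ _ := pow_le_pow_right₀ (by linarith) (by norm_num)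
      rw [hnorm]
      calc _ ≤ Real.exp (18 * bigL D ^ 9) * Real.exp (9 - bigL D ^ 20) * Real.exp (3 * bigL D ^ 9) := by gcongr
        _ = Real.exp (21 * bigL D ^ 9 + 9 - bigL D ^ 20) := by
            rw [← Real.exp_add, ← Real.exp_add]; congr 1; ring
        _ ≤ Real.exp (-((179:ℕ) * bigL D)) := by
            apply Real.exp_le_exp.mpr
            push_cast
            linarith
        _ ≤ η := e3
        _ ≤ 65536 * Real.exp 9 * η := by
            have : 1 ≤ Real.exp 9 := Real.one_le_exp (by norm_num)
            nlinarith
    · constructor <;> linarith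
    · constructor <;> linarith
  rw [hnorm] at main
  simp only [sub_self, ne_eq, OfNat.ofNat_ne_zero, not_false_eq_true, zero_pow, Real.exp_zero, mul_one] at main
  have hx2 := rpow_small c hX1 le_rfl (a := -(s.re - 1/2)) (by
    have := neg_abs_le (s.re - 1/2)
    have h0 : 0 < bigL D ^ 9 := by positivity
    nlinarith)
  have e : ‖R2 D χ ψ Z X s‖ = ‖R2 D χ ψ Z X s‖ * X ^ (s.re - 1 / 2) * X ^ (-(s.re - 1/2)) := by
    rw [mul_assoc, ← Real.rpow_add hX]; simp
  have h18 := exp9_le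
  rw [e]
  calc _ ≤ (65536 * Real.exp 9 * η) * 10 ^ 6 := by gcongr
    _ ≤ (65536 * 10 ^ 4 * η) * 10 ^ 6 := by gcongr
    _ ≤ bigL D * η := by
        have : (65536 * 10 ^ 4 * 10 ^ 6 : ℝ) ≤ bigL D := le_trans (by norm_num) hb
        nlinarith
    _ = _ := by rw [hηd]; field_simp

/-- the error term in the short approximate functional equation -/
def EE (D : ℕ) (χ : DirichletCharacter ℂ D) {p : ℕ} (ψ : DirichletCharacter ℂ p) (Z : ℂ → ℂ) (s : ℂ) : ℂ :=
  AA D χ ψ s - Ffun D χ ψ s - Z s * (starRingEnd ℂ) (Ffun D χ ψ (1 - (starRingEnd ℂ) s))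

lemma EE_small (c : Ctx D χ ψ Z q X) {s : ℂ} (h1 : |s.re - 1/2| * bigL D ^ 9 ≤ 6.3)
    (h3 : |s.im - 2 * Real.pi * t0 D| ≤ bigL1 D + 3) :
    ‖EE D χ ψ Z s‖ ≤ (bigL D ^ 177)⁻¹ := by
  have hb := c.big
  have hl : (100:ℝ) ≤ bigL D := h100 hb
  have h9 := l9_big hb
  have hr := R2_small c h1 h3
  have h90 : 0 < bigL D ^ 9 := by positivity
  have hre : |s.re - 1/2| ≤ 1/2 := by
    have : (0:ℝ) ≤ |s.re - 1/2| := abs_nonneg _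
    by_contra hcon
    push Not at hcon
    nlinarith
  rw [abs_le] at hre
  obtain ⟨g1, g2, g3, g4⟩ := geom c (s := s) (by linarith) (by linarith) (by
    have : 0 ≤ bigL D ^ 10 := by positivity
    linarith)
  have hD1 : (1:ℝ) ≤ (D:ℝ) ^ 4 := one_le_pow₀ (D_gt hl).le
  have b1 := BB_bound c (K := 10 ^ 6) s g3 (by
    intro x hx
    apply rpow_small c (hD1.trans hx.1) hx.2
    have := neg_abs_le (s.re - 1/2)
    nlinarith)
  have b2 := BB_bound c (K := 10 ^ 6) (1 - (starRingEnd ℂ) s) (by rw [star_s0]; exact g3) (by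
    intro x hx
    apply rpow_small c (hD1.trans hx.1) hx.2
    rw [star_re]
    have := le_abs_self (s.re - 1/2)
    nlinarith)
  have b3 : ‖Z s‖ ≤ 10 ^ 9 := by
    refine (Zstrip c (by linarith) (by linarith) g2 g4).trans (le_trans (Real.exp_le_exp.mpr ?_) exp19_le)
    linarith
  have e : EE D χ ψ Z s = R2 D χ ψ Z X s + BB D χ ψ X s + Z s * (starRingEnd ℂ) (BB D χ ψ X (1 - (starRingEnd ℂ) s)) := by
    unfold EE R2 HH
    rw [map_add]; ring
  rw [e]
  have hη : 0 < (bigL D ^ 178)⁻¹ := by positivity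
  have hη2 : (bigL D ^ 180)⁻¹ = (bigL D ^ 178)⁻¹ * (bigL D ^ 2)⁻¹ := by rw [← mul_inv, ← pow_add]
  have hη3 : (bigL D ^ 2)⁻¹ ≤ 1 / 10 ^ 20 := by
    rw [← one_div]
    apply one_div_le_one_div_of_le (by norm_num)
    exact hb.trans (le_self_pow₀ (by linarith) (by norm_num))
  set η := (bigL D ^ 178)⁻¹ with hηd
  rw [hη2] at b1 b2
  have hη4 : η * (bigL D ^ 2)⁻¹ ≤ η * (1 / 10 ^ 20) := by gcongr
  have t1 : ‖BB D χ ψ X s‖ ≤ η := b1.trans (by nlinarith)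
  have t2 : ‖Z s * (starRingEnd ℂ) (BB D χ ψ X (1 - (starRingEnd ℂ) s))‖ ≤ η := by
    rw [norm_mul, RCLike.norm_conj]
    calc _ ≤ 10 ^ 9 * (10 ^ 6 * (3 * (η * (bigL D ^ 2)⁻¹))) := by gcongr
      _ ≤ η := by nlinarith
  calc _ ≤ ‖R2 D χ ψ Z X s‖ + ‖BB D χ ψ X s‖ + ‖Z s * (starRingEnd ℂ) (BB D χ ψ X (1 - (starRingEnd ℂ) s))‖ := norm_add₃_le
    _ ≤ η + η + η := by gcongr
    _ ≤ bigL D * η := by nlinarith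
    _ = _ := by rw [hηd]; field_simp

end
end ZS
end

section
namespace ZS
open Complex Set

section
variable {D : ℕ} {χ : DirichletCharacter ℂ D} {p : ℕ} {ψ : DirichletCharacter ℂ p} {Z q : ℂ → ℂ} {X : ℝ}

/-- The point `1/2 + i t`. -/
def ln (t : ℝ) : ℂ := 1 / 2 + (t : ℂ) * I

lemma ln_re (t : ℝ) : (ln t).re = 1 / 2 := by simp [ln]
lemma ln_im (t : ℝ) : (ln t).im = t := by simp [ln]
lemma ln_star (t : ℝ) : 1 - (starRingEnd ℂ) (ln t) = ln t := by
  apply Complex.ext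
  · rw [star_re, ln_re]; norm_num
  · rw [star_im]
lemma ln_der (t : ℝ) : HasDerivAt ln I t := by
  have h := ((Complex.ofRealCLM.hasDerivAt (x := t)).mul_const I).const_add (1 / 2)
  have e : ((fun y : ℝ => 1 / 2 + Complex.ofRealCLM y * I) : ℝ → ℂ) = ln := rfl
  rw [e] at h
  simpa using h
lemma ln_comp {f : ℂ → ℂ} {f' : ℂ} {t : ℝ} (hf : HasDerivAt f f' (ln t)) :
    HasDerivAt (fun u : ℝ => f (ln u)) (f' * I) t := by
  have := hf.comp_of_eq t (ln_der t) rfl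
  exact this

lemma Z_ne (c : Ctx D χ ψ Z q X) {s : ℂ} (hs : s.im ≠ 0) : Z s ≠ 0 := by
  intro h
  have := c.zp.refl s hs
  rw [h, zero_mul] at this
  exact zero_ne_one this

lemma im_ne_open : IsOpen {s : ℂ | s.im ≠ 0} := isOpen_ne_fun Complex.continuous_im continuous_const

lemma q_real (c : Ctx D χ ψ Z q X) {t : ℝ} (ht : t ≠ 0) : (q (ln t)).im = 0 := by
  have hs : (ln t).im ≠ 0 := by rwa [ln_im]
  have d1 := c.zp.der (ln t) hs
  have d2 := hasDerivAt_star (s := ln t) (by rw [ln_star]; exact d1)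
  have d3 := d1.mul d2
  have d4 : HasDerivAt (fun _ : ℂ => (1:ℂ)) 0 (ln t) := hasDerivAt_const _ _
  have d5 := d4.congr_of_eventuallyEq (f₁ := Z * fun z => (starRingEnd ℂ) (Z (1 - (starRingEnd ℂ) z))) (by
    filter_upwards [im_ne_open.mem_nhds hs] with z hz
    exact c.zp.refl z hz)
  have e := d3.unique d5
  rw [ln_star, map_mul] at e
  have hZ := Z_ne c hs
  have hZ' : (starRingEnd ℂ) (Z (ln t)) ≠ 0 := by simpa using hZ
  have e2 : (Z (ln t) * (starRingEnd ℂ) (Z (ln t))) * (q (ln t) - (starRingEnd ℂ) (q (ln t))) = 0 := by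
    rw [← e]; ring
  have e3 := (mul_eq_zero.mp e2).resolve_left (mul_ne_zero hZ hZ')
  exact Complex.conj_eq_iff_im.mp (sub_eq_zero.mp e3).symm

lemma q_cont (c : Ctx D χ ψ Z q X) : ContinuousOn q {s : ℂ | s.im ≠ 0} := by
  have hd : DifferentiableOn ℂ Z {s : ℂ | s.im ≠ 0} := fun s hs => (c.zp.der s hs).differentiableAt.differentiableWithinAt
  have h1 : ContinuousOn (fun s => deriv Z s / Z s) {s : ℂ | s.im ≠ 0} :=
    (hd.deriv im_ne_open).continuousOn.div hd.continuousOn (fun s hs => Z_ne c hs)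
  refine h1.congr ?_
  intro s hs
  have := Z_ne c hs
  change q s = deriv Z s / Z s
  rw [(c.zp.der s hs).deriv]
  field_simp

lemma F_ne (c : Ctx D χ ψ Z q X) {s : ℂ} (h1 : |s.re - 1/2| * bigL D ^ 9 ≤ 1)
    (h3 : |s.im - 2 * Real.pi * t0 D| ≤ bigL1 D + 3) :
    1 ≤ ‖Ffun D χ ψ s‖ * (2 * bigL D ^ 79) := by
  have hb := c.big
  have hl := h100 hb
  have h9 := l9_big hb
  have h0 : (0:ℝ) ≤ |s.re - 1/2| := abs_nonneg _
  have hlog : 1 ≤ Real.log (bigL D) := by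
    rw [Real.le_log_iff_exp_le (by linarith)]
    have := Real.exp_one_lt_d9
    linarith
  have h2 : |s.re - 1/2| ≤ Real.log (bigL D) / (100 * bigL D) := by
    have : |s.re - 1/2| * (100 * bigL D) ≤ 1 := by
      refine le_trans ?_ h1
      gcongr
      linarith
    rw [le_div_iff₀ (by linarith)]
    linarith
  have h5 : |s.re - 1/2| ≤ 1 := by
    have : |s.re - 1/2| * 1 ≤ |s.re - 1/2| * bigL D ^ 9 := by
      gcongr
      exact one_le_pow₀ (by linarith)
    linarith
  have a1 := neg_abs_le (s.re - 1/2)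
  have a2 := le_abs_self (s.re - 1/2)
  exact F_lower χ ψ hl c.I1 c.I3 (by linarith) (by linarith) (by linarith)

lemma F_ne0 (c : Ctx D χ ψ Z q X) {s : ℂ} (h1 : |s.re - 1/2| * bigL D ^ 9 ≤ 1)
    (h3 : |s.im - 2 * Real.pi * t0 D| ≤ bigL1 D + 3) : Ffun D χ ψ s ≠ 0 := by
  intro h
  have := F_ne c h1 h3
  rw [h] at this
  norm_num at this

lemma EE_diff (c : Ctx D χ ψ Z q X) {s : ℂ} (hs : s.im ≠ 0) : DifferentiableAt ℂ (EE D χ ψ Z) s := by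
  have h1 := (hasDerivAt_star (F_diff χ ψ (1 - (starRingEnd ℂ) s)).hasDerivAt).differentiableAt
  exact ((c.adiff s).sub (F_diff χ ψ s)).sub ((c.zp.der s hs).differentiableAt.mul h1)

lemma EF_small (c : Ctx D χ ψ Z q X) {s : ℂ} (h1 : |s.re - 1/2| * bigL D ^ 9 ≤ 1)
    (h3 : |s.im - 2 * Real.pi * t0 D| ≤ bigL1 D + 3) :
    ‖EE D χ ψ Z s / Ffun D χ ψ s‖ ≤ (bigL D ^ 97)⁻¹ := by
  have hl := h100 c.big
  have a1 := EE_small c (h1.trans (by norm_num)) h3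
  have a2 := F_ne c h1 h3
  have hF : 0 < ‖Ffun D χ ψ s‖ := norm_pos_iff.mpr (F_ne0 c h1 h3)
  rw [norm_div, div_le_iff₀ hF]
  refine a1.trans ?_
  have e1 : (bigL D ^ 97)⁻¹ = (bigL D ^ 177)⁻¹ * (bigL D ^ 80) := by
    field_simp
  have e2 : bigL D ^ 80 = bigL D * bigL D ^ 79 := by ring
  rw [e1, mul_assoc]
  have h80 : (2 * bigL D ^ 79) ≤ bigL D ^ 80 := by
    rw [e2]; gcongr; linarith
  have : 1 ≤ bigL D ^ 80 * ‖Ffun D χ ψ s‖ := by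
    refine a2.trans ?_
    rw [mul_comm]
    gcongr
  have h0 : 0 < (bigL D ^ 177)⁻¹ := by positivity
  nlinarith

lemma EF_der (c : Ctx D χ ψ Z q X) {t : ℝ} (ht : |t - 2 * Real.pi * t0 D| ≤ bigL1 D + 2) :
    ‖deriv (fun s => EE D χ ψ Z s / Ffun D χ ψ s) (ln t)‖ ≤ bigL D ^ 9 / 2 := by
  have hl := h100 c.big
  have hR : 0 < (bigL D ^ 9)⁻¹ := by positivity
  have hR1 : (bigL D ^ 9)⁻¹ ≤ 1 := inv_le_one_of_one_le₀ (one_le_pow₀ (by linarith))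
  have key : ∀ z ∈ Metric.closedBall (ln t) ((bigL D ^ 9)⁻¹),
      |z.re - 1/2| * bigL D ^ 9 ≤ 1 ∧ |z.im - 2 * Real.pi * t0 D| ≤ bigL1 D + 3 ∧ z.im ≠ 0 := by
    intro z hz
    rw [Metric.mem_closedBall, Complex.dist_eq] at hz
    have r1 := (Complex.abs_re_le_norm (z - ln t)).trans hz
    have r2 := (Complex.abs_im_le_norm (z - ln t)).trans hz
    rw [sub_re, ln_re] at r1
    rw [sub_im, ln_im] at r2
    have k1 : |z.re - 1/2| * bigL D ^ 9 ≤ 1 := by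
      calc _ ≤ (bigL D ^ 9)⁻¹ * bigL D ^ 9 := by gcongr
        _ = 1 := by field_simp
    have k2 : |z.im - 2 * Real.pi * t0 D| ≤ bigL1 D + 3 := by
      have : z.im - 2 * Real.pi * t0 D = (z.im - t) + (t - 2 * Real.pi * t0 D) := by ring
      rw [this]
      refine (abs_add_le _ _).trans ?_
      linarith
    have k3 := abs_le.mp (r1.trans hR1)
    have := (geom c (s := z) (by linarith) (by linarith) (by
      have : 0 ≤ bigL D ^ 10 := by positivity
      linarith)).2.2.2
    exact ⟨k1, k2, by linarith⟩
  have hd : DiffContOnCl ℂ (fun s => EE D χ ψ Z s / Ffun D χ ψ s) (Metric.ball (ln t) ((bigL D ^ 9)⁻¹)) := by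
    apply DifferentiableOn.diffContOnCl
    rw [closure_ball _ hR.ne']
    intro z hz
    obtain ⟨k1, k2, k3⟩ := key z hz
    exact ((EE_diff c k3).div (F_diff χ ψ z) (F_ne0 c k1 k2)).differentiableWithinAt
  have := Complex.norm_deriv_le_of_forall_mem_sphere_norm_le hR hd (C := (bigL D ^ 97)⁻¹) (by
    intro z hz
    obtain ⟨k1, k2, k3⟩ := key z (Metric.sphere_subset_closedBall hz)
    exact EF_small c k1 k2)
  refine this.trans ?_
  rw [div_inv_eq_mul]
  have : (bigL D ^ 97)⁻¹ ≤ 1/2 := by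
    rw [← one_div]
    apply one_div_le_one_div_of_le (by norm_num)
    exact le_trans (by linarith) (le_self_pow₀ (by linarith : (1:ℝ) ≤ bigL D) (by norm_num : 97 ≠ 0))
  have h90 : 0 < bigL D ^ 9 := by positivity
  nlinarith

lemma main_gap (c : Ctx D χ ψ Z q X) {a b : ℝ} (hab : a < b)
    (ha : |a - 2 * Real.pi * t0 D| < bigL1 D + 2) (hb : |b - 2 * Real.pi * t0 D| < bigL1 D + 2)
    (za : AA D χ ψ (ln a) = 0) (zb : AA D χ ψ (ln b) = 0)
    (hne : ∀ t ∈ Ioo a b, AA D χ ψ (ln t) ≠ 0) :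
    |b - a - Real.pi / bigL D ^ 9| ≤ 5 * (3 * 10 ^ 5 * bigL D + (bigL D ^ 97)⁻¹ * bigL D ^ 9) / (bigL D ^ 9) ^ 2 := by
  have big := c.big
  have hl := h100 big
  have h9 := l9_big big
  have ht : ∀ t ∈ Icc a b, |t - 2 * Real.pi * t0 D| ≤ bigL1 D + 2 := by
    intro t ht
    rw [abs_lt] at ha hb
    rw [abs_le]
    constructor <;> linarith [ht.1, ht.2]
  have hg : ∀ t ∈ Icc a b, (ln t).im + 4 ≤ 8 * t0 D ∧ 4 ≤ (ln t).im := by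
    intro t h
    have := geom c (s := ln t) (by rw [ln_re]; norm_num) (by rw [ln_re]; norm_num) (by
      rw [ln_im]
      have : 0 ≤ bigL D ^ 10 := by positivity
      linarith [ht t h])
    exact ⟨this.2.1, this.2.2.2⟩
  have him : ∀ t ∈ Icc a b, (ln t).im ≠ 0 := fun t h => by linarith [(hg t h).2]
  have k1 : ∀ t : ℝ, |(ln t).re - 1/2| * bigL D ^ 9 ≤ 1 := by
    intro t; rw [ln_re]; norm_num
  have k2 : ∀ t ∈ Icc a b, |(ln t).im - 2 * Real.pi * t0 D| ≤ bigL1 D + 3 := by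
    intro t h; rw [ln_im]; linarith [ht t h]
  have hF : ∀ t ∈ Icc a b, Ffun D χ ψ (ln t) ≠ 0 := fun t h => F_ne0 c (k1 t) (k2 t h)
  have hF' : ∀ t ∈ Icc a b, (starRingEnd ℂ) (Ffun D χ ψ (ln t)) ≠ 0 := fun t h => by simpa using hF t h
  have hZ1 : ∀ t ∈ Icc a b, ‖Z (ln t)‖ = 1 := by
    intro t h
    have := congrArg norm (c.zp.refl (ln t) (him t h))
    rw [ln_star, norm_mul, RCLike.norm_conj, norm_one] at this
    have h0 := norm_nonneg (Z (ln t))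
    nlinarith
  have hphi : ∀ t ∈ Icc a b, ‖deriv (Ffun D χ ψ) (ln t) / Ffun D χ ψ (ln t)‖ ≤ 63600 * bigL D := by
    intro t h
    exact F_logDeriv χ ψ hl c.I1 c.I3 (ln_re t) (by linarith [k2 t h])
  refine spacing (bigL D ^ 9) (3 * 10 ^ 5 * bigL D) ((bigL D ^ 97)⁻¹) a b hab (by positivity) (by positivity)
    (by norm_num at h9 ⊢; linarith) (by positivity) ?_
    (fun t => AA D χ ψ (ln t) / Ffun D χ ψ (ln t))
    (fun t => Z (ln t) * (starRingEnd ℂ) (Ffun D χ ψ (1 - (starRingEnd ℂ) (ln t))) / Ffun D χ ψ (ln t))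
    (fun t => EE D χ ψ Z (ln t) / Ffun D χ ψ (ln t))
    (fun t => deriv (fun s => EE D χ ψ Z s / Ffun D χ ψ s) (ln t) * I)
    (fun t => -(q (ln t)).re + 2 * (deriv (Ffun D χ ψ) (ln t) / Ffun D χ ψ (ln t)).re)
    ?_ ?_ ?_ ?_ ?_ ?_ ?_ ?_ ?_ ?_ ?_ ?_
  · rw [← one_div]
    apply one_div_le_one_div_of_le (by norm_num)
    exact le_trans hl (le_self_pow₀ (by linarith : (1:ℝ) ≤ bigL D) (by norm_num : 97 ≠ 0))
  · intro t h
    have := hF t h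
    unfold EE
    field_simp
    ring
  · intro t h
    have := norm_ne_zero_iff.mpr (hF t h)
    rw [ln_star, norm_div, norm_mul, RCLike.norm_conj, hZ1 t h, one_mul, div_self this]
  · intro t h
    have h1 := hF t h
    have h2 := hF' t h
    have fe := c.zp.fe (ln t) (him t h)
    rw [ln_star] at fe
    rw [ln_star, map_div₀]
    field_simp
    rw [mul_comm]
    exact fe.symm
  · intro t h
    have h1 := hF t h
    have h2 := hF' t h
    have dF := (F_diff χ ψ (ln t)).hasDerivAt
    have dS := hasDerivAt_star (s := ln t) (by rw [ln_star]; exact dF)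
    have dW := ((c.zp.der (ln t) (him t h)).mul dS).div dF h1
    have dW' := ln_comp dW
    refine dW'.congr_deriv ?_
    have hq : ((q (ln t)).re : ℂ) = q (ln t) := by
      apply Complex.ext
      · simp
      · simp [q_real c (t := t) (by have := him t h; rwa [ln_im] at this)]
    have h2re : ((2 * (deriv (Ffun D χ ψ) (ln t) / Ffun D χ ψ (ln t)).re : ℝ) : ℂ) =
        deriv (Ffun D χ ψ) (ln t) / Ffun D χ ψ (ln t) +
          (starRingEnd ℂ) (deriv (Ffun D χ ψ) (ln t)) / (starRingEnd ℂ) (Ffun D χ ψ (ln t)) := by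
      rw [← map_div₀, Complex.add_conj]
    rw [ofReal_add, ofReal_neg, hq, h2re]
    simp only [Pi.mul_apply]
    rw [ln_star]
    field_simp
    ring
  · have hl' : Continuous ln := continuous_iff_continuousAt.mpr fun t => (ln_der t).continuousAt
    have c1 : ContinuousOn (fun t => q (ln t)) (Icc a b) := (q_cont c).comp hl'.continuousOn him
    have dFd : Differentiable ℂ (Ffun D χ ψ) := F_diff χ ψ
    have c2 : ContinuousOn (fun t => deriv (Ffun D χ ψ) (ln t)) (Icc a b) := by
      have : DifferentiableOn ℂ (deriv (Ffun D χ ψ)) univ := dFd.differentiableOn.deriv isOpen_univ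
      exact this.continuousOn.comp hl'.continuousOn (fun _ _ => mem_univ _)
    have c3 : ContinuousOn (fun t => Ffun D χ ψ (ln t)) (Icc a b) := (dFd.continuous.comp hl').continuousOn
    have c4 := c2.div c3 hF
    exact (Complex.continuous_re.comp_continuousOn c1).neg.add
      (continuousOn_const.mul (Complex.continuous_re.comp_continuousOn c4))
  · intro t h
    have e1 := c.zp.q_bd (ln t) (hg t h).2 (by rw [ln_re]; norm_num) (by rw [ln_re]; norm_num)
    have e2 := (Complex.abs_re_le_norm _).trans (e1.trans (log3im c (hg t h).1 (hg t h).2))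
    rw [add_re, ofReal_re] at e2
    have e3 := (Complex.abs_re_le_norm _).trans (hphi t h)
    have e4 := log_p c
    have e5 : Real.log D = bigL D := rfl
    rw [e5] at e2
    rw [abs_le] at e2 e3 e4 ⊢
    norm_num at e2 e3 e4 big ⊢
    constructor <;> linarith
  · intro t h
    exact EF_small c (k1 t) (k2 t h)
  · intro t h
    exact ln_comp (((EE_diff c (him t h)).div (F_diff χ ψ _) (hF t h)).hasDerivAt)
  · intro t h
    rw [norm_mul, norm_I, mul_one]
    exact EF_der c (ht t h)
  · simp [za]
  · simp [zb]
  · intro t h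
    exact div_ne_zero (hne t h) (hF t ⟨h.1.le, h.2.le⟩)

end
end ZS
end

/-- For every `ψ ∈ Ψ₁`, if `1/2 + iγ` and `1/2 + iγ'` are consecutive zeros of
`L(s,ψ)L(s,χψ)` in `Ω` with `γ < γ'`, then `|γ' - γ - α| ≤ C α² 𝓛`. -/
theorem statement12 :
    ∃ C : ℝ, 0 < C ∧ ∃ D₀ : ℕ, ∀ D : ℕ, D₀ ≤ D → ∀ χ : DirichletCharacter ℂ D,
      IsRealChar χ → χ.IsPrimitive →
        ∀ (p : ℕ) (ψ : DirichletCharacter ℂ p), MemPsi1 D χ ψ →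
          ∀ γ γ' : ℝ, γ < γ' →
            InOmega D (1 / 2 + (γ : ℂ) * Complex.I) →
            InOmega D (1 / 2 + (γ' : ℂ) * Complex.I) →
            Lfun ψ (1 / 2 + (γ : ℂ) * Complex.I) *
                Lfun (chiPsi D χ ψ) (1 / 2 + (γ : ℂ) * Complex.I) = 0 →
            Lfun ψ (1 / 2 + (γ' : ℂ) * Complex.I) *
                Lfun (chiPsi D χ ψ) (1 / 2 + (γ' : ℂ) * Complex.I) = 0 →
            (∀ ρ : ℂ, Lfun ψ ρ * Lfun (chiPsi D χ ψ) ρ = 0 → ¬(γ < ρ.im ∧ ρ.im < γ')) →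
            |γ' - γ - alphaD D| ≤ C * alphaD D ^ 2 * bigL D := by
  obtain ⟨L0, hL0⟩ := ZS.exists_ctx
  refine ⟨2 * 10 ^ 6, by norm_num, ⌈Real.exp L0⌉₊ + 1, ?_⟩
  intro D hD χ _ hχ p ψ hψ γ γ' hγ hΩ hΩ' hz hz' hne
  have hD1 : Real.exp L0 ≤ D := by
    refine (Nat.le_ceil _).trans ?_
    exact_mod_cast (by omega : ⌈Real.exp L0⌉₊ ≤ D)
  have hL : L0 ≤ bigL D := by
    unfold bigL
    rw [Real.le_log_iff_exp_le (lt_of_lt_of_le (Real.exp_pos _) hD1)]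
    exact hD1
  obtain ⟨Z, q, X, c⟩ := hL0 D hL χ p ψ hχ hψ
  have big := ZS.h100 c.big
  have conv : ∀ t : ℝ, InOmega D (1 / 2 + (t : ℂ) * Complex.I) → |t - 2 * Real.pi * t0 D| < bigL1 D + 2 := by
    intro t h
    have h2 := h.2
    rw [Complex.sub_im, ZS.s0_im] at h2
    have e : (1 / 2 + (t : ℂ) * Complex.I).im = t := ZS.ln_im t
    rwa [e] at h2
  have key := ZS.main_gap c hγ (conv γ hΩ) (conv γ' hΩ') hz hz' (by
    intro t ht h0
    refine hne (ZS.ln t) h0 ?_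
    rw [ZS.ln_im]
    exact ht)
  have hα : alphaD D = Real.pi / bigL D ^ 9 := by
    unfold alphaD bigP
    rw [Real.log_exp]
  rw [hα]
  refine key.trans ?_
  have h90 : 0 < bigL D ^ 9 := by positivity
  have h1 : (bigL D ^ 97)⁻¹ * bigL D ^ 9 ≤ bigL D := by
    rw [inv_mul_le_iff₀ (by positivity)]
    calc bigL D ^ 9 ≤ bigL D ^ 97 := pow_le_pow_right₀ (by linarith) (by norm_num)
      _ ≤ bigL D ^ 97 * bigL D := le_mul_of_one_le_right (by positivity) (by linarith)
  rw [div_pow, div_le_iff₀ (by positivity)]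
  have e : 2 * 10 ^ 6 * (Real.pi ^ 2 / (bigL D ^ 9) ^ 2) * bigL D * (bigL D ^ 9) ^ 2 = 2 * 10 ^ 6 * Real.pi ^ 2 * bigL D := by
    field_simp
  rw [e]
  have hpi : 1 ≤ Real.pi ^ 2 := one_le_pow₀ (by linarith [Real.pi_gt_three])
  have : 2 * 10 ^ 6 * 1 * bigL D ≤ 2 * 10 ^ 6 * Real.pi ^ 2 * bigL D := by gcongr
  linarith

end
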